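/- Let G = ⟨a, b | w⟩ be any group given by a presentation with two generators and one relator w. Then G is either SQ-universal or residually finite. -/

import Mathlib

/-- A group `G` is SQ-universal if every countable group embeds in a quotient of `G`. -/
def SQUniversal (G : Type*) [Group G] : Prop :=
  ∀ (C : Type) [Group C] [Countable C],
    ∃ (N : Subgroup G) (_ : N.Normal), ∃ f : C →* G ⧸ N, Function.Injective f

/-- A group `G` is residually finite if every non-identity element has non-trivial image
under some homomorphism to a finite group. -/
def ResiduallyFinite (G : Type*) [Group G] : Prop :=
  ∀ g : G, g ≠ 1 → ∃ (Q : Type) (_ : Group Q) (_ : Finite Q), ∃ φ : G →* Q, φ g ≠ 1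

open scoped Classical in
/-- The subgroup of a free group generated by a set of letters. -/
def letterSubgroup {X : Type} (S : Set X) : Subgroup (FreeGroup X) :=
  Subgroup.closure (FreeGroup.of '' S)

open scoped Classical in
/-- The retraction killing all letters outside `S`. -/
noncomputable def letterRetraction {X : Type} (S : Set X) : FreeGroup X →* FreeGroup X :=
  FreeGroup.lift fun x => if x ∈ S then FreeGroup.of x else 1

/-- `r` is conjugate to an element involving only letters from `S`. -/
def ConjInto {X : Type} (r : FreeGroup X) (S : Set X) : Prop :=
  ∃ s ∈ letterSubgroup S, IsConj r s

section letters

variable {X : Type} {S S' : Set X} {r g : FreeGroup X}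

theorem of_mem_letterSubgroup {x : X} (hx : x ∈ S) : FreeGroup.of x ∈ letterSubgroup S :=
  Subgroup.subset_closure ⟨x, hx, rfl⟩

theorem letterSubgroup_mono (h : S ⊆ S') : letterSubgroup S ≤ letterSubgroup S' :=
  Subgroup.closure_mono (Set.image_mono h)

theorem letterSubgroup_univ : letterSubgroup (Set.univ : Set X) = ⊤ := by
  rw [letterSubgroup, Set.image_univ, FreeGroup.closure_range_of]

theorem letterSubgroup_le_iff {K : Subgroup (FreeGroup X)} :
    letterSubgroup S ≤ K ↔ ∀ x ∈ S, FreeGroup.of x ∈ K := by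
  rw [letterSubgroup, Subgroup.closure_le]
  simp [Set.subset_def]

theorem map_letterSubgroup_le_iff {G : Type*} [Group G] {f : FreeGroup X →* G} {K : Subgroup G} :
    (∀ g ∈ letterSubgroup S, f g ∈ K) ↔ ∀ x ∈ S, f (FreeGroup.of x) ∈ K := by
  have : (∀ g ∈ letterSubgroup S, f g ∈ K) ↔ letterSubgroup S ≤ K.comap f := Iff.rfl
  rw [this, letterSubgroup_le_iff]; rfl

theorem eqOn_letterSubgroup {G : Type*} [Group G] {f f' : FreeGroup X →* G}
    (h : ∀ x ∈ S, f (FreeGroup.of x) = f' (FreeGroup.of x)) (hg : g ∈ letterSubgroup S) :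
    f g = f' g := by
  have : letterSubgroup S ≤ f.eqLocus f' := letterSubgroup_le_iff.2 h
  exact this hg

theorem letterRetraction_of_mem {x : X} (hx : x ∈ S) :
    letterRetraction S (FreeGroup.of x) = FreeGroup.of x := by
  simp [letterRetraction, hx]

theorem letterRetraction_of_notMem {x : X} (hx : x ∉ S) :
    letterRetraction S (FreeGroup.of x) = 1 := by
  simp [letterRetraction, hx]

theorem letterRetraction_mem (g : FreeGroup X) : letterRetraction S g ∈ letterSubgroup S := by
  have : ∀ g ∈ letterSubgroup (Set.univ : Set X), letterRetraction S g ∈ letterSubgroup S := by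
    rw [map_letterSubgroup_le_iff]
    intro x _
    by_cases hx : x ∈ S
    · rw [letterRetraction_of_mem hx]; exact of_mem_letterSubgroup hx
    · rw [letterRetraction_of_notMem hx]; exact one_mem _
  exact this g (by rw [letterSubgroup_univ]; trivial)

theorem letterRetraction_eq_self (hg : g ∈ letterSubgroup S) : letterRetraction S g = g :=
  eqOn_letterSubgroup (f' := MonoidHom.id _) (fun _ hx => letterRetraction_of_mem hx) hg

theorem letterRetraction_comp (g : FreeGroup X) :
    letterRetraction S (letterRetraction S' g) = letterRetraction (S ∩ S') g := by
  have : (letterRetraction S).comp (letterRetraction S') = letterRetraction (S ∩ S') := by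
    ext x
    by_cases h' : x ∈ S' <;> by_cases h : x ∈ S <;> simp [letterRetraction, h, h']
  exact DFunLike.congr_fun this g

theorem mem_letterSubgroup_iff : g ∈ letterSubgroup S ↔ letterRetraction S g = g :=
  ⟨letterRetraction_eq_self, fun h => h ▸ letterRetraction_mem g⟩

theorem mem_letterSubgroup_inter (h : g ∈ letterSubgroup S) (h' : g ∈ letterSubgroup S') :
    g ∈ letterSubgroup (S ∩ S') := by
  rw [mem_letterSubgroup_iff, ← letterRetraction_comp, letterRetraction_eq_self h',
    letterRetraction_eq_self h]

theorem letterSubgroup_empty (h : g ∈ letterSubgroup (∅ : Set X)) : g = 1 := by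
  simpa [letterSubgroup] using h

theorem ConjInto.isConj_retraction (h : ConjInto r S) : IsConj r (letterRetraction S r) := by
  obtain ⟨s, hs, hc⟩ := h
  refine hc.trans ?_
  have := (letterRetraction S).map_isConj hc
  rw [letterRetraction_eq_self hs] at this
  exact this.symm

theorem ConjInto.inter (h : ConjInto r S) (h' : ConjInto r S') : ConjInto r (S ∩ S') := by
  refine ⟨letterRetraction (S ∩ S') r, letterRetraction_mem _, ?_⟩
  rw [← letterRetraction_comp]
  exact h.isConj_retraction.trans ((letterRetraction S).map_isConj h'.isConj_retraction)

theorem ConjInto.mono (hS : S ⊆ S') (h : ConjInto r S) : ConjInto r S' := by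
  obtain ⟨s, hs, hc⟩ := h
  exact ⟨s, letterSubgroup_mono hS hs, hc⟩

theorem ConjInto.of_isConj {r' : FreeGroup X} (hc : IsConj r r') (h : ConjInto r S) :
    ConjInto r' S := by
  obtain ⟨s, hs, hc'⟩ := h
  exact ⟨s, hs, hc.symm.trans hc'⟩

theorem isConj_iff_of_conjInto {r' : FreeGroup X} (hc : IsConj r r') :
    ConjInto r S ↔ ConjInto r' S :=
  ⟨.of_isConj hc, .of_isConj hc.symm⟩

theorem conjInto_of_mem (h : r ∈ letterSubgroup S) : ConjInto r S := ⟨r, h, IsConj.refl r⟩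

theorem ConjInto.compl_finset (s : Finset X) (h : ∀ x ∈ s, ConjInto r {x}ᶜ) :
    ConjInto r {x | x ∉ s} := by
  classical
  induction s using Finset.induction_on with
  | empty =>
    exact conjInto_of_mem (by
      have : {x : X | x ∉ (∅ : Finset X)} = Set.univ := by ext; simp
      rw [this, letterSubgroup_univ]; trivial)
  | insert a s ha ih =>
    have h1 := (h a (by simp)).inter (ih fun x hx => h x (by simp [hx]))
    refine h1.mono ?_
    intro x hx
    simpa using hx

theorem exists_finset_letterSubgroup (g : FreeGroup X) :
    ∃ s : Finset X, g ∈ letterSubgroup (s : Set X) := by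
  classical
  induction g using FreeGroup.induction_on with
  | C1 => exact ⟨∅, one_mem _⟩
  | of x => exact ⟨{x}, of_mem_letterSubgroup (by simp)⟩
  | inv_of x h => obtain ⟨s, hs⟩ := h; exact ⟨s, inv_mem hs⟩
  | mul a b ha hb =>
    obtain ⟨s, hs⟩ := ha
    obtain ⟨u, hu⟩ := hb
    exact ⟨s ∪ u, mul_mem (letterSubgroup_mono (by simp) hs) (letterSubgroup_mono (by simp) hu)⟩

/-- The set of letters that cannot be removed by conjugation. -/
theorem ConjInto.essential (r : FreeGroup X) : ConjInto r {x | ¬ ConjInto r {x}ᶜ} := by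
  classical
  obtain ⟨s, hs⟩ := exists_finset_letterSubgroup r
  have h1 := ConjInto.compl_finset (r := r) (s.filter fun x => ConjInto r {x}ᶜ)
    (fun x hx => (Finset.mem_filter.1 hx).2)
  refine (h1.inter (conjInto_of_mem hs)).mono ?_
  rintro x ⟨hx, hx'⟩ h
  exact hx (Finset.mem_filter.2 ⟨hx', h⟩)

theorem finite_essential (r : FreeGroup X) : {x | ¬ ConjInto r {x}ᶜ}.Finite := by
  obtain ⟨s, hs⟩ := exists_finset_letterSubgroup r
  refine s.finite_toSet.subset fun x hx => ?_
  by_contra hxs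
  exact hx (conjInto_of_mem (letterSubgroup_mono (fun y hy => by
    rintro rfl; exact hxs hy) hs))

end letters

/-- Exponent sum of a letter. -/
noncomputable def expSum {X : Type} (x : X) : FreeGroup X →* Multiplicative ℤ := by
  classical exact FreeGroup.lift fun y => Multiplicative.ofAdd (if y = x then 1 else 0)

section norm

variable {X : Type}

theorem expSum_of_self (x : X) : expSum x (FreeGroup.of x) = Multiplicative.ofAdd 1 := by
  simp [expSum]

theorem expSum_of_ne {x y : X} (h : y ≠ x) : expSum x (FreeGroup.of y) = 1 := by
  simp [expSum, h]

theorem expSum_eq_one {x : X} {S : Set X} (hx : x ∉ S) {g : FreeGroup X}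
    (hg : g ∈ letterSubgroup S) : expSum x g = 1 :=
  eqOn_letterSubgroup (f := expSum x) (f' := 1)
    (fun y hy => by rw [expSum_of_ne (by rintro rfl; exact hx hy)]; rfl) hg

/-- The word length on a free group. -/
noncomputable def freeLen (g : FreeGroup X) : ℕ := by classical exact g.norm

theorem freeLen_eq_norm [DecidableEq X] (g : FreeGroup X) : freeLen g = g.norm := by
  unfold freeLen
  convert! rfl

theorem freeLen_one : freeLen (1 : FreeGroup X) = 0 := by
  classical rw [freeLen_eq_norm, FreeGroup.norm_one]

theorem freeLen_of (x : X) : freeLen (FreeGroup.of x) = 1 := by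
  classical rw [freeLen_eq_norm, FreeGroup.norm_of]

theorem freeLen_inv (g : FreeGroup X) : freeLen g⁻¹ = freeLen g := by
  classical rw [freeLen_eq_norm, freeLen_eq_norm, FreeGroup.norm_inv_eq]

theorem freeLen_mul_le (g h : FreeGroup X) : freeLen (g * h) ≤ freeLen g + freeLen h := by
  classical
  rw [freeLen_eq_norm, freeLen_eq_norm, freeLen_eq_norm]
  exact FreeGroup.norm_mul_le g h

theorem freeLen_map_le {Y : Type} (f : X → Y) (g : FreeGroup X) :
    freeLen (FreeGroup.map f g) ≤ freeLen g := by
  classical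
  rw [freeLen_eq_norm, freeLen_eq_norm, ← FreeGroup.mk_toWord (x := g), FreeGroup.map.mk]
  refine FreeGroup.norm_mk_le.trans ?_
  simp [FreeGroup.norm]

/-- A subadditive length function pulled back to a free group is bounded by the norm, with a gap
if a letter of length zero is essential. -/
theorem length_lt_freeLen {G : Type*} [Group G] (f : FreeGroup X →* G) (ℓ : G → ℕ)
    (h1 : ℓ 1 = 0) (hmul : ∀ a b, ℓ (a * b) ≤ ℓ a + ℓ b) (hinv : ∀ a, ℓ a⁻¹ = ℓ a)
    (hle : ∀ x, ℓ (f (FreeGroup.of x)) ≤ 1) :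
    (∀ g, ℓ (f g) ≤ freeLen g) ∧ ∀ y, ℓ (f (FreeGroup.of y)) = 0 → ∀ g,
      g ∉ letterSubgroup ({y}ᶜ : Set X) → ℓ (f g) < freeLen g := by
  have key : ∀ L : List (X × Bool), ℓ (f (FreeGroup.mk L)) ≤ L.length ∧
      ∀ y, ℓ (f (FreeGroup.of y)) = 0 → FreeGroup.mk L ∉ letterSubgroup ({y}ᶜ : Set X) →
        ℓ (f (FreeGroup.mk L)) < L.length := by
    intro L
    induction L with
    | nil =>
      refine ⟨by simp [← FreeGroup.one_eq_mk, h1], fun y _ h => (h ?_).elim⟩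
      rw [← FreeGroup.one_eq_mk]; exact one_mem _
    | cons p L ih =>
      have hp : FreeGroup.mk (p :: L) = FreeGroup.mk [p] * FreeGroup.mk L := by
        rw [FreeGroup.mul_mk]; rfl
      have hlet : ∃ e : FreeGroup X, FreeGroup.mk [p] = e ∧
          (e = FreeGroup.of p.1 ∨ e = (FreeGroup.of p.1)⁻¹) := by
        obtain ⟨x, b⟩ := p
        cases b
        · exact ⟨_, rfl, Or.inr (by simp [FreeGroup.of, FreeGroup.inv_mk, FreeGroup.invRev])⟩
        · exact ⟨_, rfl, Or.inl rfl⟩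
      obtain ⟨e, he, he'⟩ := hlet
      have hℓ : ℓ (f e) = ℓ (f (FreeGroup.of p.1)) := by
        rcases he' with h | h <;> simp [h, hinv]
      rw [hp, he, map_mul]
      have hm := hmul (f e) (f (FreeGroup.mk L))
      have hl := hle p.1
      refine ⟨by simp only [List.length_cons]; omega, fun y hy hn => ?_⟩
      by_cases hpy : p.1 = y
      · rw [hpy] at hℓ; simp only [List.length_cons]; omega
      · have : FreeGroup.mk L ∉ letterSubgroup ({y}ᶜ : Set X) := by
          intro h
          refine hn (mul_mem ?_ h)
          have : FreeGroup.of p.1 ∈ letterSubgroup ({y}ᶜ : Set X) :=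
            of_mem_letterSubgroup (by simpa using hpy)
          rcases he' with h | h
          · rw [h]; exact this
          · rw [h]; exact inv_mem this
        have := ih.2 y hy this
        simp only [List.length_cons]; omega
  classical
  refine ⟨fun g => ?_, fun y hy g hg => ?_⟩
  · have := (key g.toWord).1
    rw [FreeGroup.mk_toWord] at this
    rw [freeLen_eq_norm]; exact this
  · have := (key g.toWord).2 y hy
    rw [FreeGroup.mk_toWord] at this
    rw [freeLen_eq_norm]; exact this hg

theorem freeLen_letterRetraction_le (S : Set X) (g : FreeGroup X) :
    freeLen (letterRetraction S g) ≤ freeLen g := by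
  refine (length_lt_freeLen (letterRetraction S) freeLen freeLen_one
    freeLen_mul_le freeLen_inv fun x => ?_).1 g
  by_cases hx : x ∈ S
  · rw [letterRetraction_of_mem hx, freeLen_of]
  · rw [letterRetraction_of_notMem hx, freeLen_one]; exact zero_le_one

end norm

section euclid

variable {X : Type}

/-- The automorphism `u ↦ u v^k` of a free group. -/
theorem exists_transvection {u v : X} (h : u ≠ v) (k : ℤ) :
    ∃ e : FreeGroup X ≃* FreeGroup X, e (FreeGroup.of u) = FreeGroup.of u * FreeGroup.of v ^ k ∧
      ∀ x, x ≠ u → e (FreeGroup.of x) = FreeGroup.of x := by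
  classical
  have key : ∀ k : ℤ, ∃ f : FreeGroup X →* FreeGroup X,
      f (FreeGroup.of u) = FreeGroup.of u * FreeGroup.of v ^ k ∧
      ∀ x, x ≠ u → f (FreeGroup.of x) = FreeGroup.of x := fun k =>
    ⟨FreeGroup.lift fun x => if x = u then FreeGroup.of u * FreeGroup.of v ^ k else FreeGroup.of x,
      by simp, fun x hx => by simp [hx]⟩
  obtain ⟨f, hf, hf'⟩ := key k
  obtain ⟨f', hf1, hf1'⟩ := key (-k)
  refine ⟨MonoidHom.toMulEquiv f f' ?_ ?_, hf, hf'⟩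
  · ext x
    by_cases hx : x = u
    · subst hx; simp [hf, hf1, hf1' v h.symm]
    · simp [hf' x hx, hf1' x hx]
  · ext x
    by_cases hx : x = u
    · subst hx; simp [hf, hf1, hf' v h.symm]
    · simp [hf' x hx, hf1' x hx]

theorem hom_apply_eq_expSum {M : Type*} [CommGroup M] {u v : X} (h : u ≠ v)
    {f : FreeGroup X →* M} {g : FreeGroup X} (hg : g ∈ letterSubgroup ({u, v} : Set X)) :
    f g = f (FreeGroup.of u) ^ (expSum u g).toAdd * f (FreeGroup.of v) ^ (expSum v g).toAdd := by
  let f' : FreeGroup X →* M :=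
    ((zpowersHom M (f (FreeGroup.of u))).comp (expSum u)) *
      ((zpowersHom M (f (FreeGroup.of v))).comp (expSum v))
  refine eqOn_letterSubgroup (f := f) (f' := f') ?_ hg
  rintro x (rfl | rfl)
  · simp [f', expSum_of_self, expSum_of_ne h]
  · simp [f', expSum_of_self, expSum_of_ne h.symm]

theorem expSum_transvection {u v : X} (h : u ≠ v) (k : ℤ) {e : FreeGroup X ≃* FreeGroup X}
    (hu : e (FreeGroup.of u) = FreeGroup.of u * FreeGroup.of v ^ k)
    (he : ∀ x, x ≠ u → e (FreeGroup.of x) = FreeGroup.of x) (g : FreeGroup X) :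
    expSum u (e g) = expSum u g ∧ expSum v (e g) = expSum v g * expSum u g ^ k := by
  constructor
  · refine DFunLike.congr_fun (f := (expSum u).comp e.toMonoidHom) ?_ g
    ext x
    by_cases hx : x = u
    · subst hx; simp [hu, expSum_of_self, expSum_of_ne h.symm]
    · simp [he x hx]
  · refine DFunLike.congr_fun (f := (expSum v).comp e.toMonoidHom)
      (g := expSum v * (zpowGroupHom k).comp (expSum u)) ?_ g
    ext x
    by_cases hx : x = u
    · subst hx; simp [hu, expSum_of_self, expSum_of_ne h]
    · simp [he x hx, expSum_of_ne hx]

/-- By Euclid's algorithm an exponent sum can be made to vanish by an automorphism that only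
involves two given letters. -/
theorem exists_equiv_expSum_eq_one {u v : X} (h : u ≠ v) (r : FreeGroup X) :
    ∃ e : FreeGroup X ≃* FreeGroup X, expSum u (e r) = 1 ∧
      (∀ x, x ≠ u → x ≠ v → e (FreeGroup.of x) = FreeGroup.of x) ∧
      (∀ x ∈ ({u, v} : Set X), e (FreeGroup.of x) ∈ letterSubgroup ({u, v} : Set X)) ∧
      (∀ x ∈ ({u, v} : Set X), e.symm (FreeGroup.of x) ∈ letterSubgroup ({u, v} : Set X)) := by
  have main : ∀ (N : ℕ) (u v : X), u ≠ v → ∀ r : FreeGroup X,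
      (expSum u r).toAdd.natAbs ≤ N →
      ∃ e : FreeGroup X ≃* FreeGroup X, (expSum u (e r) = 1 ∨ expSum v (e r) = 1) ∧
      (∀ x, x ≠ u → x ≠ v → e (FreeGroup.of x) = FreeGroup.of x) ∧
      (∀ x ∈ ({u, v} : Set X), e (FreeGroup.of x) ∈ letterSubgroup ({u, v} : Set X)) ∧
      (∀ x ∈ ({u, v} : Set X), e.symm (FreeGroup.of x) ∈ letterSubgroup ({u, v} : Set X)) := by
    intro N
    induction N with
    | zero =>
      intro u v _ r hr
      refine ⟨MulEquiv.refl _, Or.inl ?_, fun _ _ _ => rfl, fun x hx => of_mem_letterSubgroup hx,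
        fun x hx => of_mem_letterSubgroup hx⟩
      simpa using hr
    | succ N ih =>
      intro u v h r hr
      by_cases h0 : expSum u r = 1
      · exact ⟨MulEquiv.refl _, Or.inl h0, fun _ _ _ => rfl, fun x hx => of_mem_letterSubgroup hx,
          fun x hx => of_mem_letterSubgroup hx⟩
      have ha : (expSum u r).toAdd ≠ 0 := fun h => h0 (by simpa using h)
      obtain ⟨e, heu, he⟩ := exists_transvection h
        (-((expSum v r).toAdd / (expSum u r).toAdd))
      have hs := expSum_transvection h _ heu he r
      have hv : (expSum v (e r)).toAdd.natAbs ≤ N := by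
        have h1 : (expSum v (e r)).toAdd = (expSum v r).toAdd % (expSum u r).toAdd := by
          rw [hs.2, toAdd_mul, toAdd_zpow, Int.emod_def]
          simp only [smul_eq_mul]; ring
        have h2 := Int.emod_nonneg (expSum v r).toAdd ha
        have h3 := Int.emod_lt (expSum v r).toAdd ha
        omega
      obtain ⟨e', h1, h2, h3, h4⟩ := ih v u h.symm (e r) hv
      have hsw : ({v, u} : Set X) = {u, v} := Set.pair_comm v u
      rw [hsw] at h3 h4
      have hmem : ∀ x ∈ ({u, v} : Set X), e (FreeGroup.of x) ∈ letterSubgroup ({u, v} : Set X) := by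
        rintro x (rfl | rfl)
        · rw [heu]
          exact mul_mem (of_mem_letterSubgroup (by simp))
            (zpow_mem (of_mem_letterSubgroup (by simp)) _)
        · rw [he x h.symm]; exact of_mem_letterSubgroup (by simp)
      have hev : e.symm (FreeGroup.of v) = FreeGroup.of v := by
        rw [MulEquiv.symm_apply_eq, he v h.symm]
      have hmem' : ∀ x ∈ ({u, v} : Set X),
          e.symm (FreeGroup.of x) ∈ letterSubgroup ({u, v} : Set X) := by
        rintro x (rfl | rfl)
        · have : e.symm (FreeGroup.of x) =
              FreeGroup.of x * (FreeGroup.of v ^ (-((expSum v r).toAdd / (expSum x r).toAdd)))⁻¹ := by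
            rw [MulEquiv.symm_apply_eq, map_mul, heu, map_inv, map_zpow, he v h.symm]; group
          rw [this]
          exact mul_mem (of_mem_letterSubgroup (by simp))
            (inv_mem (zpow_mem (of_mem_letterSubgroup (by simp)) _))
        · rw [hev]; exact of_mem_letterSubgroup (by simp)
      refine ⟨e.trans e', ?_, fun x hx hx' => ?_, fun x hx => ?_, fun x hx => ?_⟩
      · exact h1.symm
      · simp [he x hx, h2 x hx' hx]
      · exact map_letterSubgroup_le_iff (f := e'.toMonoidHom).2 h3 _ (hmem x hx)
      · exact map_letterSubgroup_le_iff (f := e.symm.toMonoidHom).2 hmem' _ (h4 x hx)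
  obtain ⟨e, h1, h2, h3, h4⟩ := main _ u v h r le_rfl
  rcases h1 with h1 | h1
  · exact ⟨e, h1, h2, h3, h4⟩
  · classical
    let s : FreeGroup X ≃* FreeGroup X := FreeGroup.freeGroupCongr (Equiv.swap u v)
    have hs : ∀ x, s (FreeGroup.of x) = FreeGroup.of (Equiv.swap u v x) := fun x => by simp [s]
    have hs' : ∀ x, s.symm (FreeGroup.of x) = FreeGroup.of (Equiv.swap u v x) := fun x => by
      rw [MulEquiv.symm_apply_eq, hs, Equiv.swap_apply_self]
    have hswap : ∀ x ∈ ({u, v} : Set X), Equiv.swap u v x ∈ ({u, v} : Set X) := by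
      rintro x (rfl | rfl) <;> simp
    refine ⟨e.trans s, ?_, fun x hx hx' => ?_, fun x hx => ?_, fun x hx => ?_⟩
    · rw [← h1]
      refine DFunLike.congr_fun (f := (expSum u).comp s.toMonoidHom) (g := expSum v) ?_ (e r)
      ext x
      by_cases hxv : x = v
      · subst hxv; simp [hs, expSum_of_self]
      · have : Equiv.swap u v x ≠ u := by
          rw [Ne, Equiv.swap_apply_eq_iff, Equiv.swap_apply_left]; exact hxv
        simp [hs, expSum_of_ne this, expSum_of_ne hxv]
    · simp [h2 x hx hx', hs, Equiv.swap_apply_of_ne_of_ne hx hx']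
    · exact map_letterSubgroup_le_iff (f := s.toMonoidHom).2
        (fun y hy => by simpa [hs] using of_mem_letterSubgroup (hswap y hy)) _ (h3 x hx)
    · have : (e.trans s).symm (FreeGroup.of x) = e.symm (FreeGroup.of (Equiv.swap u v x)) := by
        rw [← hs']; rfl
      rw [this]; exact h4 _ (hswap x hx)

end euclid

/-- Half-space data for an HNN extension with base `H`, associated subgroups `A`, `B` and stable
letter `t`: `P` consists of the elements with a normal form starting with `t`, and `N` of those
with a normal form starting with `t⁻¹`. -/
structure HalfSpaces {Γ : Type} [Group Γ] (H A B : Subgroup Γ) (t : Γ) (P N : Set Γ) : Prop where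
  leA : A ≤ H
  leB : B ≤ H
  conjA : ∀ a ∈ A, t * a * t⁻¹ ∈ B
  conjB : ∀ b ∈ B, t⁻¹ * b * t ∈ A
  base_notMem_pos : ∀ h ∈ H, h ∉ P
  base_notMem_neg : ∀ h ∈ H, h ∉ N
  mul_mem_pos_iff : ∀ g, t * g ∈ P ↔ g ∉ N
  base_mul_mem_pos : ∀ g ∈ P, ∀ h ∈ H, (h * g ∈ P ↔ h ∈ B)
  base_mul_mem_neg : ∀ g ∈ N, ∀ h ∈ H, (h * g ∈ N ↔ h ∈ A)
  base_mul_pos : ∀ g ∈ P, ∀ h ∈ H, h * g ∉ N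
  base_mul_neg : ∀ g ∈ N, ∀ h ∈ H, h * g ∉ P

namespace HalfSpaces

variable {Γ : Type} [Group Γ] {H A B : Subgroup Γ} {t : Γ} {P N : Set Γ}

theorem symm (S : HalfSpaces H A B t P N) : HalfSpaces H B A t⁻¹ N P where
  leA := S.leB
  leB := S.leA
  conjA := by simpa using S.conjB
  conjB := by simpa using S.conjA
  base_notMem_pos := S.base_notMem_neg
  base_notMem_neg := S.base_notMem_pos
  mul_mem_pos_iff g := by
    have := S.mul_mem_pos_iff (t⁻¹ * g)
    rw [mul_inv_cancel_left] at this
    tauto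
  base_mul_mem_pos := S.base_mul_mem_neg
  base_mul_mem_neg := S.base_mul_mem_pos
  base_mul_pos := S.base_mul_neg
  base_mul_neg := S.base_mul_pos

theorem one_notMem_pos (S : HalfSpaces H A B t P N) : 1 ∉ P := S.base_notMem_pos 1 (one_mem _)

theorem one_notMem_neg (S : HalfSpaces H A B t P N) : 1 ∉ N := S.base_notMem_neg 1 (one_mem _)

theorem t_mem (S : HalfSpaces H A B t P N) : t ∈ P := by
  have := (S.mul_mem_pos_iff 1).2 S.one_notMem_neg
  rwa [mul_one] at this

theorem inv_mul_mem_neg_iff (S : HalfSpaces H A B t P N) (g : Γ) :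
    t⁻¹ * g ∈ N ↔ g ∉ P := S.symm.mul_mem_pos_iff g

theorem notMem_neg_of_mem_pos (S : HalfSpaces H A B t P N) {g : Γ} (hg : g ∈ P) : g ∉ N := by
  simpa using S.base_mul_pos g hg 1 (one_mem _)

/-- Elements of `H \ B` move `P` off itself. -/
theorem mul_notMem_pos (S : HalfSpaces H A B t P N) {h g : Γ} (hh : h ∈ H) (hB : h ∉ B)
    (hg : g ∈ P) : h * g ∉ P :=
  fun hP => hB ((S.base_mul_mem_pos g hg h hh).1 hP)

/-- Elements of `tHt⁻¹ \ B` move the complement of `P` into `P`. -/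
theorem conj_mul_mem_pos (S : HalfSpaces H A B t P N) {h g : Γ} (hh : h ∈ H) (hA : h ∉ A)
    (hg : g ∉ P) :
    t * h * t⁻¹ * g ∈ P := by
  have h1 := (S.inv_mul_mem_neg_iff g).2 hg
  have h2 : h * (t⁻¹ * g) ∉ N := fun hN => hA ((S.base_mul_mem_neg _ h1 h hh).1 hN)
  have := (S.mul_mem_pos_iff _).2 h2
  simpa [mul_assoc] using this

/-- Britton's lemma for conjugation by powers of the stable letter. -/
theorem mem_of_conj_pow_mem (S : HalfSpaces H A B t P N) {k : ℕ} (hk : k ≠ 0) {h : Γ} (hh : h ∈ H)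
    (hc : t ^ k * h * (t ^ k)⁻¹ ∈ H) : h ∈ A := by
  by_contra hA
  obtain ⟨k, rfl⟩ := Nat.exists_eq_succ_of_ne_zero hk
  have aux : ∀ (j : ℕ) (g : Γ), g ∉ P → (t ^ j)⁻¹ * g ∉ P := by
    intro j
    induction j with
    | zero => simp
    | succ j ih =>
      intro g hg
      have h1 := (S.inv_mul_mem_neg_iff g).2 hg
      rw [pow_succ', mul_inv_rev, mul_assoc]
      exact ih _ (S.symm.notMem_neg_of_mem_pos h1)
  have aux' : ∀ (j : ℕ) (g : Γ), g ∈ P → t ^ j * g ∈ P := by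
    intro j
    induction j with
    | zero => simp
    | succ j ih =>
      intro g hg
      rw [pow_succ', mul_assoc, S.mul_mem_pos_iff]
      exact S.notMem_neg_of_mem_pos (ih g hg)
  have h1 := S.conj_mul_mem_pos hh hA (aux k 1 S.one_notMem_pos)
  have h2 := aux' k _ h1
  refine S.base_notMem_pos _ hc ?_
  have e : t ^ (k + 1) * h * (t ^ (k + 1))⁻¹ = t ^ k * (t * h * t⁻¹ * ((t ^ k)⁻¹ * 1)) := by
    rw [pow_succ]; group
  rwa [Nat.succ_eq_add_one, e]

theorem mem_of_inv_conj_pow_mem (S : HalfSpaces H A B t P N) {k : ℕ} (hk : k ≠ 0) {h : Γ}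
    (hh : h ∈ H)
    (hc : (t ^ k)⁻¹ * h * t ^ k ∈ H) : h ∈ B :=
  S.symm.mem_of_conj_pow_mem hk hh (by simpa using hc)

end HalfSpaces

open HNNExtension in
theorem HNNExtension.halfSpaces {Q : Type} [Group Q] (A B : Subgroup Q) (φ : A ≃* B) :
    ∃ P N : Set (HNNExtension Q A B φ),
      HalfSpaces (of : Q →* HNNExtension Q A B φ).range (A.map of) (B.map of) t P N := by
  obtain ⟨d⟩ := NormalWord.TransversalPair.nonempty Q A B
  have hbase : ∀ (h : Q) (u : ℤˣ) (g : HNNExtension Q A B φ),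
      NormalWord.Cancels u (g • (NormalWord.empty : NormalWord d)) →
      ∀ u', NormalWord.Cancels u' ((of h * g) • (NormalWord.empty : NormalWord d)) ↔
        (u = u' ∧ h ∈ toSubgroup A B u) := by
    intro h u g hg u'
    rw [mul_smul, NormalWord.of_smul_eq_smul]
    simp only [NormalWord.Cancels, NormalWord.group_smul_head, NormalWord.group_smul_toList,
      hg.2, Option.some.injEq, neg_inj]
    constructor
    · rintro ⟨h1, rfl⟩
      exact ⟨rfl, (Subgroup.mul_mem_cancel_right _ hg.1).1 h1⟩
    · rintro ⟨rfl, h1⟩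
      exact ⟨mul_mem h1 hg.1, rfl⟩
  have hone : ∀ (h : Q) (u : ℤˣ),
      ¬ NormalWord.Cancels u ((of h : HNNExtension Q A B φ) • (NormalWord.empty : NormalWord d)) := by
    intro h u hc
    rw [NormalWord.of_smul_eq_smul] at hc
    simpa using hc.2
  have hinj := of_injective (G := Q) (A := A) (B := B) φ
  refine ⟨{g | NormalWord.Cancels (-1) (g • (NormalWord.empty : NormalWord d))},
    {g | NormalWord.Cancels 1 (g • (NormalWord.empty : NormalWord d))}, ?_⟩
  refine
    { leA := Subgroup.map_le_range _ _
      leB := Subgroup.map_le_range _ _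
      conjA := ?_
      conjB := ?_
      base_notMem_pos := ?_
      base_notMem_neg := ?_
      mul_mem_pos_iff := ?_
      base_mul_mem_pos := ?_
      base_mul_mem_neg := ?_
      base_mul_pos := ?_
      base_mul_neg := ?_ }
  · rintro _ ⟨a, ha, rfl⟩
    exact ⟨φ ⟨a, ha⟩, (φ ⟨a, ha⟩).2, equiv_eq_conj (φ := φ) ⟨a, ha⟩⟩
  · rintro _ ⟨b, hb, rfl⟩
    exact ⟨φ.symm ⟨b, hb⟩, (φ.symm ⟨b, hb⟩).2, equiv_symm_eq_conj (φ := φ) ⟨b, hb⟩⟩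
  · rintro _ ⟨h, rfl⟩; exact hone h _
  · rintro _ ⟨h, rfl⟩; exact hone h _
  · intro g
    simp only [Set.mem_ofPred_eq, mul_smul, NormalWord.t_smul_eq_unitsSMul]
    exact NormalWord.unitsSMul_cancels_iff φ 1 _
  · rintro g hg _ ⟨h, rfl⟩
    simp only [Set.mem_ofPred_eq]
    rw [hbase h _ g hg]
    simp [Subgroup.mem_map, hinj.eq_iff]
  · rintro g hg _ ⟨h, rfl⟩
    simp only [Set.mem_ofPred_eq]
    rw [hbase h _ g hg]
    simp [Subgroup.mem_map, hinj.eq_iff]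
  · rintro g hg _ ⟨h, rfl⟩
    simp only [Set.mem_ofPred_eq]
    rw [hbase h _ g hg]
    simp
  · rintro g hg _ ⟨h, rfl⟩
    simp only [Set.mem_ofPred_eq]
    rw [hbase h _ g hg]
    rintro ⟨h, -⟩; exact absurd h (by decide)

/-- Alternating products of elements of `S i \ B`, the first one being taken from `S i`. -/
inductive Alternating {Γ : Type} [Group Γ] (S : Bool → Subgroup Γ) (B : Subgroup Γ) :
    Bool → Γ → Prop
  | single (i : Bool) (g : Γ) : g ∈ S i → g ∉ B → Alternating S B i g
  | cons (i : Bool) (g w : Γ) : g ∈ S i → g ∉ B → Alternating S B (!i) w →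
      Alternating S B i (g * w)

namespace Alternating

variable {Γ : Type} [Group Γ] {S : Bool → Subgroup Γ} {B : Subgroup Γ}

theorem smul_mem (hB : ∀ i, B ≤ S i) {i : Bool} {w b : Γ} (hb : b ∈ B)
    (h : Alternating S B i w) : Alternating S B i (b * w) := by
  cases h with
  | single _ _ hg hgB =>
    exact .single i _ (mul_mem (hB i hb) hg)
      (fun h => hgB ((Subgroup.mul_mem_cancel_left _ hb).1 h))
  | cons _ g w hg hgB hw =>
    rw [← mul_assoc]
    exact .cons i _ _ (mul_mem (hB i hb) hg)
      (fun h => hgB ((Subgroup.mul_mem_cancel_left _ hb).1 h)) hw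

theorem mul_mem_or (hB : ∀ i, B ≤ S i) {i j : Bool} {w g : Γ} (hg : g ∈ S j)
    (h : Alternating S B i w) : g * w ∈ B ∨ ∃ k, Alternating S B k (g * w) := by
  by_cases hgB : g ∈ B
  · exact Or.inr ⟨i, smul_mem hB hgB h⟩
  by_cases hij : j = i
  · subst hij
    cases h with
    | single _ _ hg1 hgB1 =>
      by_cases hm : g * w ∈ B
      · exact Or.inl hm
      · exact Or.inr ⟨j, .single j _ (mul_mem hg hg1) hm⟩
    | cons _ g1 w hg1 hgB1 hw =>
      rw [← mul_assoc]
      by_cases hm : g * g1 ∈ B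
      · exact Or.inr ⟨!j, smul_mem hB hm hw⟩
      · exact Or.inr ⟨j, .cons j _ _ (mul_mem hg hg1) hm hw⟩
  · have : i = !j := by cases i <;> cases j <;> simp_all
    subst this
    exact Or.inr ⟨j, .cons j _ _ hg hgB h⟩

theorem of_mem_sup (hB : ∀ i, B ≤ S i) {g : Γ} (hg : g ∈ S false ⊔ S true) :
    g ∈ B ∨ ∃ i, Alternating S B i g := by
  have key : ∀ j, ∀ x ∈ S j, ∀ y, (y ∈ B ∨ ∃ i, Alternating S B i y) →
      (x * y ∈ B ∨ ∃ i, Alternating S B i (x * y)) := by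
    rintro j x hx y (hy | ⟨i, hy⟩)
    · by_cases hxy : x * y ∈ B
      · exact Or.inl hxy
      · exact Or.inr ⟨j, .single j _ (mul_mem hx (hB j hy)) hxy⟩
    · exact mul_mem_or hB hx hy
  rw [Subgroup.sup_eq_closure] at hg
  induction hg using Subgroup.closure_induction_left with
  | one => exact Or.inl (one_mem _)
  | mul_left x hx y _ ih =>
    rcases hx with hx | hx
    · exact key _ x hx y ih
    · exact key _ x hx y ih
  | inv_mul_cancel x hx y _ ih =>
    rcases hx with hx | hx
    · exact key _ x⁻¹ (inv_mem hx) y ih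
    · exact key _ x⁻¹ (inv_mem hx) y ih

end Alternating

/-- A family of two types indexed by `Bool`. -/
def pairFamily (M N : Type) : Bool → Type
  | true => M
  | false => N

instance {M N : Type} [Group M] [Group N] : ∀ b, Group (pairFamily M N b)
  | true => inferInstanceAs (Group M)
  | false => inferInstanceAs (Group N)

/-- The binary free product maps to the free product of a `Bool`-indexed family. -/
def coprodToPair (M N : Type) [Group M] [Group N] :
    Monoid.Coprod M N →* Monoid.CoprodI (pairFamily M N) :=
  Monoid.Coprod.lift (Monoid.CoprodI.of (M := pairFamily M N) (i := true))
    (Monoid.CoprodI.of (M := pairFamily M N) (i := false))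

/-- The homomorphisms from the members of a pair. -/
def pairHom {M N G : Type} [Group M] [Group N] [Group G] (f : M →* G) (g : N →* G) :
    ∀ b, pairFamily M N b →* G
  | true => f
  | false => g

theorem lift_pairHom_comp {M N G : Type} [Group M] [Group N] [Group G] (f : M →* G) (g : N →* G) :
    (Monoid.CoprodI.lift (pairHom f g)).comp (coprodToPair M N) = Monoid.Coprod.lift f g := by
  refine Monoid.Coprod.hom_ext ?_ ?_
  · ext x
    exact Monoid.CoprodI.lift_of (M := pairFamily M N) (pairHom f g) (i := true) x
  · ext x
    exact Monoid.CoprodI.lift_of (M := pairFamily M N) (pairHom f g) (i := false) x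

theorem coprodToPair_injective (M N : Type) [Group M] [Group N] :
    Function.Injective (coprodToPair M N) := by
  have := lift_pairHom_comp (Monoid.Coprod.inl : M →* Monoid.Coprod M N) Monoid.Coprod.inr
  rw [Monoid.Coprod.lift_inl_inr] at this
  exact Function.LeftInverse.injective fun x => DFunLike.congr_fun this x

/-- Ping-pong for two groups. -/
theorem coprod_lift_injective_of_ping_pong {M N G α : Type} [Group M] [Group N] [Group G]
    [MulAction G α] (f : M →* G) (g : N →* G) (hN : Infinite N) (X Y : Set α) (hX : X.Nonempty)
    (hY : Y.Nonempty) (hXY : Disjoint X Y) (hf : ∀ m, m ≠ 1 → ∀ y ∈ Y, f m • y ∈ X)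
    (hg : ∀ n, n ≠ 1 → ∀ x ∈ X, g n • x ∈ Y) :
    Function.Injective (Monoid.Coprod.lift f g) := by
  rw [← lift_pairHom_comp, MonoidHom.coe_comp]
  refine Function.Injective.comp ?_ (coprodToPair_injective M N)
  refine Monoid.CoprodI.lift_injective_of_ping_pong (pairHom f g) (Or.inr ⟨false, ?_⟩)
    (fun b => cond b X Y) ?_ ?_ ?_
  · have : Infinite (pairFamily M N false) := hN
    exact (Cardinal.natCast_lt_aleph0 (n := 3)).le.trans (Cardinal.aleph0_le_mk _)
  · rintro (_ | _)
    · exact hY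
    · exact hX
  · rintro (_ | _) (_ | _) h
    · exact absurd rfl h
    · exact hXY.symm
    · exact hXY
    · exact absurd rfl h
  · rintro (_ | _) (_ | _) h
    · exact absurd rfl h
    · rintro n hn _ ⟨x, hx, rfl⟩; exact hg n hn x hx
    · rintro n hn _ ⟨x, hx, rfl⟩; exact hf n hn x hx
    · exact absurd rfl h

/-- Ping-pong for a subgroup and an infinite cyclic group. -/
theorem coprod_zpowers_injective {Γ : Type} [Group Γ] (D : Subgroup Γ) (α : Γ) (Y : Set Γ)
    (hY : Y.Nonempty) (hY' : Yᶜ.Nonempty) (hD : ∀ δ ∈ D, δ ≠ 1 → ∀ y ∈ Y, δ * y ∉ Y)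
    (hα : ∀ k : ℤ, k ≠ 0 → ∀ y, y ∉ Y → α ^ k * y ∈ Y) :
    Function.Injective (Monoid.Coprod.lift D.subtype (zpowersHom Γ α)) := by
  refine coprod_lift_injective_of_ping_pong _ _ inferInstance Yᶜ Y hY' hY disjoint_compl_left ?_ ?_
  · intro m hm y hy
    exact hD m m.2 (by simpa using hm) y hy
  · intro n hn x hx
    exact hα n.toAdd (by simpa using hn) x hx

/-- `Γ`, with `l : F(Λ) → Γ` and `t`, is an HNN extension of the one-relator group `F(Λ)/⟨⟨r⟩⟩` whose
associated subgroups are generated by the letters `SA` and `SB = sh(SA)`. -/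
structure MagnusHNN {Λ : Type} (sh : Λ ≃ Λ) (SA SB : Set Λ) (r : FreeGroup Λ) {Γ : Type} [Group Γ]
    (l : FreeGroup Λ →* Γ) (t : Γ) (deg : Γ →* Multiplicative ℤ) (P N : Set Γ) : Prop where
  ker : ∀ g, l g = 1 ↔ g ∈ Subgroup.normalClosure {r}
  rel : ∀ z ∈ SA, t * l (FreeGroup.of z) * t⁻¹ = l (FreeGroup.of (sh z))
  half : HalfSpaces l.range ((letterSubgroup SA).map l) ((letterSubgroup SB).map l) t P N
  deg_t : deg t = Multiplicative.ofAdd 1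
  deg_l : ∀ g, deg (l g) = 1

theorem map_letterSubgroup {Λ Λ' : Type} (f : Λ → Λ') (S : Set Λ) :
    (letterSubgroup S).map (FreeGroup.map f) = letterSubgroup (f '' S) := by
  rw [letterSubgroup, MonoidHom.map_closure, letterSubgroup, Set.image_image, Set.image_image]
  simp

theorem range_comp_of_surjective {G G' G'' : Type*} [Group G] [Group G'] [Group G''] {f : G →* G'}
    (hf : Function.Surjective f) {g : G' →* G''} : (g.comp f).range = g.range := by
  rw [MonoidHom.range_comp, MonoidHom.range_eq_top.2 hf, MonoidHom.range_eq_map]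

theorem range_comp_subtype {G G' : Type*} [Group G] [Group G'] (K : Subgroup G) (g : G →* G') :
    (g.comp K.subtype).range = K.map g := by
  rw [MonoidHom.range_comp, Subgroup.range_subtype]

theorem exists_magnusHNN {Λ : Type} (sh : Λ ≃ Λ) (SA SB : Set Λ) (hS : SB = sh '' SA)
    (r : FreeGroup Λ)
    (hA : ∀ g ∈ letterSubgroup SA, g ∈ Subgroup.normalClosure {r} → g = 1)
    (hB : ∀ g ∈ letterSubgroup SB, g ∈ Subgroup.normalClosure {r} → g = 1) :
    ∃ (Γ : Type) (_ : Group Γ) (l : FreeGroup Λ →* Γ) (t : Γ) (deg : Γ →* Multiplicative ℤ)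
      (P N : Set Γ), MagnusHNN sh SA SB r l t deg P N := by
  let Q := FreeGroup Λ ⧸ Subgroup.normalClosure ({r} : Set (FreeGroup Λ))
  let mk : FreeGroup Λ →* Q := QuotientGroup.mk' _
  let f : letterSubgroup SA →* Q := mk.comp (letterSubgroup SA).subtype
  let f' : letterSubgroup SA →* Q := (mk.comp (FreeGroup.map sh)).comp (letterSubgroup SA).subtype
  have hmk : ∀ g, mk g = 1 ↔ g ∈ Subgroup.normalClosure ({r} : Set (FreeGroup Λ)) :=
    fun g => QuotientGroup.eq_one_iff g
  have hf : Function.Injective f := by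
    rw [injective_iff_map_eq_one]
    intro a ha
    exact Subtype.ext (hA a a.2 ((hmk _).1 ha))
  have hmap := map_letterSubgroup sh SA
  rw [← hS] at hmap
  have hf' : Function.Injective f' := by
    rw [injective_iff_map_eq_one]
    intro a ha
    have h1 : FreeGroup.map sh (a : FreeGroup Λ) = 1 :=
      hB _ (hmap ▸ Subgroup.mem_map_of_mem _ a.2) ((hmk _).1 ha)
    exact Subtype.ext (FreeGroup.map_injective sh.injective (by rw [h1]; simp))
  let φ : f.range ≃* f'.range := (MonoidHom.ofInjective hf).symm.trans (MonoidHom.ofInjective hf')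
  obtain ⟨P, N, hPN⟩ := HNNExtension.halfSpaces f.range f'.range φ
  let ι : Q →* HNNExtension Q f.range f'.range φ := HNNExtension.of
  let deg : HNNExtension Q f.range f'.range φ →* Multiplicative ℤ :=
    HNNExtension.lift 1 (Multiplicative.ofAdd 1) (by simp)
  refine ⟨HNNExtension Q f.range f'.range φ, inferInstance, ι.comp mk, HNNExtension.t, deg, P, N,
    ⟨fun g => ?_, fun z hz => ?_, ?_, by simp [deg], fun g => by simp [deg, ι]⟩⟩
  · rw [← hmk, MonoidHom.comp_apply, ← map_one ι]
    exact (HNNExtension.of_injective φ).eq_iff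
  · let z' : letterSubgroup SA := ⟨FreeGroup.of z, of_mem_letterSubgroup hz⟩
    have h1 := HNNExtension.equiv_eq_conj (φ := φ) (MonoidHom.ofInjective hf z')
    have h2 : φ (MonoidHom.ofInjective hf z') = MonoidHom.ofInjective hf' z' := by simp [φ]
    rw [h2] at h1
    rw [MonoidHom.ofInjective_apply, MonoidHom.ofInjective_apply] at h1
    have h3 : f' z' = mk (FreeGroup.of (sh z)) := by simp [f', z']
    rw [h3] at h1
    exact h1.symm
  · have e1 : (ι.comp mk).range = ι.range :=
      range_comp_of_surjective (QuotientGroup.mk'_surjective _)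
    have e2 : (letterSubgroup SA).map (ι.comp mk) = f.range.map ι := by
      rw [← Subgroup.map_map]
      exact congrArg _ (range_comp_subtype _ _).symm
    have e3 : (letterSubgroup SB).map (ι.comp mk) = f'.range.map ι := by
      have e4 : (letterSubgroup SB).map mk = f'.range := by
        rw [← hmap, Subgroup.map_map]
        exact (range_comp_subtype (letterSubgroup SA) (mk.comp (FreeGroup.map sh))).symm
      rw [← Subgroup.map_map, e4]
    rw [e1, e2, e3]
    exact hPN

/-- Translation of the index of an indexed alphabet. -/
def indexShift (X : Type) (k : ℤ) : X × ℤ ≃ X × ℤ := (Equiv.refl X).prodCongr (Equiv.addRight k)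

theorem indexShift_apply {X : Type} (k : ℤ) (p : X × ℤ) : indexShift X k p = (p.1, p.2 + k) := rfl

/-- The action of `ℤ` on the free group over an indexed alphabet. -/
def shiftAction (X : Type) : Multiplicative ℤ →* MulAut (FreeGroup (X × ℤ)) :=
  MonoidHom.mk' (fun k => FreeGroup.freeGroupCongr (indexShift X k.toAdd)) (fun a b => by
    have : ∀ w, FreeGroup.map (indexShift X (a * b).toAdd) w =
        FreeGroup.map (indexShift X a.toAdd) (FreeGroup.map (indexShift X b.toAdd) w) := by
      intro w
      rw [FreeGroup.map.comp]
      congr 2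
      funext p
      simp only [Function.comp, indexShift_apply, toAdd_mul, Prod.mk.injEq, true_and]
      ring
    ext w
    exact this w)

theorem shiftAction_apply {X : Type} (k : Multiplicative ℤ) (w : FreeGroup (X × ℤ)) :
    shiftAction X k w = FreeGroup.map (indexShift X k.toAdd) w := rfl

/-- The target of the rewriting homomorphism. -/
abbrev IndexedFree (X : Type) : Type := FreeGroup (X × ℤ) ⋊[shiftAction X] Multiplicative ℤ

open SemidirectProduct in
/-- The rewriting homomorphism with stable letter `y`: `y` acts by translation by `d y`, any other
letter `x` becomes the indexed letter `(x, 0)` followed by a translation by `d x`. -/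
noncomputable def rewriteHom {X : Type} (y : X) (d : X → ℤ) : FreeGroup X →* IndexedFree X := by
  classical exact FreeGroup.lift fun x =>
    if x = y then inr (Multiplicative.ofAdd (d y))
    else inl (FreeGroup.of (x, 0)) * inr (Multiplicative.ofAdd (d x))

/-- Evaluation of indexed letters: `(x, i) ↦ T^i g_x T^{-i}`. -/
def indexedEval {X G : Type} [Group G] (T : G) (e : X → G) : FreeGroup (X × ℤ) →* G :=
  FreeGroup.lift fun p => T ^ p.2 * e p.1 * (T ^ p.2)⁻¹

/-- The homomorphism matching `indexedEval` under the rewriting homomorphism. -/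
noncomputable def stableEval {X G : Type} [Group G] (y : X) (d : X → ℤ) (T : G) (e : X → G) :
    FreeGroup X →* G := by
  classical exact FreeGroup.lift fun x => if x = y then T ^ d y else e x * T ^ d x

section rewriting

variable {X G : Type} [Group G] (y : X) (d : X → ℤ) (T : G) (e : X → G)

theorem rewriteHom_of_self : rewriteHom y d (FreeGroup.of y) =
    SemidirectProduct.inr (Multiplicative.ofAdd (d y)) := by simp [rewriteHom]

theorem rewriteHom_of_ne {x : X} (h : x ≠ y) : rewriteHom y d (FreeGroup.of x) =
    SemidirectProduct.inl (FreeGroup.of (x, 0)) *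
      SemidirectProduct.inr (Multiplicative.ofAdd (d x)) := by simp [rewriteHom, h]

theorem indexedEval_of (p : X × ℤ) :
    indexedEval T e (FreeGroup.of p) = T ^ p.2 * e p.1 * (T ^ p.2)⁻¹ := by simp [indexedEval]

theorem stableEval_of_self : stableEval y d T e (FreeGroup.of y) = T ^ d y := by simp [stableEval]

theorem stableEval_of_ne {x : X} (h : x ≠ y) :
    stableEval y d T e (FreeGroup.of x) = e x * T ^ d x := by simp [stableEval, h]

theorem indexedEval_shift (k : ℤ) (w : FreeGroup (X × ℤ)) :
    indexedEval T e (FreeGroup.map (indexShift X k) w) =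
      T ^ k * indexedEval T e w * (T ^ k)⁻¹ := by
  have : (indexedEval T e).comp (FreeGroup.map (indexShift X k)) =
      (MulAut.conj (T ^ k)).toMonoidHom.comp (indexedEval T e) := by
    ext p
    simp only [MonoidHom.comp_apply, FreeGroup.map.of, indexedEval_of, indexShift_apply,
      MulEquiv.toMonoidHom_eq_coe, MonoidHom.coe_coe, MulAut.conj_apply]
    rw [add_comm, zpow_add]; group
  exact DFunLike.congr_fun this w

theorem stableEval_eq (w : FreeGroup X) : stableEval y d T e w =
    indexedEval T e (rewriteHom y d w).left * T ^ (rewriteHom y d w).right.toAdd := by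
  let F : IndexedFree X →* G := SemidirectProduct.lift (indexedEval T e) (zpowersHom G T) (by
    intro k
    ext w
    have := indexedEval_shift T e k.toAdd (FreeGroup.of w)
    change indexedEval T e (FreeGroup.map (indexShift X k.toAdd) (FreeGroup.of w)) = _
    rw [this]
    rfl)
  have h1 : stableEval y d T e = F.comp (rewriteHom y d) := by
    ext x
    by_cases h : x = y
    · subst h
      simp [F, stableEval_of_self, rewriteHom_of_self]
    · simp [F, stableEval_of_ne y d T e h, rewriteHom_of_ne y d h, indexedEval_of]
  rw [h1]
  rfl

theorem rewriteHom_right : (SemidirectProduct.rightHom.comp (rewriteHom y d)) =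
    FreeGroup.lift fun x => Multiplicative.ofAdd (d x) := by
  ext x
  by_cases h : x = y
  · subst h; simp [rewriteHom_of_self]
  · simp [rewriteHom_of_ne y d h]

theorem rewriteHom_right_apply (w : FreeGroup X) : (rewriteHom y d w).right =
    FreeGroup.lift (fun x => Multiplicative.ofAdd (d x)) w :=
  DFunLike.congr_fun (rewriteHom_right y d) w

theorem map_shift_mem {S : Set X} {k : ℤ} {w : FreeGroup (X × ℤ)}
    (h : w ∈ letterSubgroup {p : X × ℤ | p.1 ∈ S}) :
    FreeGroup.map (indexShift X k) w ∈ letterSubgroup {p : X × ℤ | p.1 ∈ S} :=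
  map_letterSubgroup_le_iff.2 (fun p hp => by
    rw [FreeGroup.map.of]; exact of_mem_letterSubgroup hp) _ h

theorem rewriteHom_left_mem {S : Set X} {w : FreeGroup X} (hw : w ∈ letterSubgroup S) :
    (rewriteHom y d w).left ∈ letterSubgroup {p : X × ℤ | p.1 ∈ S \ {y}} := by
  let K : Subgroup (IndexedFree X) :=
    { carrier := {a | a.left ∈ letterSubgroup {p : X × ℤ | p.1 ∈ S \ {y}}}
      one_mem' := one_mem (letterSubgroup {p : X × ℤ | p.1 ∈ S \ {y}})
      mul_mem' := fun {a b} ha hb =>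
        mul_mem (S := Subgroup (FreeGroup (X × ℤ))) ha (map_shift_mem hb)
      inv_mem' := fun {a} ha => by
        simp only [Set.mem_ofPred_eq, SemidirectProduct.inv_left]
        exact map_shift_mem (inv_mem ha) }
  have : ∀ w ∈ letterSubgroup S, rewriteHom y d w ∈ K := by
    rw [map_letterSubgroup_le_iff]
    intro x hx
    by_cases h : x = y
    · subst h
      rw [rewriteHom_of_self]; exact one_mem (letterSubgroup {p : X × ℤ | p.1 ∈ S \ {x}})
    · rw [rewriteHom_of_ne y d h]
      refine mul_mem ?_ (one_mem (letterSubgroup {p : X × ℤ | p.1 ∈ S \ {y}}))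
      exact of_mem_letterSubgroup ⟨hx, h⟩
  exact this w hw

theorem rewriteHom_left_mem_univ (w : FreeGroup X) :
    (rewriteHom y d w).left ∈ letterSubgroup {p : X × ℤ | p.1 ≠ y} := by
  have := rewriteHom_left_mem y d (S := Set.univ) (w := w) (by rw [letterSubgroup_univ]; trivial)
  exact letterSubgroup_mono (fun p hp => hp.2) this

theorem rewriteHom_freeLen_lt {r : FreeGroup X} (h : r ∉ letterSubgroup ({y}ᶜ : Set X)) :
    freeLen (rewriteHom y d r).left < freeLen r := by
  refine (length_lt_freeLen (rewriteHom y d) (fun a => freeLen a.left) ?_ ?_ ?_ ?_).2 y ?_ r h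
  · exact freeLen_one
  · intro a b
    exact (freeLen_mul_le _ _).trans (Nat.add_le_add_left (freeLen_map_le _ _) _)
  · intro a
    have hle : ∀ a : IndexedFree X, freeLen a⁻¹.left ≤ freeLen a.left := fun a => by
      rw [SemidirectProduct.inv_left, ← freeLen_inv a.left]
      exact freeLen_map_le _ _
    refine le_antisymm (hle a) ?_
    simpa using hle a⁻¹
  · intro x
    by_cases h : x = y
    · subst h; rw [rewriteHom_of_self, SemidirectProduct.left_inr, freeLen_one]; exact zero_le_one
    · rw [rewriteHom_of_ne y d h]
      simp [freeLen_of]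
  · rw [rewriteHom_of_self, SemidirectProduct.left_inr, freeLen_one]

theorem rewriteHom_eq_inl {S : Set X} (hy : y ∉ S) (hd : ∀ x ∈ S, d x = 0) {w : FreeGroup X}
    (hw : w ∈ letterSubgroup S) :
    rewriteHom y d w = SemidirectProduct.inl (FreeGroup.map (fun x => (x, (0 : ℤ))) w) := by
  refine eqOn_letterSubgroup (f := rewriteHom y d)
    (f' := SemidirectProduct.inl.comp (FreeGroup.map fun x => (x, (0 : ℤ)))) ?_ hw
  intro x hx
  have : x ≠ y := by rintro rfl; exact hy hx
  simp [rewriteHom_of_ne y d this, hd x hx]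

end rewriting

/-- Indexed letters for which the index of `x` is restricted to an interval. -/
def indexWindow {X : Type} (x : X) (μ ν : ℤ) : Set (X × ℤ) :=
  {p | p.1 = x → μ ≤ p.2 ∧ p.2 ≤ ν}

theorem indexShift_image_window {X : Type} (x : X) (μ ν : ℤ) :
    indexWindow x (μ + 1) ν = indexShift X 1 '' indexWindow x μ (ν - 1) := by
  ext ⟨z, i⟩
  constructor
  · intro h
    refine ⟨(z, i - 1), fun hz => ?_, by simp [indexShift_apply]⟩
    have := h hz
    simp only at this ⊢; omega
  · rintro ⟨⟨z', i'⟩, h, he⟩ hz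
    simp only [indexShift_apply, Prod.mk.injEq] at he hz
    have := h (he.1.trans hz)
    simp only at this ⊢; omega

/-- The Freiheitssatz for relators of length less than `n`. -/
def FreiheitssatzBelow (n : ℕ) : Prop :=
  ∀ (X : Type) (r : FreeGroup X), freeLen r < n → ∀ ξ : X, ¬ ConjInto r {ξ}ᶜ →
    ∀ g ∈ letterSubgroup ({ξ}ᶜ : Set X), g ∈ Subgroup.normalClosure {r} → g = 1

theorem exists_window {X : Type} {n : ℕ} (hF : FreiheitssatzBelow n) {r : FreeGroup (X × ℤ)}
    (hr : freeLen r < n) {x : X} (hx : ∃ i, ¬ ConjInto r {(x, i)}ᶜ) :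
    ∃ (μ ν : ℤ) (r' : FreeGroup (X × ℤ)), μ ≤ ν ∧ IsConj r r' ∧ freeLen r' < n ∧
      r' ∈ letterSubgroup (indexWindow x μ ν) ∧ ¬ ConjInto r' {(x, μ)}ᶜ ∧
      ¬ ConjInto r' {(x, ν)}ᶜ ∧
      (∀ g ∈ letterSubgroup (indexWindow x μ (ν - 1)), g ∈ Subgroup.normalClosure {r'} → g = 1) ∧
      (∀ g ∈ letterSubgroup (indexWindow x (μ + 1) ν), g ∈ Subgroup.normalClosure {r'} → g = 1) := by
  classical
  have hfin : {i : ℤ | ¬ ConjInto r {(x, i)}ᶜ}.Finite :=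
    ((finite_essential r).preimage (f := fun i : ℤ => (x, i)) (by
      intro a _ b _ h; simpa using h)).subset (fun i hi => hi)
  set s := hfin.toFinset with hs
  have hmem : ∀ i, i ∈ s ↔ ¬ ConjInto r {(x, i)}ᶜ := fun i => by simp [hs]
  have hne : s.Nonempty := by obtain ⟨i, hi⟩ := hx; exact ⟨i, (hmem i).2 hi⟩
  set μ := s.min' hne
  set ν := s.max' hne
  have hμ : ¬ ConjInto r {(x, μ)}ᶜ := (hmem μ).1 (s.min'_mem hne)
  have hν : ¬ ConjInto r {(x, ν)}ᶜ := (hmem ν).1 (s.max'_mem hne)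
  have hwin : ConjInto r (indexWindow x μ ν) := by
    refine (ConjInto.essential r).mono ?_
    rintro ⟨z, i⟩ hp hz
    simp only at hz; subst hz
    exact ⟨s.min'_le _ ((hmem i).2 hp), s.le_max' _ ((hmem i).2 hp)⟩
  have hc := hwin.isConj_retraction
  have hlen : freeLen (letterRetraction (indexWindow x μ ν) r) < n :=
    (freeLen_letterRetraction_le _ _).trans_lt hr
  rw [isConj_iff_of_conjInto hc] at hμ hν
  refine ⟨μ, ν, _, s.min'_le_max' hne, hc, hlen, letterRetraction_mem _, hμ, hν,
    fun g hg => hF _ _ hlen _ hν g (letterSubgroup_mono ?_ hg),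
    fun g hg => hF _ _ hlen _ hμ g (letterSubgroup_mono ?_ hg)⟩
  · rintro p hp rfl
    have := hp rfl
    simp only at this; omega
  · rintro p hp rfl
    have := hp rfl
    simp only at this; omega

theorem zpow_conj_of_step {G : Type*} [Group G] {t : G} {f : ℤ → G} {a b : ℤ}
    (h : ∀ i, a ≤ i → i < b → t * f i * t⁻¹ = f (i + 1)) {i : ℤ} (ha : a ≤ i) (hb : i ≤ b) :
    t ^ (i - a) * f a * (t ^ (i - a))⁻¹ = f i := by
  induction i, ha using Int.leInduction with
  | base => simp
  | succ i hi ih =>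
    rw [← h i hi (by omega), ← ih (by omega), show i + 1 - a = 1 + (i - a) by ring, zpow_add]
    group

theorem zpow_conj_of_step' {G : Type*} [Group G] {t : G} {f : ℤ → G}
    (h : ∀ i, t * f i * t⁻¹ = f (i + 1)) (i a : ℤ) :
    t ^ (i - a) * f a * (t ^ (i - a))⁻¹ = f i := by
  rcases le_total a i with hi | hi
  · exact zpow_conj_of_step (fun i _ _ => h i) hi le_rfl
  · rw [← zpow_conj_of_step (f := f) (t := t) (fun i _ _ => h i) hi le_rfl]
    rw [show i - a = -(a - i) by ring]
    group

section magnus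

variable {X : Type} {x : X} {μ ν : ℤ} {r' : FreeGroup (X × ℤ)} {Γ : Type} [Group Γ]
  {l : FreeGroup (X × ℤ) →* Γ} {t : Γ} {deg : Γ →* Multiplicative ℤ} {P N : Set Γ}

theorem MagnusHNN.exists_base
    (h : MagnusHNN (indexShift X 1) (indexWindow x μ (ν - 1)) (indexWindow x (μ + 1) ν) r' l t deg
      P N) :
    ∃ e : X → Γ, (∀ w ∈ letterSubgroup (indexWindow x μ ν), indexedEval t e w = l w) ∧
      ∀ w, deg (indexedEval t e w) = 1 := by
  classical
  have hrel : ∀ z i, (z = x → μ ≤ i ∧ i < ν) →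
      t * l (FreeGroup.of (z, i)) * t⁻¹ = l (FreeGroup.of (z, i + 1)) := fun z i hz =>
    h.rel (z, i) (fun hzx => ⟨(hz hzx).1, Int.le_sub_one_of_lt (hz hzx).2⟩)
  let e : X → Γ := fun z => (t ^ (if z = x then μ else 0))⁻¹ *
    l (FreeGroup.of (z, if z = x then μ else 0)) * t ^ (if z = x then μ else 0)
  refine ⟨e, fun w hw => eqOn_letterSubgroup ?_ hw, fun w => ?_⟩
  · rintro ⟨z, i⟩ hz
    rw [indexedEval_of]
    by_cases hzx : z = x
    · subst hzx
      rw [← zpow_conj_of_step (f := fun i => l (FreeGroup.of (z, i))) (t := t) (a := μ) (b := ν)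
        (fun j h1 h2 => hrel z j fun _ => ⟨h1, h2⟩) (hz rfl).1 (hz rfl).2]
      simp only [e, if_true, zpow_sub]
      group
    · rw [← zpow_conj_of_step' (f := fun i => l (FreeGroup.of (z, i))) (t := t)
        (fun j => hrel z j fun h => absurd h hzx) i 0]
      simp [e, hzx]
  · have : deg.comp (indexedEval t e) = 1 := by
      ext p
      simp only [MonoidHom.comp_apply, indexedEval_of, e, map_mul, map_inv, h.deg_l]
      simp
    exact DFunLike.congr_fun this w

theorem MagnusHNN.exists_embed
    (h : MagnusHNN (indexShift X 1) (indexWindow x μ (ν - 1)) (indexWindow x (μ + 1) ν) r' l t deg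
      P N) (hr' : r' ∈ letterSubgroup (indexWindow x μ ν)) {r : FreeGroup X} {y : X} {d : X → ℤ}
    (hright : (rewriteHom y d r).right = 1) (hc : IsConj (rewriteHom y d r).left r') :
    ∃ e : X → Γ, (∀ w ∈ letterSubgroup (indexWindow x μ ν), indexedEval t e w = l w) ∧
      stableEval y d t e r = 1 ∧
      ∀ g ∈ Subgroup.normalClosure {r}, (rewriteHom y d g).right = 1 ∧
        indexedEval t e (rewriteHom y d g).left = 1 := by
  obtain ⟨e, he, hdeg⟩ := h.exists_base
  have h1 : stableEval y d t e r = 1 := by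
    rw [stableEval_eq, hright, toAdd_one, zpow_zero, mul_one]
    have h2 : IsConj (indexedEval t e (rewriteHom y d r).left) (indexedEval t e r') :=
      (indexedEval t e).map_isConj hc
    rw [he r' hr', (h.ker r').2 (Subgroup.subset_normalClosure rfl)] at h2
    exact isConj_one_left.1 h2
  refine ⟨e, he, h1, fun g hg => ?_⟩
  have hle : Subgroup.normalClosure {r} ≤ (stableEval y d t e).ker :=
    Subgroup.normalClosure_le_normal (by simpa using h1)
  have h3 : stableEval y d t e g = 1 := hle hg
  have h4 : (rewriteHom y d g).right = 1 := by
    have := congrArg deg h3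
    rw [stableEval_eq, map_mul, hdeg, map_zpow, h.deg_t] at this
    simpa [← ofAdd_zsmul] using this
  rw [stableEval_eq, h4, toAdd_one, zpow_zero, mul_one] at h3
  exact ⟨h4, h3⟩

end magnus

theorem rewriteHom_injOn {X : Type} {y ξ : X} {d : X → ℤ} (hy : d y ≠ 0)
    (hd : ∀ z, z ≠ y → z ≠ ξ → d z = 0) {g : FreeGroup X} (hg : g ∈ letterSubgroup ({ξ}ᶜ : Set X))
    (h : rewriteHom y d g = 1) : g = 1 := by
  classical
  let d' : X → ℤ := fun z => if z = y then 1 else 0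
  let M : IndexedFree X →* IndexedFree X := SemidirectProduct.map
    (FreeGroup.map fun p : X × ℤ => (p.1, d y * p.2)) (zpowGroupHom (d y)) (by
      intro k
      ext p
      simp only [MonoidHom.comp_apply, MulEquiv.toMonoidHom_eq_coe, MonoidHom.coe_coe,
        shiftAction_apply]
      simp [indexShift_apply, mul_add])
  have hM : ∀ g ∈ letterSubgroup ({ξ}ᶜ : Set X), rewriteHom y d g = M.comp (rewriteHom y d') g := by
    intro g hg
    refine eqOn_letterSubgroup (fun z hz => ?_) hg
    by_cases hzy : z = y
    · subst hzy
      simp only [MonoidHom.comp_apply, rewriteHom_of_self, M, SemidirectProduct.map_inr]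
      simp [d', ← ofAdd_zsmul]
    · simp only [MonoidHom.comp_apply, rewriteHom_of_ne _ _ hzy, M, SemidirectProduct.map_inr,
        map_mul, SemidirectProduct.map_inl, hd z hzy hz]
      simp [d', hzy]
  have hid : stableEval y d' (FreeGroup.of y) FreeGroup.of = MonoidHom.id (FreeGroup X) := by
    ext z
    by_cases hzy : z = y
    · subst hzy; simp [stableEval_of_self, d']
    · simp [stableEval_of_ne _ _ _ _ hzy, d', hzy]
  rw [hM g hg] at h
  have hl : (rewriteHom y d' g).left = 1 := by
    have h1 := congrArg SemidirectProduct.left h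
    have hinj : Function.Injective fun p : X × ℤ => (p.1, d y * p.2) := by
      rintro ⟨a, i⟩ ⟨b, j⟩ hab
      simpa [hy] using hab
    exact FreeGroup.map_injective hinj (h1.trans (by simp))
  have hr : (rewriteHom y d' g).right = 1 := by
    have h1 := congrArg SemidirectProduct.right h
    have h2 : (rewriteHom y d' g).right ^ d y = 1 := h1
    have h3 := congrArg Multiplicative.toAdd h2
    simpa [hy] using h3
  have h1 := stableEval_eq y d' (FreeGroup.of y) FreeGroup.of g
  rw [hl, hr, hid] at h1
  simpa using h1

theorem expSum_eq_one_of_conjInto {X : Type} {M : Type*} [CommGroup M] {r : FreeGroup X} {S : Set X}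
    (h : ConjInto r S) {f : FreeGroup X →* M} (hf : ∀ x ∈ S, f (FreeGroup.of x) = 1) : f r = 1 := by
  obtain ⟨s, hs, hc⟩ := h
  have h1 : f s = 1 := by
    have := eqOn_letterSubgroup (f := f) (f' := 1) (by simpa using hf) hs
    simpa using this
  have h2 := f.map_isConj hc
  rw [isConj_iff_eq] at h2
  rw [h2, h1]

theorem eq_one_of_mem_normalClosure_of_conjInto {X : Type} {r : FreeGroup X} {ξ : X}
    (h : ConjInto r {ξ}) {g : FreeGroup X} (hg : g ∈ letterSubgroup ({ξ}ᶜ : Set X))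
    (hgr : g ∈ Subgroup.normalClosure {r}) : g = 1 := by
  obtain ⟨s, hs, hc⟩ := h
  have h1 : letterRetraction ({ξ}ᶜ : Set X) s = 1 := by
    refine (eqOn_letterSubgroup (f' := 1) (fun z hz => ?_) hs)
    exact letterRetraction_of_notMem (by simpa using hz)
  have h2 := (letterRetraction ({ξ}ᶜ : Set X)).map_isConj hc
  rw [h1, isConj_one_left] at h2
  have hle : Subgroup.normalClosure {r} ≤ (letterRetraction ({ξ}ᶜ : Set X)).ker :=
    Subgroup.normalClosure_le_normal (by simpa using h2)
  rw [← letterRetraction_eq_self hg]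
  exact hle hgr

theorem freiheitssatz_of_expSum_ne {n : ℕ} (hF : FreiheitssatzBelow n) {X : Type} {r : FreeGroup X}
    (hr : freeLen r < n + 1) {ξ y : X} (hyξ : y ≠ ξ) (hy : ¬ ConjInto r {y}ᶜ) (hσ : expSum ξ r ≠ 1)
    {g : FreeGroup X} (hg : g ∈ letterSubgroup ({ξ}ᶜ : Set X))
    (hgr : g ∈ Subgroup.normalClosure {r}) : g = 1 := by
  classical
  let d : X → ℤ := fun z => if z = y then (expSum ξ r).toAdd else
    if z = ξ then -(expSum y r).toAdd else 0
  have hright : (rewriteHom y d r).right = 1 := by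
    rw [rewriteHom_right_apply]
    have : FreeGroup.lift (fun x => Multiplicative.ofAdd (d x)) =
        expSum y ^ (expSum ξ r).toAdd * expSum ξ ^ (-(expSum y r).toAdd) := by
      ext z
      by_cases hzy : z = y
      · subst hzy
        simp [d, expSum_of_self, expSum_of_ne hyξ, ← ofAdd_zsmul]
      · by_cases hzξ : z = ξ
        · subst hzξ
          simp [d, expSum_of_self, expSum_of_ne hzy, hzy, ← ofAdd_zsmul]
        · simp [d, expSum_of_ne hzy, expSum_of_ne hzξ, hzy, hzξ]
    rw [this]
    apply Multiplicative.toAdd.injective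
    simp [mul_comm]
  have hlen : freeLen (rewriteHom y d r).left < n := by
    have := rewriteHom_freeLen_lt y d (r := r) (fun h => hy (conjInto_of_mem h))
    omega
  have hess : ∃ i, ¬ ConjInto (rewriteHom y d r).left {(ξ, i)}ᶜ := by
    by_contra! hcon
    have h1 : ConjInto (rewriteHom y d r).left {p : X × ℤ | p.1 ≠ ξ} := by
      refine (ConjInto.essential _).mono ?_
      rintro ⟨z, i⟩ hp rfl
      exact hp (hcon i)
    let e : X → Multiplicative ℤ := fun z => if z = ξ then Multiplicative.ofAdd 1 else 1
    have h2 : indexedEval (1 : Multiplicative ℤ) e (rewriteHom y d r).left = 1 :=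
      expSum_eq_one_of_conjInto h1 (fun p hp => by
        have : p.1 ≠ ξ := hp
        simp [indexedEval_of, e, this])
    have h3 : stableEval y d (1 : Multiplicative ℤ) e = expSum ξ := by
      ext z
      by_cases hzy : z = y
      · subst hzy
        simp [stableEval_of_self, expSum_of_ne hyξ]
      · rw [stableEval_of_ne _ _ _ _ hzy]
        by_cases hzξ : z = ξ
        · subst hzξ
          simp [e, expSum_of_self]
        · simp [e, hzξ, expSum_of_ne hzξ]
    have h4 := stableEval_eq y d (1 : Multiplicative ℤ) e r
    rw [h2, h3] at h4
    exact hσ (by simpa using h4)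
  obtain ⟨μ, ν, r', hμν, hc, hlen', hr', hμ, hν, hA, hB⟩ := exists_window hF hlen hess
  obtain ⟨Γ, _, l, t, deg, P, N, hM⟩ :=
    exists_magnusHNN _ _ _ (indexShift_image_window ξ μ ν) r' hA hB
  obtain ⟨e, he, -, hker⟩ := hM.exists_embed hr' hright hc
  obtain ⟨h1, h2⟩ := hker g hgr
  have hmem := rewriteHom_left_mem y d hg
  have hsub : ∀ ν', {p : X × ℤ | p.1 ∈ ({ξ}ᶜ \ {y} : Set X)} ⊆ indexWindow ξ μ ν' :=
    fun ν' p hp hpξ => absurd hpξ hp.1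
  rw [he _ (letterSubgroup_mono (hsub ν) hmem), hM.ker] at h2
  have h3 := hA _ (letterSubgroup_mono (hsub _) hmem) h2
  refine rewriteHom_injOn (y := y) (d := d) ?_ ?_ hg (SemidirectProduct.ext h3 h1)
  · simpa [d] using hσ
  · intro z h1 h2; simp [d, h1, h2]

section unitDegree

variable {X : Type} {r : FreeGroup X} {ξ : X} [DecidableEq X]

theorem rewriteHom_single_right (r : FreeGroup X) :
    (rewriteHom ξ (Pi.single ξ 1) r).right = expSum ξ r := by
  rw [rewriteHom_right_apply]
  congr 1
  ext z
  by_cases hzξ : z = ξ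
  · subst hzξ; simp [expSum_of_self]
  · simp [expSum_of_ne hzξ, hzξ]

theorem stableEval_single :
    stableEval ξ (Pi.single ξ 1) (FreeGroup.of ξ) FreeGroup.of = MonoidHom.id (FreeGroup X) := by
  ext z
  by_cases hzy : z = ξ
  · subst hzy; simp [stableEval_of_self]
  · simp [stableEval_of_ne _ _ _ _ hzy, hzy]

theorem indexedEval_rewriteHom_left (hσ : expSum ξ r = 1) :
    indexedEval (FreeGroup.of ξ) FreeGroup.of (rewriteHom ξ (Pi.single ξ 1) r).left = r := by
  have h1 := stableEval_eq ξ (Pi.single ξ 1) (FreeGroup.of ξ) FreeGroup.of r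
  rw [rewriteHom_single_right, hσ, stableEval_single] at h1
  simpa using h1.symm

theorem exists_not_conjInto_rewriteHom_left (hσ : expSum ξ r = 1) {x : X} (hxξ : x ≠ ξ)
    (hx : ¬ ConjInto r {x}ᶜ) :
    ∃ i, ¬ ConjInto (rewriteHom ξ (Pi.single ξ 1) r).left {(x, i)}ᶜ := by
  by_contra! hcon
  have h1 : ConjInto (rewriteHom ξ (Pi.single ξ 1) r).left {p : X × ℤ | p.1 ≠ x} := by
    refine (ConjInto.essential _).mono ?_
    rintro ⟨z, i⟩ hp rfl
    exact hp (hcon i)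
  obtain ⟨s, hs, hc⟩ := h1
  have h2 := (indexedEval (FreeGroup.of ξ) FreeGroup.of).map_isConj hc
  rw [indexedEval_rewriteHom_left hσ] at h2
  refine hx ⟨_, ?_, h2⟩
  refine map_letterSubgroup_le_iff.2 (fun p hp => ?_) s hs
  have hξm : FreeGroup.of ξ ∈ letterSubgroup ({x}ᶜ : Set X) :=
    of_mem_letterSubgroup (by simpa using hxξ.symm)
  rw [indexedEval_of]
  exact mul_mem (mul_mem (zpow_mem hξm _) (of_mem_letterSubgroup hp)) (inv_mem (zpow_mem hξm _))

end unitDegree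

theorem freiheitssatz_of_expSum_eq {n : ℕ} (hF : FreiheitssatzBelow n) {X : Type} {r : FreeGroup X}
    (hr : freeLen r < n + 1) {ξ x : X} (hxξ : x ≠ ξ) (hx : ¬ ConjInto r {x}ᶜ)
    (hξ : ¬ ConjInto r {ξ}ᶜ) (hσ : expSum ξ r = 1)
    {g : FreeGroup X} (hg : g ∈ letterSubgroup ({ξ}ᶜ : Set X))
    (hgr : g ∈ Subgroup.normalClosure {r}) : g = 1 := by
  classical
  let d : X → ℤ := Pi.single ξ 1
  have hright : (rewriteHom ξ d r).right = 1 := by rw [rewriteHom_single_right, hσ]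
  have hlen : freeLen (rewriteHom ξ d r).left < n := by
    have := rewriteHom_freeLen_lt ξ d (r := r) (fun h => hξ (conjInto_of_mem h))
    omega
  have hback : indexedEval (FreeGroup.of ξ) FreeGroup.of (rewriteHom ξ d r).left = r :=
    indexedEval_rewriteHom_left hσ
  have hess : ∃ i, ¬ ConjInto (rewriteHom ξ d r).left {(x, i)}ᶜ :=
    exists_not_conjInto_rewriteHom_left hσ hxξ hx
  obtain ⟨μ, ν, r', hμν, hc, hlen', hr', hμ, hν, hA, hB⟩ := exists_window hF hlen hess
  obtain ⟨Γ, _, l, t, deg, P, N, hM⟩ :=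
    exists_magnusHNN _ _ _ (indexShift_image_window x μ ν) r' hA hB
  obtain ⟨e, he, -, hker⟩ := hM.exists_embed hr' hright hc
  obtain ⟨h1, h2⟩ := hker g hgr
  have hleft : (rewriteHom ξ d g).left = FreeGroup.map (fun z => (z, (0 : ℤ))) g := by
    rw [rewriteHom_eq_inl ξ d (S := {ξ}ᶜ) (by simp) (by intro z hz; simp [d, show z ≠ ξ from hz]) hg]
    simp
  have h3 : FreeGroup.map (indexShift X μ) (FreeGroup.map (fun z => (z, (0 : ℤ))) g) =
      FreeGroup.map (fun z => (z, μ)) g := by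
    rw [FreeGroup.map.comp]
    congr 2
    funext z
    simp [indexShift_apply]
  have hgμ : FreeGroup.map (fun z => (z, μ)) g ∈ letterSubgroup {p : X × ℤ | p.2 = μ} := by
    refine map_letterSubgroup_le_iff.2 (fun z _ => ?_) g hg
    rw [FreeGroup.map.of]
    exact of_mem_letterSubgroup rfl
  have h4 : FreeGroup.map (fun z => (z, μ)) g ∈ Subgroup.normalClosure {r'} := by
    rw [← hM.ker, ← he _ (letterSubgroup_mono ?_ hgμ), ← h3, indexedEval_shift, ← hleft, h2]
    · simp
    · intro p hp _
      have hp : p.2 = μ := hp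
      omega
  have hess' : ∃ z i, i ≠ μ ∧ ¬ ConjInto r' {(z, i)}ᶜ := by
    by_contra! hcon
    have h5 : ConjInto r' {p : X × ℤ | p.2 = μ} := by
      refine (ConjInto.essential _).mono ?_
      rintro ⟨z, i⟩ hp
      by_contra hi
      exact hp (hcon z i hi)
    have h6 : ConjInto r' {p : X × ℤ | p.1 ≠ ξ} :=
      (conjInto_of_mem (rewriteHom_left_mem_univ ξ d r)).of_isConj hc
    obtain ⟨s, hs, hc'⟩ := h5.inter h6
    have h7 := (indexedEval (FreeGroup.of ξ) FreeGroup.of).map_isConj (hc.trans hc')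
    rw [hback] at h7
    have h8 : ∀ s ∈ letterSubgroup ({p : X × ℤ | p.2 = μ} ∩ {p : X × ℤ | p.1 ≠ ξ}),
        indexedEval (FreeGroup.of ξ) FreeGroup.of s ∈ (letterSubgroup ({ξ}ᶜ : Set X)).map
          (MulAut.conj (FreeGroup.of ξ ^ μ)).toMonoidHom := by
      rw [map_letterSubgroup_le_iff]
      rintro ⟨z, i⟩ ⟨rfl, hp⟩
      exact ⟨_, of_mem_letterSubgroup hp, by rw [indexedEval_of]; rfl⟩
    obtain ⟨s', hs', he'⟩ := h8 s hs
    refine hξ ⟨s', hs', h7.trans ?_⟩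
    rw [← he', isConj_comm]
    exact isConj_iff.2 ⟨_, rfl⟩
  obtain ⟨z, i, hi, hzi⟩ := hess'
  have h5 := hF _ r' hlen' (z, i) hzi _ (letterSubgroup_mono ?_ hgμ) h4
  · exact FreeGroup.map_injective (f := fun z => (z, μ)) (fun a b hab => by simpa using hab)
      (by rw [h5]; simp)
  · rintro p hp rfl
    exact hi hp

theorem freiheitssatzBelow (n : ℕ) : FreiheitssatzBelow n := by
  induction n with
  | zero => intro X r hr; omega
  | succ n ih =>
    intro X r hr ξ hξ g hg hgr
    by_cases hex : ∃ y, y ≠ ξ ∧ ¬ ConjInto r {y}ᶜ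
    · obtain ⟨y, hyξ, hy⟩ := hex
      by_cases hσ : expSum ξ r = 1
      · exact freiheitssatz_of_expSum_eq ih hr hyξ hy hξ hσ hg hgr
      · exact freiheitssatz_of_expSum_ne ih hr hyξ hy hσ hg hgr
    · push Not at hex
      refine eq_one_of_mem_normalClosure_of_conjInto ((ConjInto.essential r).mono ?_) hg hgr
      intro y hy
      by_contra h
      exact hy (hex y h)

/-- The Freiheitssatz. -/
theorem freiheitssatz {X : Type} {r : FreeGroup X} {ξ : X} (hξ : ¬ ConjInto r {ξ}ᶜ)
    {g : FreeGroup X} (hg : g ∈ letterSubgroup ({ξ}ᶜ : Set X))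
    (hgr : g ∈ Subgroup.normalClosure {r}) : g = 1 :=
  freiheitssatzBelow (freeLen r + 1) X r (Nat.lt_succ_self _) ξ hξ g hg hgr

section normalForm

open MvPolynomial

variable {σ : Type} {F : Type} [Field F]

theorem degree_le_totalDegree {g : MvPolynomial σ F} {m : σ →₀ ℕ} (h : m ∈ g.support) :
    m.degree ≤ g.totalDegree := le_totalDegree h

theorem totalDegree_mul_monomial_le (g : MvPolynomial σ F) (a : σ →₀ ℕ) :
    (g * monomial a (1 : F)).totalDegree ≤ g.totalDegree + a.degree :=
  (totalDegree_mul _ _).trans (Nat.add_le_add_left (totalDegree_monomial_le _ _) _)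

theorem degree_tsub_single {m : σ →₀ ℕ} {i : σ} {q : ℕ} (h : q ≤ m i) :
    (m - Finsupp.single i q).degree + q = m.degree := by
  have h1 : m - Finsupp.single i q + Finsupp.single i q = m :=
    tsub_add_cancel_of_le (by simpa using h)
  have h2 := congrArg Finsupp.degree h1
  rwa [map_add, Finsupp.degree_single] at h2

open Classical in
/-- The normal form of a monomial with respect to the rewriting rules `X i ^ q → f i`. -/
noncomputable def normalForm (f : σ → MvPolynomial σ F) (q : ℕ) (hf : ∀ i, (f i).totalDegree < q)
    (m : σ →₀ ℕ) : MvPolynomial σ F :=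
  if h : ∃ i, q ≤ m i then
    ∑ m' ∈ (f h.choose * monomial (m - Finsupp.single h.choose q) (1 : F)).support.attach,
      coeff m'.1 (f h.choose * monomial (m - Finsupp.single h.choose q) (1 : F)) •
        normalForm f q hf m'.1
  else monomial m 1
termination_by m.degree
decreasing_by
  have h1 := degree_le_totalDegree m'.2
  have h2 := totalDegree_mul_monomial_le (f h.choose) (m - Finsupp.single h.choose q)
  have h3 := degree_tsub_single h.choose_spec
  have h4 := hf h.choose
  omega

/-- The linear extension of `normalForm`. -/
noncomputable def normalFormLinear (f : σ → MvPolynomial σ F) (q : ℕ)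
    (hf : ∀ i, (f i).totalDegree < q) : MvPolynomial σ F →ₗ[F] MvPolynomial σ F :=
  (basisMonomials σ F).constr F (normalForm f q hf)

variable {f : σ → MvPolynomial σ F} {q : ℕ} {hf : ∀ i, (f i).totalDegree < q}

theorem normalFormLinear_monomial (m : σ →₀ ℕ) :
    normalFormLinear f q hf (monomial m 1) = normalForm f q hf m := by
  have := (basisMonomials σ F).constr_basis F (normalForm f q hf) m
  simpa [normalFormLinear] using this

theorem linear_apply_eq_sum (L : MvPolynomial σ F →ₗ[F] MvPolynomial σ F) (g : MvPolynomial σ F) :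
    L g = ∑ m ∈ g.support, coeff m g • L (monomial m 1) := by
  conv_lhs => rw [← support_sum_monomial_coeff g]
  rw [map_sum]
  refine Finset.sum_congr rfl fun m _ => ?_
  rw [← map_smul, smul_monomial, smul_eq_mul, mul_one]

theorem normalForm_of_reduced {m : σ →₀ ℕ} (h : ¬ ∃ i, q ≤ m i) :
    normalForm f q hf m = monomial m 1 := by
  rw [normalForm, dif_neg h]

theorem exists_normalForm_eq {m : σ →₀ ℕ} (h : ∃ i, q ≤ m i) : ∃ i, q ≤ m i ∧
    normalForm f q hf m =
      normalFormLinear f q hf (f i * monomial (m - Finsupp.single i q) 1) := by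
  classical
  refine ⟨h.choose, h.choose_spec, ?_⟩
  rw [normalForm, dif_pos h, linear_apply_eq_sum, Finset.sum_attach
    (f := fun m' => coeff m' (f h.choose * monomial (m - Finsupp.single h.choose q) (1 : F)) •
        normalForm f q hf m')]
  simp only [normalFormLinear_monomial]

theorem normalFormLinear_rewrite (a : σ →₀ ℕ) (i : σ) :
    normalFormLinear f q hf (monomial (a + Finsupp.single i q) 1) =
      normalFormLinear f q hf (f i * monomial a 1) := by
  induction hd : a.degree using Nat.strong_induction_on generalizing a i with
  | _ d ih =>
  have hlin : ∀ (g : MvPolynomial σ F) (i : σ), g.totalDegree < d →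
      normalFormLinear f q hf (g * monomial (Finsupp.single i q) 1) =
        normalFormLinear f q hf (f i * g) := by
    intro g i hg
    conv_lhs => rw [← support_sum_monomial_coeff g]
    conv_rhs => rw [← support_sum_monomial_coeff g]
    rw [Finset.sum_mul, Finset.mul_sum, map_sum, map_sum]
    refine Finset.sum_congr rfl fun m hm => ?_
    have hm' := degree_le_totalDegree hm
    have h1 := ih m.degree (by omega) m i rfl
    have h2 : (monomial m (coeff m g) : MvPolynomial σ F) = coeff m g • monomial m 1 := by
      rw [smul_monomial, smul_eq_mul, mul_one]
    rw [h2, smul_mul_assoc, mul_smul_comm, map_smul, map_smul, monomial_mul, one_mul, h1]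
  obtain ⟨j, hj, he⟩ := exists_normalForm_eq (f := f) (hf := hf)
    (m := a + Finsupp.single i q) ⟨i, by simp⟩
  rw [normalFormLinear_monomial, he]
  by_cases hji : j = i
  · subst hji; rw [add_tsub_cancel_right]
  · have haj : q ≤ a j := by
      simpa [Finsupp.single_apply, Ne.symm hji] using hj
    obtain ⟨c, rfl⟩ : ∃ c, a = c + Finsupp.single j q :=
      ⟨a - Finsupp.single j q, (tsub_add_cancel_of_le (by simpa using haj)).symm⟩
    have hc : c.degree + q = d := by rw [← hd, map_add, Finsupp.degree_single]
    have e1 : c + Finsupp.single j q + Finsupp.single i q - Finsupp.single j q =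
        c + Finsupp.single i q := by
      rw [add_right_comm, add_tsub_cancel_right]
    have hdeg : ∀ k, (f k * monomial c (1 : F)).totalDegree < d := by
      intro k
      have := totalDegree_mul_monomial_le (f k) c
      have := hf k
      omega
    rw [e1]
    have h1 : f j * monomial (c + Finsupp.single i q) (1 : F) =
        f j * monomial c 1 * monomial (Finsupp.single i q) 1 := by
      rw [mul_assoc, monomial_mul, one_mul]
    have h2 : f i * monomial (c + Finsupp.single j q) (1 : F) =
        f i * monomial c 1 * monomial (Finsupp.single j q) 1 := by
      rw [mul_assoc, monomial_mul, one_mul]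
    rw [h1, h2, hlin _ _ (hdeg j), hlin _ _ (hdeg i)]
    congr 1; ring

/-- The ideal of the relations `X i ^ q = f i`. -/
noncomputable def powerIdeal (f : σ → MvPolynomial σ F) (q : ℕ) : Ideal (MvPolynomial σ F) :=
  Ideal.span (Set.range fun i => monomial (Finsupp.single i q) 1 - f i)

theorem normalFormLinear_eq_zero {g : MvPolynomial σ F} (hg : g ∈ powerIdeal f q) :
    normalFormLinear f q hf g = 0 := by
  have : ∀ a, normalFormLinear f q hf (a * g) = 0 := by
    refine Submodule.span_induction (p := fun g _ => ∀ a, normalFormLinear f q hf (a * g) = 0)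
      ?_ ?_ ?_ ?_ hg
    · rintro _ ⟨i, rfl⟩ a
      beta_reduce
      rw [← support_sum_monomial_coeff a, Finset.sum_mul, map_sum]
      refine Finset.sum_eq_zero fun m _ => ?_
      have h2 : (monomial m (coeff m a) : MvPolynomial σ F) = coeff m a • monomial m 1 := by
        rw [smul_monomial, smul_eq_mul, mul_one]
      rw [h2, smul_mul_assoc, map_smul, mul_sub, map_sub, monomial_mul, one_mul,
        normalFormLinear_rewrite, mul_comm, sub_self, smul_zero]
    · simp
    · intro x y _ _ hx hy a
      rw [mul_add, map_add, hx, hy, add_zero]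
    · intro b x _ hx a
      rw [smul_eq_mul, ← mul_assoc, hx]
  simpa using this 1

theorem normalFormLinear_eq_self {g : MvPolynomial σ F} (hg : g.totalDegree < q) :
    normalFormLinear f q hf g = g := by
  rw [linear_apply_eq_sum]
  conv_rhs => rw [← support_sum_monomial_coeff g]
  refine Finset.sum_congr rfl fun m hm => ?_
  rw [normalFormLinear_monomial, normalForm_of_reduced, smul_monomial, smul_eq_mul, mul_one]
  rintro ⟨i, hi⟩
  have h1 := degree_le_totalDegree hm
  have h2 := degree_tsub_single hi
  omega

theorem eq_zero_of_mem_powerIdeal (hf : ∀ i, (f i).totalDegree < q) {g : MvPolynomial σ F}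
    (hg : g.totalDegree < q) (hgI : g ∈ powerIdeal f q) : g = 0 := by
  rw [← normalFormLinear_eq_self (hf := hf) hg, normalFormLinear_eq_zero hgI]

theorem mk_monomial_mem_span (hf : ∀ i, (f i).totalDegree < q) (m : σ →₀ ℕ) :
    Ideal.Quotient.mkₐ F (powerIdeal f q) (monomial m 1) ∈ Submodule.span F
      ((fun m => Ideal.Quotient.mkₐ F (powerIdeal f q) (monomial m 1)) '' {m | ∀ i, m i < q}) := by
  induction hd : m.degree using Nat.strong_induction_on generalizing m with
  | _ d ih =>
  by_cases h : ∃ i, q ≤ m i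
  · obtain ⟨i, hi⟩ := h
    obtain ⟨c, rfl⟩ : ∃ c, m = c + Finsupp.single i q :=
      ⟨m - Finsupp.single i q, (tsub_add_cancel_of_le (by simpa using hi)).symm⟩
    have hc : c.degree + q = d := by rw [← hd, map_add, Finsupp.degree_single]
    have h1 : Ideal.Quotient.mkₐ F (powerIdeal f q) (monomial (c + Finsupp.single i q) 1) =
        Ideal.Quotient.mkₐ F (powerIdeal f q) (f i * monomial c 1) := by
      refine (Ideal.Quotient.mk_eq_mk_iff_sub_mem _ _).2 ?_
      have : (monomial (c + Finsupp.single i q) 1 - f i * monomial c 1 : MvPolynomial σ F) =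
          monomial c 1 * (monomial (Finsupp.single i q) 1 - f i) := by
        rw [mul_sub, monomial_mul, one_mul, mul_comm (f i)]
      rw [this]
      exact Ideal.mul_mem_left _ _ (Ideal.subset_span ⟨i, rfl⟩)
    rw [h1, ← support_sum_monomial_coeff (f i * monomial c 1), map_sum]
    refine Submodule.sum_mem _ fun m' hm' => ?_
    have h2 := degree_le_totalDegree hm'
    have h3 := totalDegree_mul_monomial_le (f i) c
    have h4 := hf i
    have h5 := Submodule.smul_mem _ (coeff m' (f i * monomial c 1)) (ih _ (by omega) m' rfl)
    rwa [← map_smul, smul_monomial, smul_eq_mul, mul_one] at h5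
  · push Not at h
    exact Submodule.subset_span ⟨m, h, rfl⟩

theorem span_reduced_eq_top (hf : ∀ i, (f i).totalDegree < q) :
    Submodule.span F
      ((fun m => Ideal.Quotient.mkₐ F (powerIdeal f q) (monomial m 1)) '' {m | ∀ i, m i < q}) =
        ⊤ := by
  refine eq_top_iff.2 fun x _ => ?_
  obtain ⟨g, rfl⟩ := Ideal.Quotient.mkₐ_surjective F (powerIdeal f q) x
  rw [← support_sum_monomial_coeff g, map_sum]
  refine Submodule.sum_mem _ fun m _ => ?_
  have h5 := Submodule.smul_mem _ (coeff m g) (mk_monomial_mem_span hf m)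
  rwa [← map_smul, smul_monomial, smul_eq_mul, mul_one] at h5

theorem finrank_powerIdeal_le [Fintype σ] (hf : ∀ i, (f i).totalDegree < q) :
    Module.Finite F (MvPolynomial σ F ⧸ powerIdeal f q) ∧
      Module.finrank F (MvPolynomial σ F ⧸ powerIdeal f q) ≤ q ^ Fintype.card σ := by
  classical
  let v : (σ → Fin q) → MvPolynomial σ F ⧸ powerIdeal f q := fun a =>
    Ideal.Quotient.mkₐ F (powerIdeal f q)
      (monomial (Finsupp.equivFunOnFinite.symm fun i => (a i : ℕ)) 1)
  have hv : Submodule.span F (Set.range v) = ⊤ := by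
    rw [← span_reduced_eq_top hf]
    congr 1
    ext x
    constructor
    · rintro ⟨a, rfl⟩
      exact ⟨_, fun i => by simp, rfl⟩
    · rintro ⟨m, hm, rfl⟩
      refine ⟨fun i => ⟨m i, hm i⟩, ?_⟩
      simp only [v]
      congr 2
      ext i; simp
  refine ⟨⟨⟨Finset.univ.image v, by rw [Finset.coe_image, Finset.coe_univ, Set.image_univ, hv]⟩⟩, ?_⟩
  have h1 := finrank_range_le_card (R := F) v
  rw [Set.finrank, hv, finrank_top] at h1
  simpa using h1

end normalForm

open MvPolynomial in
/-- A polynomial self-map of affine space over a prime field has, after finitely many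
iterations, enough points at which it coincides with a power of Frobenius. -/
theorem exists_frobenius_point (p : ℕ) [hp : Fact p.Prime] {σ : Type} [Fintype σ]
    (f : σ → MvPolynomial σ (ZMod p)) (D : MvPolynomial σ (ZMod p))
    (hD : (bind₁ f)^[Fintype.card σ] D ≠ 0) :
    ∃ (K : Type) (_ : Field K) (_ : Finite K) (_ : CharP K p) (ev : MvPolynomial σ (ZMod p) →+* K)
      (k : ℕ), (∀ i, ev (f i) = ev (X i) ^ p ^ k) ∧ ev D ≠ 0 := by
  classical
  set D' := (bind₁ f)^[Fintype.card σ] D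
  let k := D'.totalDegree + ∑ i, (f i).totalDegree
  have hk : k < p ^ k := Nat.lt_pow_self hp.out.one_lt
  set q := p ^ k with hq
  have hf : ∀ i, (f i).totalDegree < q := fun i =>
    lt_of_le_of_lt ((Finset.single_le_sum (f := fun i => (f i).totalDegree)
      (fun _ _ => Nat.zero_le _) (Finset.mem_univ i)).trans (Nat.le_add_left _ _)) hk
  let I := powerIdeal f q
  let mk : MvPolynomial σ (ZMod p) →+* MvPolynomial σ (ZMod p) ⧸ I := Ideal.Quotient.mk I
  have hmk : ∀ i, mk (f i) = mk (X i) ^ q := by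
    intro i
    rw [← map_pow]
    refine ((Ideal.Quotient.mk_eq_mk_iff_sub_mem _ _).2 ?_).symm
    rw [X_pow_eq_monomial]
    exact Ideal.subset_span ⟨i, rfl⟩
  obtain ⟨hfin, hrank⟩ := finrank_powerIdeal_le hf
  have hD' : D' ∉ I := fun h => hD (eq_zero_of_mem_powerIdeal hf
    (lt_of_le_of_lt (Nat.le_add_right _ _) hk) h)
  have hnt : Nontrivial (MvPolynomial σ (ZMod p) ⧸ I) :=
    Ideal.Quotient.nontrivial_iff.2 (fun h => hD' (h ▸ trivial))
  have hchar : CharP (MvPolynomial σ (ZMod p) ⧸ I) p := charP_of_injective_algebraMap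
    (algebraMap (ZMod p) _).injective p
  have hfrob : ∀ P, mk (bind₁ f P) = mk P ^ q := by
    intro P
    have : mk.comp (bind₁ f).toRingHom =
        (iterateFrobenius (MvPolynomial σ (ZMod p) ⧸ I) p k).comp mk := by
      refine MvPolynomial.ringHom_ext (fun r => ?_) (fun i => ?_)
      · exact DFunLike.congr_fun (RingHom.ext_zmod
          ((mk.comp (bind₁ f).toRingHom).comp C)
          (((iterateFrobenius (MvPolynomial σ (ZMod p) ⧸ I) p k).comp mk).comp C)) r
      · simp [iterateFrobenius_def, hmk, hq]
    have h2 := DFunLike.congr_fun this P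
    simpa [iterateFrobenius_def] using h2
  have hiter : ∀ j, mk ((bind₁ f)^[j] D) = mk D ^ q ^ j := by
    intro j
    induction j with
    | zero => simp
    | succ j ih => rw [Function.iterate_succ_apply', hfrob, ih, ← pow_mul, pow_succ]
  have hnil : ¬ IsNilpotent (mk D) := by
    rintro ⟨m, hm⟩
    apply hD'
    rw [← Ideal.Quotient.eq_zero_iff_mem]
    change mk D' = 0
    rw [hiter]
    let L := LinearMap.mulLeft (ZMod p) (mk D)
    have hker : ∀ j, Module.finrank (ZMod p) (MvPolynomial σ (ZMod p) ⧸ I) ≤ j →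
        LinearMap.ker (L ^ j) =
          LinearMap.ker (L ^ Module.finrank (ZMod p) (MvPolynomial σ (ZMod p) ⧸ I)) :=
      fun j hj => Module.End.ker_pow_eq_ker_pow_finrank_of_le hj
    have h1 := (hker (q ^ Fintype.card σ) hrank).trans
      (hker (max m _) (le_max_right m _)).symm
    have h2 : (1 : MvPolynomial σ (ZMod p) ⧸ I) ∈ LinearMap.ker (L ^ (q ^ Fintype.card σ)) := by
      rw [h1, LinearMap.mem_ker]
      simp only [L]
      rw [LinearMap.pow_mulLeft, LinearMap.mulLeft_apply, mul_one]
      exact pow_eq_zero_of_le (le_max_left _ _) hm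
    rw [LinearMap.mem_ker] at h2
    simp only [L] at h2
    rwa [LinearMap.pow_mulLeft, LinearMap.mulLeft_apply, mul_one] at h2
  rw [nilpotent_iff_mem_prime] at hnil
  push Not at hnil
  obtain ⟨J, hJ, hDJ⟩ := hnil
  have hfinite : Finite (MvPolynomial σ (ZMod p) ⧸ I) := Module.finite_of_finite (ZMod p)
  have hfJ : Finite ((MvPolynomial σ (ZMod p) ⧸ I) ⧸ J) :=
    Finite.of_surjective _ Ideal.Quotient.mk_surjective
  let hfield : Field ((MvPolynomial σ (ZMod p) ⧸ I) ⧸ J) :=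
    (Finite.isField_of_domain _).toField
  let π : (MvPolynomial σ (ZMod p) ⧸ I) →+* ((MvPolynomial σ (ZMod p) ⧸ I) ⧸ J) :=
    Ideal.Quotient.mk J
  have hcharJ : CharP ((MvPolynomial σ (ZMod p) ⧸ I) ⧸ J) p := charP_of_injective_algebraMap
    (algebraMap (ZMod p) _).injective p
  refine ⟨_, hfield, hfJ, hcharJ, π.comp mk, k, fun i => ?_, ?_⟩
  · simp [hmk, hq]
  · intro h
    exact hDJ (Ideal.Quotient.eq_zero_iff_mem.1 h)

/-- Evaluation of the letter `i` as `t ^ i * b * t ^ (-i)`. -/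
def conjEval {G : Type*} [Group G] (t b : G) : FreeGroup ℤ →* G :=
  FreeGroup.lift fun i => t ^ i * b * (t ^ i)⁻¹

theorem conjEval_of {G : Type*} [Group G] (t b : G) (i : ℤ) :
    conjEval t b (FreeGroup.of i) = t ^ i * b * (t ^ i)⁻¹ := by simp [conjEval]

theorem map_conjEval {G G' : Type*} [Group G] [Group G'] (f : G →* G') (t b : G) (r : FreeGroup ℤ) :
    f (conjEval t b r) = conjEval (f t) (f b) r := by
  have : f.comp (conjEval t b) = conjEval (f t) (f b) := by
    ext i; simp [conjEval_of]
  exact DFunLike.congr_fun this r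

theorem conjEval_free_injective :
    Function.Injective (conjEval (FreeGroup.of false) (FreeGroup.of true)) := by
  let d : Bool → ℤ := fun z => if z = false then 1 else 0
  have h : (rewriteHom false d).comp (conjEval (FreeGroup.of false) (FreeGroup.of true)) =
      SemidirectProduct.inl.comp (FreeGroup.map fun i : ℤ => (true, i)) := by
    ext1 i
    have h1 : rewriteHom false d (FreeGroup.of true) =
        SemidirectProduct.inl (FreeGroup.of (true, 0)) := by
      rw [rewriteHom_of_ne _ _ (by decide)]
      simp [d]
    have h2 := SemidirectProduct.inl_aut (φ := shiftAction Bool) (Multiplicative.ofAdd i)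
      (FreeGroup.of (true, 0))
    simp only [MonoidHom.comp_apply, conjEval_of, map_mul, map_inv, map_zpow, rewriteHom_of_self, h1]
    rw [← map_zpow SemidirectProduct.inr, ← map_inv SemidirectProduct.inr]
    have h4 : Multiplicative.ofAdd (d false) ^ i = Multiplicative.ofAdd i := by
      simp [d, ← ofAdd_zsmul]
    rw [h4, ← h2, shiftAction_apply]
    simp [indexShift_apply]
  have h3 : Function.Injective (SemidirectProduct.inl.comp (FreeGroup.map fun i : ℤ => (true, i)) :
      FreeGroup ℤ →* IndexedFree Bool) := by
    rw [MonoidHom.coe_comp]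
    exact SemidirectProduct.inl_injective.comp
      (FreeGroup.map_injective fun a b hab => by simpa using hab)
  rw [← h, MonoidHom.coe_comp] at h3
  exact h3.of_comp

section sanov

open Matrix

/-- The action of the modular group on nonzero integral vectors. -/
abbrev modularAction : MulAction (SpecialLinearGroup (Fin 2) ℤ) {v : Fin 2 → ℤ // v ≠ 0} where
  smul g v := ⟨(g : Matrix (Fin 2) (Fin 2) ℤ) *ᵥ v.1, fun h => v.2 (by
    have h1 : ((g⁻¹ * g : SpecialLinearGroup (Fin 2) ℤ) : Matrix (Fin 2) (Fin 2) ℤ) *ᵥ v.1 = 0 := by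
      rw [Matrix.SpecialLinearGroup.coe_mul, ← Matrix.mulVec_mulVec, h, Matrix.mulVec_zero]
    simpa using h1)⟩
  one_smul v := Subtype.ext (by
    change ((1 : SpecialLinearGroup (Fin 2) ℤ) : Matrix (Fin 2) (Fin 2) ℤ) *ᵥ v.1 = v.1
    simp)
  mul_smul g h v := Subtype.ext (by
    change ((g * h : SpecialLinearGroup (Fin 2) ℤ) : Matrix (Fin 2) (Fin 2) ℤ) *ᵥ v.1 =
      (g : Matrix (Fin 2) (Fin 2) ℤ) *ᵥ ((h : Matrix (Fin 2) (Fin 2) ℤ) *ᵥ v.1)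
    rw [Matrix.SpecialLinearGroup.coe_mul, Matrix.mulVec_mulVec])

/-- The standard free generators of a free subgroup of the modular group. -/
def sanovMatrix : Bool → SpecialLinearGroup (Fin 2) ℤ
  | false => ⟨!![1, 2; 0, 1], by simp⟩
  | true => ⟨!![1, 0; 2, 1], by simp⟩

theorem sanov_injective : Function.Injective (FreeGroup.lift sanovMatrix) := by
  let := modularAction
  have hsm : ∀ (g : SpecialLinearGroup (Fin 2) ℤ) (v : {v : Fin 2 → ℤ // v ≠ 0}) (i : Fin 2),
      (g • v).1 i = (g : Matrix (Fin 2) (Fin 2) ℤ) i 0 * v.1 0 +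
        (g : Matrix (Fin 2) (Fin 2) ℤ) i 1 * v.1 1 := by
    intro g v i
    change ((g : Matrix (Fin 2) (Fin 2) ℤ) *ᵥ v.1) i = _
    simp [Matrix.mulVec, dotProduct, Fin.sum_univ_two]
  have ht : ((sanovMatrix true : SpecialLinearGroup (Fin 2) ℤ) : Matrix (Fin 2) (Fin 2) ℤ) =
      !![1, 0; 2, 1] := rfl
  have hf : ((sanovMatrix false : SpecialLinearGroup (Fin 2) ℤ) : Matrix (Fin 2) (Fin 2) ℤ) =
      !![1, 2; 0, 1] := rfl
  have ht' : (((sanovMatrix true)⁻¹ : SpecialLinearGroup (Fin 2) ℤ) : Matrix (Fin 2) (Fin 2) ℤ) =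
      !![1, 0; -2, 1] := by
    rw [Matrix.SpecialLinearGroup.coe_inv, ht, Matrix.adjugate_fin_two_of]; simp
  have hf' : (((sanovMatrix false)⁻¹ : SpecialLinearGroup (Fin 2) ℤ) : Matrix (Fin 2) (Fin 2) ℤ) =
      !![1, -2; 0, 1] := by
    rw [Matrix.SpecialLinearGroup.coe_inv, hf, Matrix.adjugate_fin_two_of]; simp
  have hv : ∀ v : {v : Fin 2 → ℤ // v ≠ 0}, v.1 0 = 0 → v.1 1 = 0 → False := fun v h0 h1 =>
    v.2 (by ext i; fin_cases i <;> assumption)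
  let X : Bool → Set {v : Fin 2 → ℤ // v ≠ 0}
    | false => {v | v.1 1 = 0 ∨ v.1 1 * v.1 1 < v.1 0 * v.1 1}
    | true => {v | v.1 0 = 0 ∨ v.1 0 * v.1 0 ≤ v.1 0 * v.1 1}
  let Y : Bool → Set {v : Fin 2 → ℤ // v ≠ 0}
    | false => {v | v.1 1 ≠ 0 ∧ v.1 0 * v.1 1 ≤ -(v.1 1 * v.1 1)}
    | true => {v | v.1 0 ≠ 0 ∧ v.1 0 * v.1 1 < -(v.1 0 * v.1 0)}
  have hX : Disjoint (X false) (X true) := by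
    rw [Set.disjoint_left]
    rintro v h1 h2
    simp only [X, Set.mem_ofPred_eq] at h1 h2
    rcases h1 with h1 | h1
    · refine hv v ?_ h1
      rcases h2 with h2 | h2
      · exact h2
      · rw [h1] at h2; nlinarith
    · rcases h2 with h2 | h2
      · rw [h2] at h1; nlinarith
      · nlinarith [sq_nonneg (v.1 0 - v.1 1)]
  have hY : Disjoint (Y false) (Y true) := by
    rw [Set.disjoint_left]
    rintro v h1 h2
    simp only [Y, Set.mem_ofPred_eq] at h1 h2
    nlinarith [sq_nonneg (v.1 0 + v.1 1)]
  refine FreeGroup.injective_lift_of_ping_pong sanovMatrix X Y ?_ ?_ ?_ ?_ ?_ ?_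
  · rintro (_ | _)
    · exact ⟨⟨![1, 0], fun h => by simpa using congrFun h 0⟩, Or.inl rfl⟩
    · exact ⟨⟨![0, 1], fun h => by simpa using congrFun h 1⟩, Or.inl rfl⟩
  · rintro (_ | _) (_ | _) h
    · exact absurd rfl h
    · exact hX
    · exact hX.symm
    · exact absurd rfl h
  · rintro (_ | _) (_ | _) h
    · exact absurd rfl h
    · exact hY
    · exact hY.symm
    · exact absurd rfl h
  · rintro (_ | _) (_ | _) <;> rw [Set.disjoint_left] <;> rintro v h1 ⟨h2, h3⟩ <;>
      simp only [X, Set.mem_ofPred_eq] at h1 <;> rcases h1 with h1 | h1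
    · exact h2 h1
    · nlinarith [mul_self_nonneg (v.1 1)]
    · rw [h1] at h3; nlinarith [mul_self_nonneg (v.1 0)]
    · nlinarith [mul_self_nonneg (v.1 1), mul_self_nonneg (v.1 0)]
    · rw [h1] at h3; nlinarith [mul_self_pos.2 h2]
    · nlinarith [mul_self_pos.2 h2, mul_self_nonneg (v.1 0)]
    · exact h2 h1
    · nlinarith [mul_self_nonneg (v.1 0)]
  · rintro (_ | _) _ ⟨v, hv', rfl⟩ <;> simp only [Y, Set.mem_compl_iff, Set.mem_ofPred_eq, not_and,
      not_le, not_lt] at hv' <;> simp only [X, Set.mem_ofPred_eq, hsm, ht, hf] <;> simp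
    · by_cases h : v.1 1 = 0
      · exact Or.inl h
      · right; nlinarith [hv' h]
    · by_cases h : v.1 0 = 0
      · exact Or.inl h
      · right; nlinarith [hv' h]
  · rintro (_ | _) _ ⟨v, hv', rfl⟩ <;> simp only [X, Set.mem_compl_iff, Set.mem_ofPred_eq, not_or,
      not_le, not_lt] at hv' <;> simp only [Y, Set.mem_ofPred_eq, hsm, Pi.inv_apply, ht', hf'] <;> simp
    · exact ⟨hv'.1, by nlinarith [hv'.2]⟩
    · exact ⟨hv'.1, by nlinarith [hv'.2]⟩

theorem exists_free_specialLinear (n : ℕ) :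
    ∃ ρ : FreeGroup (Fin n) →* SpecialLinearGroup (Fin 2) ℤ, Function.Injective ρ := by
  refine ⟨((FreeGroup.lift sanovMatrix).comp (conjEval (FreeGroup.of false) (FreeGroup.of true))).comp
    (FreeGroup.map fun i => ((i : ℕ) : ℤ)), ?_⟩
  simp only [MonoidHom.coe_comp]
  exact (sanov_injective.comp conjEval_free_injective).comp
    (FreeGroup.map_injective fun a b h => by simpa [Fin.ext_iff] using h)

end sanov

section wordMatrix

open Matrix

variable {ι R : Type*} [DecidableEq ι] [CommRing R]

/-- The value of a reduced word at `2 × 2` matrices, with adjugates in place of inverses. -/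
def wordMatrix (M : ι → Matrix (Fin 2) (Fin 2) R) (w : FreeGroup ι) : Matrix (Fin 2) (Fin 2) R :=
  (w.toWord.map fun p => if p.2 then M p.1 else (M p.1).adjugate).prod

theorem map_wordMatrix {S : Type*} [CommRing S] (e : R →+* S) (M : ι → Matrix (Fin 2) (Fin 2) R)
    (w : FreeGroup ι) : e.mapMatrix (wordMatrix M w) = wordMatrix (fun i => e.mapMatrix (M i)) w := by
  rw [wordMatrix, wordMatrix, map_list_prod, List.map_map]
  congr 2
  funext p
  simp only [Function.comp_apply]
  split_ifs
  · rfl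
  · exact e.map_adjugate _

theorem wordMatrix_specialLinear (ρ : FreeGroup ι →* Matrix.SpecialLinearGroup (Fin 2) R)
    (w : FreeGroup ι) :
    wordMatrix (fun i => (ρ (FreeGroup.of i) : Matrix (Fin 2) (Fin 2) R)) w =
      (ρ w : Matrix (Fin 2) (Fin 2) R) := by
  have hρ : ρ w = (w.toWord.map fun p => cond p.2 (ρ (FreeGroup.of p.1))
      (ρ (FreeGroup.of p.1))⁻¹).prod := by
    rw [← FreeGroup.lift_mk (f := fun i => ρ (FreeGroup.of i)), FreeGroup.mk_toWord]
    congr 1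
    ext1 i
    simp
  rw [hρ, wordMatrix]
  generalize w.toWord = L
  induction L with
  | nil => simp
  | cons p L ih =>
    rw [List.map_cons, List.prod_cons, ih, List.map_cons, List.prod_cons,
      Matrix.SpecialLinearGroup.coe_mul]
    rcases p with ⟨i, _ | _⟩
    · simp
    · simp

theorem wordMatrix_units {K : Type*} [Field K] (U : ι → (Matrix (Fin 2) (Fin 2) K)ˣ)
    (w : FreeGroup ι) : ∃ c : K, c ≠ 0 ∧ wordMatrix (fun i => (U i : Matrix (Fin 2) (Fin 2) K)) w =
      c • (FreeGroup.lift U w : Matrix (Fin 2) (Fin 2) K) := by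
  have hρ : FreeGroup.lift U w = (w.toWord.map fun p => cond p.2 (U p.1) (U p.1)⁻¹).prod := by
    rw [← FreeGroup.lift_mk, FreeGroup.mk_toWord]
  rw [hρ, wordMatrix]
  generalize w.toWord = L
  induction L with
  | nil => exact ⟨1, one_ne_zero, by simp⟩
  | cons p L ih =>
    obtain ⟨c, hc, e⟩ := ih
    rw [List.map_cons, List.prod_cons, e, List.map_cons, List.prod_cons, Units.val_mul]
    rcases p with ⟨i, _ | _⟩
    · have hd : (U i : Matrix (Fin 2) (Fin 2) K).det ≠ 0 := by
        have := (U i).isUnit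
        rw [Matrix.isUnit_iff_isUnit_det] at this
        exact this.ne_zero
      refine ⟨(U i : Matrix (Fin 2) (Fin 2) K).det * c, mul_ne_zero hd hc, ?_⟩
      have : (U i : Matrix (Fin 2) (Fin 2) K).adjugate =
          (U i : Matrix (Fin 2) (Fin 2) K).det • ((U i)⁻¹ : (Matrix (Fin 2) (Fin 2) K)ˣ).val := by
        have h := Matrix.adjugate_mul (U i : Matrix (Fin 2) (Fin 2) K)
        calc _ = (U i : Matrix (Fin 2) (Fin 2) K).adjugate *
              ((U i : Matrix (Fin 2) (Fin 2) K) * ((U i)⁻¹ : (Matrix (Fin 2) (Fin 2) K)ˣ).val) := by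
              simp
          _ = _ := by rw [← mul_assoc, h]; simp
      simp [this, smul_smul, mul_comm c]
    · exact ⟨c, hc, by simp⟩

/-- Three linear forms on `2 × 2` matrices whose common zeros are the scalar matrices. -/
def offScalar (k : Fin 3) (A : Matrix (Fin 2) (Fin 2) R) : R :=
  ![A 0 1, A 1 0, A 0 0 - A 1 1] k

theorem map_offScalar {S : Type*} [CommRing S] (e : R →+* S) (k : Fin 3)
    (A : Matrix (Fin 2) (Fin 2) R) : offScalar k (e.mapMatrix A) = e (offScalar k A) := by
  fin_cases k <;> simp [offScalar]

theorem eq_scalar_of_offScalar {A : Matrix (Fin 2) (Fin 2) R} (h : ∀ k, offScalar k A = 0) :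
    A = A 0 0 • 1 := by
  have h0 : A 0 1 = 0 := h 0
  have h1 : A 1 0 = 0 := h 1
  have h2 : A 0 0 - A 1 1 = 0 := h 2
  ext i j
  fin_cases i <;> fin_cases j <;> simp [h0, h1, (sub_eq_zero.1 h2).symm]

theorem offScalar_eq_zero_of_commute {A : Matrix (Fin 2) (Fin 2) R} (h : ∀ B, A * B = B * A)
    (k : Fin 3) : offScalar k A = 0 := by
  have h0 := h !![0, 1; 0, 0]
  have h1 := h !![0, 0; 1, 0]
  have a1 := congrFun (congrFun h0 0) 0
  have a2 := congrFun (congrFun h0 0) 1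
  have a3 := congrFun (congrFun h1 0) 0
  simp [Matrix.mul_apply, Fin.sum_univ_two] at a1 a2 a3
  fin_cases k
  · simpa [offScalar] using a3
  · simpa [offScalar] using a1.symm
  · simp [offScalar, a2]

/-- Conjugation by invertible matrices, as permutations of the matrix ring. -/
def unitConj (R : Type*) [CommRing R] :
    (Matrix (Fin 2) (Fin 2) R)ˣ →* Equiv.Perm (Matrix (Fin 2) (Fin 2) R) :=
  (MulAction.toPermHom (ConjAct (Matrix (Fin 2) (Fin 2) R)ˣ) (Matrix (Fin 2) (Fin 2) R)).comp
    ConjAct.toConjAct.toMonoidHom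

theorem unitConj_apply (U : (Matrix (Fin 2) (Fin 2) R)ˣ) (A : Matrix (Fin 2) (Fin 2) R) :
    unitConj R U A = U.val * A * U⁻¹.val := rfl

theorem unitConj_eq_of_smul {K : Type*} [Field K] {U V : (Matrix (Fin 2) (Fin 2) K)ˣ} {c : K}
    (h : V.val = c • U.val) : unitConj K V = unitConj K U := by
  ext1 A
  rw [unitConj_apply, unitConj_apply, Units.mul_inv_eq_iff_eq_mul, h]
  simp [mul_assoc]

end wordMatrix

section borisovSapir

open Matrix MvPolynomial

theorem exists_offScalar_ne_zero {n : ℕ}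
    {ρ : FreeGroup (Fin n) →* Matrix.SpecialLinearGroup (Fin 2) ℤ} (hρ : Function.Injective ρ)
    {h : FreeGroup (Fin n)} (hh : h ≠ 1) :
    ∃ k, offScalar k (ρ h : Matrix (Fin 2) (Fin 2) ℤ) ≠ 0 := by
  by_contra! hk
  have e := eq_scalar_of_offScalar hk
  have hdet := (ρ h).det_coe
  rw [e, Matrix.det_smul] at hdet
  simp only [Fintype.card_fin, Matrix.det_one, mul_one] at hdet
  have h2 : ρ (h ^ 2) = ρ 1 := by
    rw [map_pow, map_one]
    apply Subtype.ext
    change ((ρ h ^ 2 : Matrix.SpecialLinearGroup (Fin 2) ℤ) : Matrix (Fin 2) (Fin 2) ℤ) =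
      ((1 : Matrix.SpecialLinearGroup (Fin 2) ℤ) : Matrix (Fin 2) (Fin 2) ℤ)
    rw [Matrix.SpecialLinearGroup.coe_pow, e, smul_pow, hdet]
    simp
  exact hh ((pow_eq_one_iff_left two_ne_zero).1 (hρ h2))

/-- **Borisov–Sapir.** An element of a free group of finite rank surviving all iterates of an
endomorphism survives in a finite quotient on which the endomorphism becomes inner. -/
theorem exists_finite_quotient_endomorphism {n : ℕ} (φ : FreeGroup (Fin n) →* FreeGroup (Fin n))
    {g : FreeGroup (Fin n)} (hg : ∀ m : ℕ, φ^[m] g ≠ 1) :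
    ∃ (Q : Type) (_ : Group Q) (_ : Finite Q) (f : FreeGroup (Fin n) →* Q) (τ : Q),
      (∀ x, τ * f x * τ⁻¹ = f (φ x)) ∧ f g ≠ 1 := by
  let σ := Fin n × Fin 2 × Fin 2
  obtain ⟨ρ, hρ⟩ := exists_free_specialLinear n
  obtain ⟨k, hk⟩ := exists_offScalar_ne_zero hρ (hg (Fintype.card σ))
  obtain ⟨p, hpgt, hp⟩ := Nat.exists_infinite_primes
    ((offScalar k (ρ (φ^[Fintype.card σ] g) : Matrix (Fin 2) (Fin 2) ℤ)).natAbs + 1)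
  have : Fact p.Prime := ⟨hp⟩
  let X' : Fin n → Matrix (Fin 2) (Fin 2) (MvPolynomial σ (ZMod p)) := fun i a b => X (i, a, b)
  let F : σ → MvPolynomial σ (ZMod p) := fun s => wordMatrix X' (φ (FreeGroup.of s.1)) s.2.1 s.2.2
  let D : MvPolynomial σ (ZMod p) := (∏ i, (X' i).det) * offScalar k (wordMatrix X' g)
  let ev : (FreeGroup (Fin n) →* Matrix.SpecialLinearGroup (Fin 2) (ZMod p)) →
      MvPolynomial σ (ZMod p) →+* ZMod p := fun S =>
    MvPolynomial.eval fun s => (S (FreeGroup.of s.1) : Matrix (Fin 2) (Fin 2) (ZMod p)) s.2.1 s.2.2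
  have hX : ∀ S i, (ev S).mapMatrix (X' i) =
      (S (FreeGroup.of i) : Matrix (Fin 2) (Fin 2) (ZMod p)) := by
    intro S i; ext a b; exact MvPolynomial.eval_X _
  have hword : ∀ S w, (ev S).mapMatrix (wordMatrix X' w) =
      (S w : Matrix (Fin 2) (Fin 2) (ZMod p)) := by
    intro S w
    rw [map_wordMatrix, ← wordMatrix_specialLinear]
    simp only [hX]
  have hstep : ∀ S P, ev S (bind₁ F P) = ev (S.comp φ) P := by
    intro S P
    have : (ev S).comp (bind₁ F : MvPolynomial σ (ZMod p) →ₐ[ZMod p] _).toRingHom =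
        ev (S.comp φ) := by
      apply MvPolynomial.ringHom_ext
      · intro r; simp [ev]
      · intro s
        have := congrFun (congrFun (hword S (φ (FreeGroup.of s.1))) s.2.1) s.2.2
        simpa [ev, F] using this
    exact DFunLike.congr_fun this P
  have hiter : ∀ (m : ℕ) S P, ∃ S' : FreeGroup (Fin n) →* Matrix.SpecialLinearGroup (Fin 2) (ZMod p),
      (∀ x, S' x = S (φ^[m] x)) ∧ ev S ((bind₁ F)^[m] P) = ev S' P := by
    intro m
    induction m with
    | zero => exact fun S P => ⟨S, fun _ => rfl, rfl⟩
    | succ m ih =>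
      intro S P
      obtain ⟨S', h1, h2⟩ := ih (S.comp φ) P
      refine ⟨S', fun x => ?_, ?_⟩
      · rw [h1, Function.iterate_succ_apply']; rfl
      · rw [Function.iterate_succ_apply', hstep, h2]
  have hD : (bind₁ F)^[Fintype.card σ] D ≠ 0 := by
    intro h0
    obtain ⟨S', h1, h2⟩ := hiter (Fintype.card σ)
      ((Matrix.SpecialLinearGroup.map (Int.castRingHom (ZMod p))).comp ρ) D
    rw [h0, map_zero, map_mul, map_prod, ← map_offScalar, hword] at h2
    have h3 : ∀ i, ev S' (X' i).det = 1 := by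
      intro i
      rw [RingHom.map_det, hX]
      exact (S' _).det_coe
    rw [Finset.prod_congr rfl fun i _ => h3 i, Finset.prod_const_one, one_mul, h1] at h2
    have h4 : offScalar k ((Int.castRingHom (ZMod p)).mapMatrix
        (ρ (φ^[Fintype.card σ] g) : Matrix (Fin 2) (Fin 2) ℤ)) = 0 := h2.symm
    rw [map_offScalar, eq_intCast, ZMod.intCast_zmod_eq_zero_iff_dvd] at h4
    have := Int.natAbs_dvd_natAbs.2 h4
    rw [Int.natAbs_natCast] at this
    have := Nat.le_of_dvd (Int.natAbs_pos.2 hk) this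
    omega
  obtain ⟨K, _, _, _, e, q, he, heD⟩ := exists_frobenius_point p F D hD
  let M : Fin n → Matrix (Fin 2) (Fin 2) K := fun i => e.mapMatrix (X' i)
  rw [map_mul, map_prod, mul_ne_zero_iff, Finset.prod_ne_zero_iff, ← map_offScalar,
    map_wordMatrix] at heD
  have hM : ∀ i, IsUnit (M i) := by
    intro i
    rw [Matrix.isUnit_iff_isUnit_det, isUnit_iff_ne_zero]
    have := heD.1 i (Finset.mem_univ i)
    rwa [RingHom.map_det] at this
  choose U hU using hM
  have hU' : (fun i => e.mapMatrix (X' i)) = fun i => (U i).val := funext fun i => (hU i).symm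
  rw [hU'] at heD
  let T := (iterateFrobeniusEquiv K p q).mapMatrix (m := Fin 2)
  have hT : ∀ i, T (U i).val = wordMatrix (fun i => (U i).val) (φ (FreeGroup.of i)) := by
    intro i
    rw [← hU', ← map_wordMatrix, hU]
    ext a b
    have := he (i, a, b)
    change iterateFrobeniusEquiv K p q (e (X (i, a, b))) = e (F (i, a, b))
    rw [this, iterateFrobeniusEquiv_def]
  refine ⟨Equiv.Perm (Matrix (Fin 2) (Fin 2) K), inferInstance, inferInstance,
    (unitConj K).comp (FreeGroup.lift U), T.toEquiv, ?_, ?_⟩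
  · have : (MulAut.conj (T.toEquiv : Equiv.Perm (Matrix (Fin 2) (Fin 2) K))).toMonoidHom.comp
        ((unitConj K).comp (FreeGroup.lift U)) = ((unitConj K).comp (FreeGroup.lift U)).comp φ := by
      ext1 i
      obtain ⟨c, -, hc⟩ := wordMatrix_units U (φ (FreeGroup.of i))
      rw [← hT] at hc
      have h1 := unitConj_eq_of_smul (U := FreeGroup.lift U (φ (FreeGroup.of i)))
        (V := Units.map T.toRingHom.toMonoidHom (U i)) hc
      simp only [MonoidHom.comp_apply, FreeGroup.lift_apply_of]
      rw [← h1]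
      ext1 A
      change T (unitConj K (U i) (T.symm A)) = _
      rw [unitConj_apply, unitConj_apply, map_mul, map_mul, T.apply_symm_apply]
      rfl
    exact fun x => DFunLike.congr_fun this x
  · intro h1
    obtain ⟨c, -, hc⟩ := wordMatrix_units U g
    apply heD.2
    apply offScalar_eq_zero_of_commute
    intro B
    have h2 : unitConj K (FreeGroup.lift U g) B = B := by
      have := DFunLike.congr_fun h1 B
      exact this
    rw [unitConj_apply, Units.mul_inv_eq_iff_eq_mul] at h2
    rw [hc, smul_mul_assoc, h2, mul_smul_comm]

end borisovSapir

/-- The group `⟨t, b | r(t ^ i * b * t ^ (-i))⟩`. -/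
abbrev ConjGroup (r : FreeGroup ℤ) : Type :=
  PresentedGroup ({conjEval (FreeGroup.of false) (FreeGroup.of true) r} : Set (FreeGroup Bool))

namespace ConjGroup

variable {r : FreeGroup ℤ} {G : Type*} [Group G]

/-- The stable letter. -/
def t (r : FreeGroup ℤ) : ConjGroup r := PresentedGroup.of false

/-- The base letter. -/
def b (r : FreeGroup ℤ) : ConjGroup r := PresentedGroup.of true

theorem conjEval_eq_one (r : FreeGroup ℤ) : conjEval (t r) (b r) r = 1 := by
  have h := map_conjEval
    (PresentedGroup.mk ({conjEval (FreeGroup.of false) (FreeGroup.of true) r} : Set (FreeGroup Bool)))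
    (FreeGroup.of false) (FreeGroup.of true) r
  exact h.symm.trans (PresentedGroup.one_of_mem rfl)

theorem exists_hom {T B : G} (h : conjEval T B r = 1) :
    ∃ f : ConjGroup r →* G, f (t r) = T ∧ f (b r) = B := by
  refine ⟨PresentedGroup.toGroup (f := fun i => if i then B else T) ?_, ?_, ?_⟩
  · intro z hz
    rw [Set.mem_singleton_iff.1 hz, map_conjEval]
    simpa using h
  · exact PresentedGroup.toGroup.of _
  · exact PresentedGroup.toGroup.of _

theorem induction_right {p : ConjGroup r → Prop} (one : p 1) (t_mul : ∀ g, p g → p (g * t r))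
    (t_inv_mul : ∀ g, p g → p (g * (t r)⁻¹)) (b_mul : ∀ g, p g → p (g * b r))
    (b_inv_mul : ∀ g, p g → p (g * (b r)⁻¹)) (g : ConjGroup r) : p g := by
  have hg : g ∈ Subgroup.closure (Set.range
      (PresentedGroup.of (rels := ({conjEval (FreeGroup.of false) (FreeGroup.of true) r} :
        Set (FreeGroup Bool))))) := by
    rw [PresentedGroup.closure_range_of]; trivial
  induction hg using Subgroup.closure_induction_right with
  | one => exact one
  | mul_right x hx y hy ih =>
    obtain ⟨_ | _, rfl⟩ := hy
    · exact t_mul _ ih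
    · exact b_mul _ ih
  | mul_inv_cancel x hx y hy ih =>
    obtain ⟨_ | _, rfl⟩ := hy
    · exact t_inv_mul _ ih
    · exact b_inv_mul _ ih

theorem conjEval_eq_one_of_mem {T B : G} (h : conjEval T B r = 1) {g : FreeGroup ℤ}
    (hg : g ∈ Subgroup.normalClosure {r}) : conjEval T B g = 1 := by
  have : Subgroup.normalClosure {r} ≤ (conjEval T B).ker :=
    Subgroup.normalClosure_le_normal (by simpa using h)
  exact this hg

end ConjGroup

section ascending

variable {n : ℕ} {r u : FreeGroup ℤ}

/-- The substitution `b_i ↦ x_i` for `0 ≤ i < n`, with value `v` at the letter `n`. -/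
def truncate (n : ℕ) (v : FreeGroup (Fin n)) : FreeGroup ℤ →* FreeGroup (Fin n) :=
  FreeGroup.lift fun i =>
    if h : 0 ≤ i ∧ i < n then FreeGroup.of ⟨i.toNat, by omega⟩ else if i = n then v else 1

theorem truncate_of_lt (v : FreeGroup (Fin n)) (i : Fin n) :
    truncate n v (FreeGroup.of ((i : ℕ) : ℤ)) = FreeGroup.of i := by
  simp [truncate]

theorem truncate_of_self (v : FreeGroup (Fin n)) : truncate n v (FreeGroup.of (n : ℤ)) = v := by
  simp [truncate]

/-- The inclusion of the free group on `n` letters in the free group on `ℤ`. -/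
def extendLetters (n : ℕ) : FreeGroup (Fin n) →* FreeGroup ℤ :=
  FreeGroup.map fun i => ((i : ℕ) : ℤ)

theorem extendLetters_injective (n : ℕ) : Function.Injective (extendLetters n) :=
  FreeGroup.map_injective fun a b h => by simpa [Fin.ext_iff] using h

theorem truncate_extendLetters (v w : FreeGroup (Fin n)) :
    truncate n v (extendLetters n w) = w := by
  have : (truncate n v).comp (extendLetters n) = MonoidHom.id _ := by
    ext1 i
    simp only [MonoidHom.comp_apply, extendLetters, FreeGroup.map.of, truncate_of_lt]
    rfl
  exact DFunLike.congr_fun this w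

theorem extendLetters_truncate (v : FreeGroup (Fin n)) {g : FreeGroup ℤ}
    (hg : g ∈ letterSubgroup (Set.Ico (0 : ℤ) n)) : extendLetters n (truncate n v g) = g := by
  refine eqOn_letterSubgroup (f := (extendLetters n).comp (truncate n v)) (f' := MonoidHom.id _)
    (fun i hi => ?_) hg
  obtain ⟨i, rfl⟩ := Int.eq_ofNat_of_zero_le hi.1
  have := truncate_of_lt v ⟨i, by exact_mod_cast hi.2⟩
  simp only [MonoidHom.comp_apply]
  rw [this]
  simp [extendLetters]

theorem extendLetters_mem (w : FreeGroup (Fin n)) :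
    extendLetters n w ∈ letterSubgroup (Set.Ico (0 : ℤ) n) := by
  have : w ∈ letterSubgroup (Set.univ : Set (Fin n)) := by rw [letterSubgroup_univ]; trivial
  refine map_letterSubgroup_le_iff.2 (fun i _ => ?_) w this
  simp only [extendLetters, FreeGroup.map.of]
  exact of_mem_letterSubgroup ⟨by omega, by omega⟩

/-- If the top letter of the relator is redundant, the group is an ascending HNN extension of a
free group, hence residually finite. -/
theorem residuallyFinite_of_ascending (hr : r ∈ letterSubgroup (Set.Icc (0 : ℤ) n))
    (hn : ¬ ConjInto r {(n : ℤ)}ᶜ) (hu : u ∈ letterSubgroup (Set.Ico (0 : ℤ) n))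
    (hur : FreeGroup.of (n : ℤ) * u⁻¹ ∈ Subgroup.normalClosure {r}) :
    ResiduallyFinite (ConjGroup r) := by
  let v := truncate n 1 u
  let θ := truncate n v
  let φ : FreeGroup (Fin n) →* FreeGroup (Fin n) :=
    FreeGroup.lift fun i => θ (FreeGroup.of ((i : ℕ) + 1 : ℤ))
  have hv : extendLetters n v = u := extendLetters_truncate 1 hu
  have hφ : ∀ i : ℕ, i < n → φ (θ (FreeGroup.of (i : ℤ))) = θ (FreeGroup.of (i + 1 : ℤ)) := by
    intro i hi
    have := truncate_of_lt v ⟨i, hi⟩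
    change φ (truncate n v (FreeGroup.of (i : ℤ))) = _
    rw [show truncate n v (FreeGroup.of (i : ℤ)) = FreeGroup.of ⟨i, hi⟩ from this]
    simp [φ]
  have hφi : ∀ i : ℕ, i ≤ n → φ^[i] (θ (FreeGroup.of 0)) = θ (FreeGroup.of (i : ℤ)) := by
    intro i
    induction i with
    | zero => intro _; rfl
    | succ i ih =>
      intro hi
      rw [Function.iterate_succ_apply', ih (by omega), hφ i (by omega)]
      push_cast; rfl
  have hθr : θ r = 1 := by
    have h1 : extendLetters n (θ r) ∈ Subgroup.normalClosure {r} := by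
      have h2 : ∀ z ∈ letterSubgroup (Set.Icc (0 : ℤ) n),
          QuotientGroup.mk' (Subgroup.normalClosure {r}) (extendLetters n (θ z)) =
          QuotientGroup.mk' (Subgroup.normalClosure {r}) z := by
        intro z hz
        refine eqOn_letterSubgroup (f := (QuotientGroup.mk' (Subgroup.normalClosure {r})).comp
          ((extendLetters n).comp θ)) (f' := QuotientGroup.mk' (Subgroup.normalClosure {r}))
          (fun i hi => ?_) hz
        rcases lt_or_eq_of_le hi.2 with h | h
        · have := extendLetters_truncate v (of_mem_letterSubgroup ⟨hi.1, h⟩)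
          simp only [MonoidHom.comp_apply]
          exact congrArg _ this
        · have h3 : θ (FreeGroup.of i) = v := by rw [h]; exact truncate_of_self v
          simp only [MonoidHom.comp_apply]
          rw [h3, hv, h, QuotientGroup.mk'_eq_mk']
          refine ⟨u⁻¹ * FreeGroup.of (n : ℤ), ?_, by group⟩
          have := Subgroup.normalClosure_normal.conj_mem _ hur u⁻¹
          simpa [mul_assoc] using this
      have h3 := h2 r hr
      exact (QuotientGroup.eq_one_iff _).1 (h3.trans
        ((QuotientGroup.eq_one_iff r).2 (Subgroup.subset_normalClosure rfl)))
    have h4 : extendLetters n (θ r) ∈ letterSubgroup {(n : ℤ)}ᶜ :=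
      letterSubgroup_mono (fun i hi => ne_of_lt hi.2) (extendLetters_mem _)
    have := freiheitssatz hn h4 h1
    exact extendLetters_injective n (by rw [this, map_one])
  -- evaluation in a group where the relation holds
  let t := ConjGroup.t r
  let b := ConjGroup.b r
  let j : FreeGroup (Fin n) →* ConjGroup r := (conjEval t b).comp (extendLetters n)
  have hj : ∀ i : ℕ, i ≤ n → j (θ (FreeGroup.of (i : ℤ))) = t ^ i * b * (t ^ i)⁻¹ := by
    intro i hi
    rcases lt_or_eq_of_le hi with h | h
    · have := extendLetters_truncate v (of_mem_letterSubgroup (x := (i : ℤ))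
        (S := Set.Ico (0 : ℤ) n) ⟨by omega, by omega⟩)
      change conjEval t b (extendLetters n (truncate n v _)) = _
      rw [this, conjEval_of]; simp
    · have h3 : θ (FreeGroup.of (i : ℤ)) = v := by rw [h]; exact truncate_of_self v
      change conjEval t b (extendLetters n (θ _)) = _
      rw [h3, hv]
      have := ConjGroup.conjEval_eq_one_of_mem (ConjGroup.conjEval_eq_one r) hur
      rw [map_mul, map_inv, mul_inv_eq_one, conjEval_of] at this
      change t ^ (n : ℤ) * b * (t ^ (n : ℤ))⁻¹ = conjEval t b u at this
      rw [← this, h]; simp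
  have htj : ∀ w, t * j w * t⁻¹ = j (φ w) := by
    have : (MulAut.conj t).toMonoidHom.comp j = j.comp φ := by
      ext1 i
      have h1 := hj i i.2.le
      have h2 := hj (i + 1) i.2
      rw [show θ (FreeGroup.of ((i : ℕ) : ℤ)) = FreeGroup.of i from truncate_of_lt v i] at h1
      have h3 : φ (FreeGroup.of i) = θ (FreeGroup.of ((i : ℕ) + 1 : ℤ)) := by simp [φ]
      simp only [MonoidHom.comp_apply, h3]
      rw [h1]
      push_cast at h2
      rw [h2]
      change t * _ * t⁻¹ = _
      rw [pow_succ']; group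
    exact fun w => DFunLike.congr_fun this w
  have htjm : ∀ (m : ℕ) w, t ^ m * j w * (t ^ m)⁻¹ = j (φ^[m] w) := by
    intro m
    induction m with
    | zero => simp
    | succ m ih =>
      intro w
      rw [Function.iterate_succ_apply', ← htj, ← ih, pow_succ']; group
  have hb : b = j (θ (FreeGroup.of 0)) := by
    have := hj 0 (Nat.zero_le n)
    simpa using this.symm
  have hmove : ∀ (i k : ℕ) w z, (t ^ i)⁻¹ * j w * t ^ k * j z =
      (t ^ i)⁻¹ * j (w * φ^[k] z) * t ^ k := by
    intro i k w z
    rw [map_mul, ← htjm]; group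
  have hform : ∀ g : ConjGroup r, ∃ (i k : ℕ) (w : FreeGroup (Fin n)),
      g = (t ^ i)⁻¹ * j w * t ^ k := by
    intro g
    induction g using ConjGroup.induction_right with
    | one => exact ⟨0, 0, 1, by simp⟩
    | t_mul g ih =>
      obtain ⟨i, k, w, rfl⟩ := ih
      exact ⟨i, k + 1, w, by rw [pow_succ, ← mul_assoc]⟩
    | t_inv_mul g ih =>
      obtain ⟨i, k, w, rfl⟩ := ih
      rcases k with _ | k
      · refine ⟨i + 1, 0, φ w, ?_⟩
        rw [← htj, pow_succ']
        change _ * t⁻¹ = _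
        group
      · refine ⟨i, k, w, ?_⟩
        rw [pow_succ]
        change _ * t⁻¹ = _
        group
    | b_mul g ih =>
      obtain ⟨i, k, w, rfl⟩ := ih
      change ∃ i' k' w', _ * b = _
      rw [hb, hmove]
      exact ⟨_, _, _, rfl⟩
    | b_inv_mul g ih =>
      obtain ⟨i, k, w, rfl⟩ := ih
      change ∃ i' k' w', _ * b⁻¹ = _
      rw [hb, ← map_inv, hmove]
      exact ⟨_, _, _, rfl⟩
  intro g hg
  obtain ⟨i, k, w, rfl⟩ := hform g
  by_cases hik : i = k
  · subst hik
    have hw : ∀ m : ℕ, φ^[m] w ≠ 1 := by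
      intro m hm
      apply hg
      have := htjm m w
      rw [hm, map_one, mul_inv_eq_one, mul_eq_left] at this
      rw [this]; group
    obtain ⟨Q, _, _, f, τ, hτ, hfw⟩ := exists_finite_quotient_endomorphism φ hw
    have hτm : ∀ (m : ℕ) x, τ ^ m * f x * (τ ^ m)⁻¹ = f (φ^[m] x) := by
      intro m
      induction m with
      | zero => simp
      | succ m ih =>
        intro w
        rw [Function.iterate_succ_apply', ← hτ, ← ih, pow_succ']; group
    have heval : ∀ z ∈ letterSubgroup (Set.Icc (0 : ℤ) n),
        conjEval τ (f (θ (FreeGroup.of 0))) z = f (θ z) := by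
      intro z hz
      refine eqOn_letterSubgroup (f := conjEval τ (f (θ (FreeGroup.of 0)))) (f' := f.comp θ)
        (fun i hi => ?_) hz
      obtain ⟨i, rfl⟩ := Int.eq_ofNat_of_zero_le hi.1
      rw [conjEval_of, zpow_natCast, hτm, hφi i (by exact_mod_cast hi.2)]
      rfl
    obtain ⟨F, hFt, hFb⟩ := ConjGroup.exists_hom (r := r) (T := τ) (B := f (θ (FreeGroup.of 0)))
      (by rw [heval r hr, hθr, map_one])
    refine ⟨Q, inferInstance, inferInstance, F, ?_⟩
    have h1 : F (j w) = f w := by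
      change F (conjEval t b (extendLetters n w)) = _
      rw [map_conjEval, hFt, hFb, heval _ (letterSubgroup_mono Set.Ico_subset_Icc_self
        (extendLetters_mem w))]
      exact congrArg f (truncate_extendLetters v w)
    intro h2
    rw [map_mul, map_mul, h1, map_inv, mul_assoc, inv_mul_eq_one, eq_comm, mul_eq_right] at h2
    exact hfw h2
  · let m : ℕ := ((k : ℤ) - i).natAbs + 1
    have hm : NeZero m := ⟨by omega⟩
    obtain ⟨F, hFt, hFb⟩ := ConjGroup.exists_hom (r := r) (T := Multiplicative.ofAdd (1 : ZMod m))
      (B := 1) (by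
        have : conjEval (Multiplicative.ofAdd (1 : ZMod m)) 1 = 1 := by ext i; simp [conjEval_of]
        rw [this]; rfl)
    refine ⟨Multiplicative (ZMod m), inferInstance,
      inferInstanceAs (Finite (ZMod m)), F, fun h => ?_⟩
    have h1 : F (j w) = 1 := by
      change F (conjEval t b (extendLetters n w)) = _
      rw [map_conjEval, hFb]
      have : conjEval (F t) 1 = 1 := by ext i; simp [conjEval_of]
      rw [this]; rfl
    rw [map_mul, map_mul, h1, map_inv, map_pow, map_pow, hFt, mul_one, inv_mul_eq_one,
      ← ofAdd_nsmul, ← ofAdd_nsmul] at h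
    have h2 : ((i : ℕ) : ZMod m) = k := by simpa using h
    have h3 : (((k : ℤ) - i : ℤ) : ZMod m) = 0 := by push_cast; rw [h2, sub_self]
    rw [ZMod.intCast_zmod_eq_zero_iff_dvd] at h3
    have h4 := Int.natAbs_dvd_natAbs.2 h3
    rw [Int.natAbs_natCast] at h4
    have := Nat.le_of_dvd (by omega) h4
    omega

end ascending

theorem SQUniversal.of_mulEquiv {G G' : Type*} [Group G] [Group G'] (e : G ≃* G')
    (h : SQUniversal G) : SQUniversal G' := by
  intro C _ _
  obtain ⟨N, hN, f, hf⟩ := h C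
  have hN' : (N.map (e : G →* G')).Normal := hN.map _ e.surjective
  exact ⟨N.map (e : G →* G'), hN', (QuotientGroup.congr N _ e rfl).toMonoidHom.comp f,
    (QuotientGroup.congr N _ e rfl).injective.comp hf⟩

theorem ResiduallyFinite.of_mulEquiv {G G' : Type*} [Group G] [Group G'] (e : G ≃* G')
    (h : ResiduallyFinite G) : ResiduallyFinite G' := by
  intro g hg
  obtain ⟨Q, _, _, f, hf⟩ := h (e.symm g) (by simpa using hg)
  exact ⟨Q, inferInstance, inferInstance, f.comp e.symm.toMonoidHom, hf⟩

theorem normalClosure_eq_of_isConj {G : Type*} [Group G] {a b : G} (h : IsConj a b) :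
    Subgroup.normalClosure {a} = Subgroup.normalClosure {b} := by
  have key : ∀ {a b : G}, IsConj a b → Subgroup.normalClosure {a} ≤ Subgroup.normalClosure {b} := by
    intro a b h
    obtain ⟨c, hc⟩ := isConj_iff.1 h.symm
    refine Subgroup.normalClosure_le_normal (Set.singleton_subset_iff.2 ?_)
    rw [← hc]
    exact Subgroup.Normal.conj_mem Subgroup.normalClosure_normal b
      (Subgroup.subset_normalClosure (Set.mem_singleton b)) c
  exact le_antisymm (key h) (key h.symm)

theorem nonempty_presentedGroup_equiv {α β : Type*} (e : FreeGroup α ≃* FreeGroup β)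
    {w : FreeGroup α} {w' : FreeGroup β} (h : IsConj (e w) w') :
    Nonempty (PresentedGroup {w} ≃* PresentedGroup {w'}) := by
  refine ⟨QuotientGroup.congr _ _ e ?_⟩
  rw [← normalClosure_eq_of_isConj h, Subgroup.map_normalClosure _ _ e.surjective]
  simp

theorem conjEval_map_add {G : Type*} [Group G] (t b : G) (k : ℤ) (r : FreeGroup ℤ) :
    conjEval t b (FreeGroup.map (· + k) r) = t ^ k * conjEval t b r * (t ^ k)⁻¹ := by
  have : (conjEval t b).comp (FreeGroup.map (· + k)) =
      (MulAut.conj (t ^ k)).toMonoidHom.comp (conjEval t b) := by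
    ext i
    simp only [MonoidHom.comp_apply, FreeGroup.map.of, conjEval_of, MulEquiv.toMonoidHom_eq_coe,
      MonoidHom.coe_coe, MulAut.conj_apply]
    rw [add_comm, zpow_add]; group
  exact DFunLike.congr_fun this r

theorem conjEval_map_neg {G : Type*} [Group G] (t b : G) (r : FreeGroup ℤ) :
    conjEval t b (FreeGroup.map Neg.neg r) = conjEval t⁻¹ b r := by
  have : (conjEval t b).comp (FreeGroup.map Neg.neg) = conjEval t⁻¹ b := by
    ext i
    simp [conjEval_of]
  exact DFunLike.congr_fun this r

namespace ConjGroup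

theorem nonempty_equiv_of_isConj {r r' : FreeGroup ℤ} (h : IsConj r r') :
    Nonempty (ConjGroup r ≃* ConjGroup r') :=
  nonempty_presentedGroup_equiv (MulEquiv.refl _) (MonoidHom.map_isConj (conjEval _ _) h)

theorem nonempty_equiv_map_add (r : FreeGroup ℤ) (k : ℤ) :
    Nonempty (ConjGroup r ≃* ConjGroup (FreeGroup.map (· + k) r)) := by
  refine nonempty_presentedGroup_equiv (MulEquiv.refl _) ?_
  rw [conjEval_map_add]
  exact isConj_iff.2 ⟨_, rfl⟩

theorem nonempty_equiv_map_neg (r : FreeGroup ℤ) :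
    Nonempty (ConjGroup r ≃* ConjGroup (FreeGroup.map Neg.neg r)) := by
  let f : FreeGroup Bool →* FreeGroup Bool := FreeGroup.lift fun i =>
    if i then FreeGroup.of true else (FreeGroup.of false)⁻¹
  have hf : f.comp f = MonoidHom.id _ := by
    ext (_ | _) <;> simp [f]
  let e : FreeGroup Bool ≃* FreeGroup Bool := MonoidHom.toMulEquiv f f hf hf
  refine nonempty_presentedGroup_equiv e ?_
  have : e (conjEval (FreeGroup.of false) (FreeGroup.of true) r) =
      conjEval (FreeGroup.of false) (FreeGroup.of true) (FreeGroup.map Neg.neg r) := by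
    change f _ = _
    rw [map_conjEval, conjEval_map_neg]
    simp [f]
  rw [this]

end ConjGroup

/-- Every two-generator one-relator group has a presentation in which the stable letter has
exponent sum zero in the relator. -/
theorem exists_conjGroup (w : FreeGroup Bool) :
    ∃ r : FreeGroup ℤ, Nonempty (ConjGroup r ≃* PresentedGroup ({w} : Set (FreeGroup Bool))) := by
  obtain ⟨e, he, -⟩ := exists_equiv_expSum_eq_one (X := Bool) (u := false) (v := true) (by decide) w
  let d : Bool → ℤ := fun z => if z = false then 1 else 0
  let E : Bool → FreeGroup Bool := FreeGroup.of
  have h1 := stableEval_eq false d (FreeGroup.of false) E (e w)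
  have h2 : stableEval false d (FreeGroup.of false) E = MonoidHom.id (FreeGroup Bool) := by
    ext1 i
    cases i
    · simp [stableEval_of_self, d]
    · rw [stableEval_of_ne _ _ _ _ (by decide)]; simp [d, E]
  have h3 : (rewriteHom false d (e w)).right = 1 := by
    rw [rewriteHom_right_apply, ← he]
    have : FreeGroup.lift (fun x => Multiplicative.ofAdd (d x)) = expSum (X := Bool) false := by
      ext1 i
      cases i
      · simp [d, expSum_of_self]
      · rw [expSum_of_ne (by decide)]; simp [d]
    rw [this]
  rw [h2, h3] at h1
  have h4 : ∀ z ∈ letterSubgroup {p : Bool × ℤ | p.1 ≠ false},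
      indexedEval (FreeGroup.of false) E z =
        conjEval (FreeGroup.of false) (FreeGroup.of true) (FreeGroup.map Prod.snd z) := by
    intro z hz
    refine eqOn_letterSubgroup (f' := (conjEval (FreeGroup.of false) (FreeGroup.of true)).comp
      (FreeGroup.map Prod.snd)) (fun p hp => ?_) hz
    obtain ⟨_ | _, i⟩ := p
    · exact absurd rfl hp
    · simp [indexedEval_of, conjEval_of, E]
  rw [h4 _ (rewriteHom_left_mem_univ false d (e w))] at h1
  simp only [MonoidHom.id_apply, toAdd_one, zpow_zero, mul_one] at h1
  obtain ⟨f⟩ := nonempty_presentedGroup_equiv e (w := w) (IsConj.refl _)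
  refine ⟨FreeGroup.map Prod.snd (rewriteHom false d (e w)).left, ⟨?_⟩⟩
  rw [h1] at f
  exact f.symm

open scoped commutatorElement

section labels

variable {Ω G : Type}

/-- A permutation of `Ω` acts on `Ω × G` through the first coordinate. -/
def per (Ω G : Type) : Equiv.Perm Ω →* Equiv.Perm (Ω × G) where
  toFun π := π.prodCongr (Equiv.refl G)
  map_one' := rfl
  map_mul' _ _ := rfl

theorem per_apply (π : Equiv.Perm Ω) (p : Ω × G) : per Ω G π p = (π p.1, p.2) := rfl

variable [Group G]

/-- A labelling of `Ω` by `G` acts on `Ω × G` by fibrewise left multiplication. -/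
def lab (Ω G : Type) [Group G] : (Ω → G) →* Equiv.Perm (Ω × G) where
  toFun F :=
    { toFun := fun p => (p.1, F p.1 * p.2)
      invFun := fun p => (p.1, (F p.1)⁻¹ * p.2)
      left_inv := fun p => by simp
      right_inv := fun p => by simp }
  map_one' := by ext p <;> simp
  map_mul' F F' := by ext p <;> simp [mul_assoc]

theorem lab_apply (F : Ω → G) (p : Ω × G) : lab Ω G F p = (p.1, F p.1 * p.2) := rfl

theorem lab_injective : Function.Injective (lab Ω G) := by
  intro F F' h
  funext ω
  have := congrArg Prod.snd (DFunLike.congr_fun h (ω, 1))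
  simpa [lab_apply] using this

theorem per_conj_lab (π : Equiv.Perm Ω) (F : Ω → G) :
    per Ω G π * lab Ω G F * (per Ω G π)⁻¹ = lab Ω G (F ∘ π.symm) := by
  rw [mul_inv_eq_iff_eq_mul]
  ext p <;> simp [per_apply, lab_apply]

end labels

section embedding

/-- The label `c` at `0` on the integers, inside the permutations of `ℤ × C`. -/
noncomputable def pointLabel (C : Type) [Group C] : C →* Equiv.Perm (ℤ × C) :=
  (lab ℤ C).comp (MonoidHom.mulSingle (fun _ : ℤ => C) 0)

theorem pointLabel_injective (C : Type) [Group C] : Function.Injective (pointLabel C) :=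
  lab_injective.comp (Pi.mulSingle_injective (M := fun _ : ℤ => C) 0)

/-- The translation of `ℤ × C`. -/
def translation (C : Type) : Equiv.Perm (ℤ × C) := per ℤ C (Equiv.addRight 1)

theorem translation_zpow (C : Type) (k : ℤ) :
    translation C ^ k = per ℤ C (Equiv.addRight k) := by
  rw [translation, ← map_zpow]
  congr 1
  simp

/-- Every point label is a commutator with the translation. -/
theorem pointLabel_eq_commutator {C : Type} [Group C] (c : C) :
    pointLabel C c = ⁅lab ℤ C (fun n => if 0 ≤ n then c else 1), translation C⁆ := by
  rw [commutatorElement_def, mul_assoc, mul_assoc, ← mul_assoc (translation C), ← map_inv,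
    translation, per_conj_lab, ← map_mul, pointLabel, MonoidHom.comp_apply]
  congr 1
  funext n
  simp only [MonoidHom.mulSingle_apply, Pi.mul_apply, Function.comp_apply, Pi.inv_apply,
    Equiv.addRight_symm, Equiv.coe_addRight]
  by_cases h0 : n = 0
  · subst h0; simp
  · rw [Pi.mulSingle_eq_of_ne h0]
    by_cases h : 0 ≤ n
    · rw [if_pos h, if_pos (by omega)]; simp
    · rw [if_neg h, if_neg (by omega)]; simp

/-- Every countable group embeds in a two-generator group, inside the normal closure of the
commutator of the generators; moreover the first generator and the product of the generators may be
taken of infinite order. -/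
theorem exists_two_generator_embedding (C : Type) [Group C] [Countable C] :
    ∃ (E : Type) (_ : Group E) (x y : E) (ι : C →* E), Function.Injective ι ∧
      Subgroup.closure {x, y} = ⊤ ∧ (∀ k : ℤ, k ≠ 0 → x ^ k ≠ 1) ∧
      (∀ k : ℤ, k ≠ 0 → (x * y) ^ k ≠ 1) ∧ ∀ c, ι c ∈ Subgroup.normalClosure {⁅x, y⁆} := by
  obtain ⟨γ, hγ⟩ := exists_surjective_nat C
  let B := Equiv.Perm (ℤ × C)
  let f : ℤ → B := fun n => if n = 0 then translation C else
    if 0 ≤ n ∧ n % 2 = 1 then lab ℤ C (fun m => if 0 ≤ m then γ (n / 2).toNat else 1) else 1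
  let X := translation B
  let Y := lab ℤ B f
  let ι₀ : C →* Equiv.Perm (ℤ × B) := (pointLabel B).comp (pointLabel C)
  have hι₀ : Function.Injective ι₀ := (pointLabel_injective B).comp (pointLabel_injective C)
  have hcomm : ∀ k : ℕ, ι₀ (γ k) = ⁅X ^ (-(2 * k + 1 : ℤ)) * Y * (X ^ (-(2 * k + 1 : ℤ)))⁻¹, Y⁆ := by
    intro k
    rw [translation_zpow, per_conj_lab, commutatorElement_def, ← map_inv, ← map_inv, ← map_mul,
      ← map_mul, ← map_mul]
    change lab ℤ B (Pi.mulSingle 0 (pointLabel C (γ k))) = _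
    congr 1
    funext n
    simp only [Pi.mul_apply, Function.comp_apply, Pi.inv_apply, Equiv.addRight_symm,
      Equiv.coe_addRight, neg_neg]
    by_cases h0 : n = 0
    · subst h0
      have h1 : f (2 * k + 1) = lab ℤ C (fun m => if 0 ≤ m then γ k else 1) := by
        have e1 : ((2 * k + 1 : ℤ) / 2).toNat = k := by omega
        simp only [f]
        rw [if_neg (by omega), if_pos (by omega), e1]
      have h2 : f 0 = translation C := rfl
      rw [zero_add, h1, h2, Pi.mulSingle_eq_same, pointLabel_eq_commutator, commutatorElement_def]
    · rw [Pi.mulSingle_eq_of_ne h0]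
      rcases Int.emod_two_eq_zero_or_one n with h | h
      · have h1 : f n = 1 := by simp only [f]; rw [if_neg h0, if_neg (by omega)]
        rw [h1]; simp
      · by_cases h3 : n + (2 * k + 1) = 0
        · have h1 : f n = 1 := by simp only [f]; rw [if_neg h0, if_neg (by omega)]
          rw [h1]; simp
        · have h1 : f (n + (2 * k + 1)) = 1 := by
            simp only [f]; rw [if_neg h3, if_neg (by omega)]
          rw [h1]; simp
  let E := Subgroup.closure ({X, Y} : Set (Equiv.Perm (ℤ × B)))
  have hX : X ∈ E := Subgroup.subset_closure (by simp)
  have hY : Y ∈ E := Subgroup.subset_closure (by simp)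
  have hι : ∀ c, ι₀ c ∈ E := by
    intro c
    obtain ⟨k, rfl⟩ := hγ c
    rw [hcomm, commutatorElement_def]
    have h1 : X ^ (-(2 * k + 1 : ℤ)) ∈ E := zpow_mem hX _
    have h2 := mul_mem (mul_mem h1 hY) (inv_mem h1)
    exact mul_mem (mul_mem (mul_mem h2 hY) (inv_mem h2)) (inv_mem hY)
  have hfst : ∀ (k : ℕ) p, (((X * Y) ^ k) p).1 = p.1 + k := by
    intro k
    induction k with
    | zero => intro p; simp
    | succ k ih =>
      intro p
      rw [pow_succ, Equiv.Perm.mul_apply, ih]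
      change p.1 + 1 + (k : ℤ) = _
      push_cast; ring
  have hpow : ∀ k : ℤ, k ≠ 0 → X ^ k ≠ 1 := by
    intro k hk h
    have := congrArg Prod.fst (DFunLike.congr_fun h ((0 : ℤ), (1 : B)))
    rw [translation_zpow, per_apply] at this
    simp at this
    exact hk this
  have hpow' : ∀ k : ℤ, k ≠ 0 → (X * Y) ^ k ≠ 1 := by
    intro k hk h
    have h1 : (X * Y) ^ k.natAbs = 1 := by
      rw [← zpow_natCast]
      rcases Int.natAbs_eq k with e | e
      · rw [← e, h]
      · rw [show (k.natAbs : ℤ) = -k by omega, zpow_neg, h, inv_one]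
    have := hfst k.natAbs ((0 : ℤ), (1 : B))
    rw [h1] at this
    simp at this
    exact hk (abs_eq_zero.1 this.symm)
  refine ⟨E, inferInstance, ⟨X, hX⟩, ⟨Y, hY⟩, ι₀.codRestrict E hι, ?_, ?_, ?_, ?_, ?_⟩
  · intro a b h
    exact hι₀ (congrArg Subtype.val h)
  · have := Subgroup.closure_closure_coe_preimage (k := ({X, Y} : Set (Equiv.Perm (ℤ × B))))
    rw [← this]
    congr 1
    ext z
    simp [Subtype.ext_iff]
  · intro k hk h
    exact hpow k hk (by simpa using congrArg Subtype.val h)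
  · intro k hk h
    exact hpow' k hk (by simpa using congrArg Subtype.val h)
  · intro c
    obtain ⟨k, rfl⟩ := hγ c
    let x : E := ⟨X, hX⟩
    let y : E := ⟨Y, hY⟩
    let N : Subgroup E := Subgroup.normalClosure {⁅x, y⁆}
    have e : ι₀.codRestrict E hι (γ k) =
        ⁅x ^ (-(2 * k + 1 : ℤ)) * y * (x ^ (-(2 * k + 1 : ℤ)))⁻¹, y⁆ := by
      apply Subtype.ext
      exact hcomm k
    have h1 : Commute (QuotientGroup.mk' N x) (QuotientGroup.mk' N y) := by
      rw [← commutatorElement_eq_one_iff_commute, ← map_commutatorElement]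
      exact (QuotientGroup.eq_one_iff _).2 (Subgroup.subset_normalClosure rfl)
    change _ ∈ N
    rw [e]
    refine (QuotientGroup.eq_one_iff _).1 ?_
    change QuotientGroup.mk' N _ = 1
    rw [map_commutatorElement, map_mul, map_mul, map_inv, map_zpow,
      (h1.zpow_left _).eq, mul_inv_cancel_right]
    simp

/-- A countable group contained in the image of a homomorphism embeds in a quotient of its
domain. -/
theorem exists_embedding_quotient {G P C : Type*} [Group G] [Group P] [Group C] (Ψ : G →* P)
    (ι : C →* P) (hι : Function.Injective ι) (h : ∀ c, ι c ∈ Ψ.range) :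
    ∃ (N : Subgroup G) (_ : N.Normal), ∃ f : C →* G ⧸ N, Function.Injective f := by
  let e := QuotientGroup.quotientKerEquivRange Ψ
  refine ⟨Ψ.ker, inferInstance, e.symm.toMonoidHom.comp (ι.codRestrict Ψ.range h), ?_⟩
  exact e.symm.injective.comp fun a b hab => hι (congrArg Subtype.val hab)

end embedding

section constructions

theorem exists_amalgam {K G₁ G₂ : Type} [Group K] [Group G₁] [Group G₂] {f₁ : K →* G₁}
    {f₂ : K →* G₂} (h₁ : Function.Injective f₁) (h₂ : Function.Injective f₂) :
    ∃ (X : Type) (_ : Group X) (i₁ : G₁ →* X) (i₂ : G₂ →* X), Function.Injective i₁ ∧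
      Function.Injective i₂ ∧ ∀ k, i₁ (f₁ k) = i₂ (f₂ k) := by
  let φ : ∀ b, K →* pairFamily G₁ G₂ b := fun b => match b with
    | true => f₁
    | false => f₂
  have hφ : ∀ b, Function.Injective (φ b) := by
    rintro (_ | _)
    · exact h₂
    · exact h₁
  refine ⟨Monoid.PushoutI φ, inferInstance, Monoid.PushoutI.of (φ := φ) true,
    Monoid.PushoutI.of (φ := φ) false, Monoid.PushoutI.of_injective hφ true,
    Monoid.PushoutI.of_injective hφ false, fun k => ?_⟩
  exact (Monoid.PushoutI.of_apply_eq_base φ true k).trans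
    (Monoid.PushoutI.of_apply_eq_base φ false k).symm

theorem exists_stable_letter {A X : Type} [Group A] [Group X] {f g : A →* X}
    (hf : Function.Injective f) (hg : Function.Injective g) :
    ∃ (P : Type) (_ : Group P) (ι : X →* P) (s : P), Function.Injective ι ∧
      ∀ a, s * ι (f a) * s⁻¹ = ι (g a) := by
  let φ : f.range ≃* g.range := (MonoidHom.ofInjective hf).symm.trans (MonoidHom.ofInjective hg)
  refine ⟨HNNExtension X f.range g.range φ, inferInstance, HNNExtension.of, HNNExtension.t,
    HNNExtension.of_injective φ, fun a => ?_⟩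
  have h := HNNExtension.equiv_eq_conj (φ := φ) (MonoidHom.ofInjective hf a)
  have e : φ (MonoidHom.ofInjective hf a) = MonoidHom.ofInjective hg a := by simp [φ]
  rw [e] at h
  exact h.symm

/-- Two groups embed in a third such that the first one and any infinite cyclic subgroup of the
second one generate their free product. -/
theorem exists_free_container (D E : Type) [Group D] [Group E] :
    ∃ (Q : Type) (_ : Group Q) (f : D →* Q) (g : E →* Q), Function.Injective g ∧
      ∀ x : E, (∀ k : ℤ, k ≠ 0 → x ^ k ≠ 1) →
        Function.Injective (Monoid.Coprod.lift f (zpowersHom Q (g x))) := by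
  let φ : (⊥ : Subgroup (D × E)) ≃* (⊥ : Subgroup (D × E)) := MulEquiv.refl _
  obtain ⟨P, N, S⟩ := HNNExtension.halfSpaces ⊥ ⊥ φ
  let ι : D × E →* HNNExtension (D × E) ⊥ ⊥ φ := HNNExtension.of
  have hι : Function.Injective ι := HNNExtension.of_injective φ
  let t : HNNExtension (D × E) ⊥ ⊥ φ := HNNExtension.t
  have hne : ∀ z : D × E, z ≠ 1 → ι z ∉ (⊥ : Subgroup (D × E)).map ι := by
    rintro z hz ⟨z', hz', e⟩
    exact hz (by rw [← hι e]; exact Subgroup.mem_bot.1 hz')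
  refine ⟨_, inferInstance, ι.comp (MonoidHom.inl D E),
    (MulAut.conj t).toMonoidHom.comp (ι.comp (MonoidHom.inr D E)), ?_, fun x hx => ?_⟩
  · refine (MulAut.conj t).injective.comp (hι.comp fun a b h => ?_)
    exact (Prod.ext_iff.1 h).2
  refine coprod_lift_injective_of_ping_pong _ _ inferInstance Pᶜ P ⟨1, S.one_notMem_pos⟩
    ⟨t, S.t_mem⟩ disjoint_compl_left (fun m hm y hy => ?_) (fun n hn y hy => ?_)
  · refine S.mul_notMem_pos ⟨_, rfl⟩ (hne _ fun h => hm (Prod.ext_iff.1 h).1) hy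
  · have e : zpowersHom _ (((MulAut.conj t).toMonoidHom.comp (ι.comp (MonoidHom.inr D E))) x) n =
        t * ι (1, x ^ n.toAdd) * t⁻¹ := by
      rw [zpowersHom_apply, ← map_zpow]
      simp
    rw [e]
    refine S.conj_mul_mem_pos ⟨_, rfl⟩ (hne _ fun h => ?_) hy
    exact hx n.toAdd (by simpa using hn) (Prod.ext_iff.1 h).2

end constructions

section embedding

variable {Γ : Type} [Group Γ] {t b : Γ} {r : FreeGroup ℤ} {m : ℤ}

theorem conjEval_map_le_conj :
    (letterSubgroup (Set.Icc 1 m)).map (conjEval t b) ≤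
      ((letterSubgroup (Set.Icc 0 m)).map (conjEval t b)).map (MulAut.conj t).toMonoidHom := by
  rintro _ ⟨g, hg, rfl⟩
  refine map_letterSubgroup_le_iff.2 (fun i hi => ?_) g hg
  refine ⟨_, ⟨FreeGroup.of (i - 1), of_mem_letterSubgroup ⟨by have := hi.1; omega,
    by have := hi.2; omega⟩, rfl⟩, ?_⟩
  simp only [conjEval_of, MulEquiv.toMonoidHom_eq_coe, MonoidHom.coe_coe, MulAut.conj_apply]
  group

/-- If the subgroup generated by the conjugates `b₁, …, bₘ` generates its free product with a cyclic
subgroup of `⟨b₀, …, bₘ⟩`, and also with a cyclic subgroup of `⟨b₁, …, bₘ₊₁⟩`, then `ConjGroup r` is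
SQ-universal. -/
theorem sqUniversal_of_free_cyclic (h : conjEval t b r = 1)
    (hr : r ∈ letterSubgroup (Set.Icc 0 m)) {α β : Γ}
    (hα : α ∈ (letterSubgroup (Set.Icc 0 m)).map (conjEval t b))
    (hβ : β ∈ (letterSubgroup (Set.Icc 0 m)).map (conjEval t b))
    (hα' : Function.Injective (Monoid.Coprod.lift
      ((letterSubgroup (Set.Icc 1 m)).map (conjEval t b)).subtype (zpowersHom Γ α)))
    (hβ' : Function.Injective (Monoid.Coprod.lift
      ((letterSubgroup (Set.Icc 1 m)).map (conjEval t b)).subtype (zpowersHom Γ (t * β * t⁻¹)))) :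
    SQUniversal (ConjGroup r) := by
  intro C _ _
  obtain ⟨E, _, x, y, ι, hι, hE, hx, hxy, -⟩ := exists_two_generator_embedding C
  let D := (letterSubgroup (Set.Icc 1 m)).map (conjEval t b)
  let A := (letterSubgroup (Set.Icc 0 m)).map (conjEval t b)
  let c : Γ →* Γ := (MulAut.conj t).toMonoidHom
  let B := A.map c
  have hDA : D ≤ A := Subgroup.map_mono (letterSubgroup_mono (Set.Icc_subset_Icc_left (by omega)))
  have hDB : D ≤ B := conjEval_map_le_conj
  have hβB : t * β * t⁻¹ ∈ B := ⟨β, hβ, rfl⟩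
  obtain ⟨Q, _, iD, iE, hiE, hQ⟩ := exists_free_container D E
  have fA : Function.Injective (Monoid.Coprod.lift (Subgroup.inclusion hDA)
      (zpowersHom A ⟨α, hα⟩)) := by
    refine Function.Injective.of_comp (f := A.subtype) ?_
    rw [← MonoidHom.coe_comp, Monoid.Coprod.comp_lift]
    convert hα' using 3
    all_goals ext; simp
  have fB : Function.Injective (Monoid.Coprod.lift (Subgroup.inclusion hDB)
      (zpowersHom B ⟨t * β * t⁻¹, hβB⟩)) := by
    refine Function.Injective.of_comp (f := B.subtype) ?_
    rw [← MonoidHom.coe_comp, Monoid.Coprod.comp_lift]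
    convert hβ' using 3
    all_goals ext; simp
  obtain ⟨X₁, _, i₁, i₂, hi₁, hi₂, h12⟩ := exists_amalgam fA (hQ x hx)
  have f₂ : Function.Injective (i₂.comp (Monoid.Coprod.lift iD (zpowersHom Q (iE (x * y))))) :=
    hi₂.comp (hQ (x * y) hxy)
  obtain ⟨X, _, j₁, j₂, hj₁, hj₂, hj⟩ := exists_amalgam f₂ fB
  have fc : Function.Injective (j₂.comp ((c.comp A.subtype).codRestrict B
      fun a => ⟨a, a.2, rfl⟩)) := by
    refine hj₂.comp fun a a' haa => Subtype.ext ?_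
    exact (MulAut.conj t).injective (congrArg Subtype.val haa)
  obtain ⟨P, _, κ, s, hκ, hs⟩ := exists_stable_letter (f := j₁.comp i₁) (hj₁.comp hi₁) fc
  let JA : A →* P := κ.comp (j₁.comp i₁)
  let JB : B →* P := κ.comp j₂
  have hs' : ∀ a (ha : a ∈ A) (ha' : t * a * t⁻¹ ∈ B),
      s * JA ⟨a, ha⟩ * s⁻¹ = JB ⟨t * a * t⁻¹, ha'⟩ := fun a ha _ => hs ⟨a, ha⟩
  have hJD : ∀ a (ha : a ∈ D), JA ⟨a, hDA ha⟩ = JB ⟨a, hDB ha⟩ := by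
    intro a ha
    have e1 := h12 (Monoid.Coprod.inl ⟨a, ha⟩)
    have e2 := hj (Monoid.Coprod.inl ⟨a, ha⟩)
    simp only [Monoid.Coprod.lift_apply_inl, MonoidHom.comp_apply] at e1 e2
    change κ (j₁ (i₁ (Subgroup.inclusion hDA ⟨a, ha⟩))) = κ (j₂ _)
    rw [e1, e2]
    rfl
  have hJα : JA ⟨α, hα⟩ = κ (j₁ (i₂ (iE x))) := by
    have e1 := h12 (Monoid.Coprod.inr (Multiplicative.ofAdd 1))
    simp only [Monoid.Coprod.lift_apply_inr, zpowersHom_apply, toAdd_ofAdd, zpow_one] at e1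
    exact congrArg (fun z => κ (j₁ z)) e1
  have hJβ : JB ⟨t * β * t⁻¹, hβB⟩ = κ (j₁ (i₂ (iE (x * y)))) := by
    have e1 := hj (Monoid.Coprod.inr (Multiplicative.ofAdd 1))
    simp only [Monoid.Coprod.lift_apply_inr, zpowersHom_apply, toAdd_ofAdd, zpow_one,
      MonoidHom.comp_apply] at e1
    exact congrArg κ e1.symm
  by_cases hm : 0 ≤ m
  swap
  · exfalso
    have e : (letterSubgroup (Set.Icc 0 m)) = ⊥ := by
      rw [Set.Icc_eq_empty hm]
      exact (Subgroup.eq_bot_iff_forall _).2 fun _ => letterSubgroup_empty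
    rw [e, Subgroup.map_bot, Subgroup.mem_bot] at hα
    have := @hα' (Monoid.Coprod.inr (Multiplicative.ofAdd 1)) 1 (by
      rw [Monoid.Coprod.lift_apply_inr]; simp [hα])
    have h2 := congrArg Monoid.Coprod.snd this
    simp at h2
  have hb : ∀ i ∈ Set.Icc 0 m, conjEval t b (FreeGroup.of i) ∈ A := fun i hi =>
    ⟨_, of_mem_letterSubgroup hi, rfl⟩
  let b' : P := JA ⟨_, hb 0 ⟨le_rfl, hm⟩⟩
  have hb' : ∀ (i : ℕ) (hi : (i : ℤ) ∈ Set.Icc 0 m),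
      conjEval s b' (FreeGroup.of (i : ℤ)) = JA ⟨_, hb i hi⟩ := by
    intro i
    induction i with
    | zero => intro hi; simp [conjEval_of, b']
    | succ i ih =>
      intro hi
      have hi' : (i : ℤ) ∈ Set.Icc 0 m := ⟨by omega, by have := hi.2; push_cast at this; omega⟩
      have e : ∀ {G : Type} [Group G] (T B : G), conjEval T B (FreeGroup.of ((i + 1 : ℕ) : ℤ)) =
          T * conjEval T B (FreeGroup.of (i : ℤ)) * T⁻¹ := by
        intro G _ T B
        simp only [conjEval_of, Nat.cast_succ]
        group
      have hd : conjEval t b (FreeGroup.of ((i + 1 : ℕ) : ℤ)) ∈ D :=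
        ⟨_, of_mem_letterSubgroup ⟨by omega, hi.2⟩, rfl⟩
      rw [e s b', ih hi', hs' _ _ ⟨_, hb i hi', rfl⟩]
      rw [hJD _ hd]
      congr 2
      exact (e t b).symm
  have hΨ : ∀ g, g ∈ letterSubgroup (Set.Icc 0 m) →
      ∃ ha : conjEval t b g ∈ A, conjEval s b' g = JA ⟨_, ha⟩ := by
    intro g hg
    refine Subgroup.closure_induction (p := fun g _ => ∃ ha : conjEval t b g ∈ A,
      conjEval s b' g = JA ⟨_, ha⟩) ?_ ?_ ?_ ?_ hg
    · rintro _ ⟨i, hi, rfl⟩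
      lift i to ℕ using hi.1
      exact ⟨hb i hi, hb' i hi⟩
    · refine ⟨by rw [map_one]; exact one_mem _, ?_⟩
      rw [map_one]
      exact ((congrArg JA (Subtype.ext (map_one _))).trans (map_one JA)).symm
    · rintro g g' - - ⟨ha, e⟩ ⟨ha', e'⟩
      refine ⟨by rw [map_mul]; exact mul_mem ha ha', ?_⟩
      rw [map_mul, e, e', ← map_mul]
      exact congrArg JA (Subtype.ext (map_mul _ _ _).symm)
    · rintro g - ⟨ha, e⟩
      refine ⟨by rw [map_inv]; exact inv_mem ha, ?_⟩
      rw [map_inv, e, ← map_inv]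
      exact congrArg JA (Subtype.ext (map_inv _ _).symm)
  have hr' : conjEval s b' r = 1 := by
    obtain ⟨ha, e⟩ := hΨ r hr
    rw [e]
    exact (congrArg JA (Subtype.ext h)).trans (map_one JA)
  obtain ⟨Ψ, hΨt, hΨb⟩ := ConjGroup.exists_hom hr'
  have hRA : ∀ a, JA a ∈ Ψ.range := by
    rintro ⟨_, g, hg, rfl⟩
    obtain ⟨ha, e⟩ := hΨ g hg
    exact ⟨conjEval (ConjGroup.t r) (ConjGroup.b r) g, by rw [map_conjEval, hΨt, hΨb, e]⟩
  have hsR : s ∈ Ψ.range := ⟨_, hΨt⟩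
  have hxR : κ (j₁ (i₂ (iE x))) ∈ Ψ.range := hJα ▸ hRA _
  have hxyR : κ (j₁ (i₂ (iE (x * y)))) ∈ Ψ.range := by
    rw [← hJβ, ← hs' β hβ]
    exact mul_mem (mul_mem hsR (hRA _)) (inv_mem hsR)
  let J : E →* P := (κ.comp (j₁.comp i₂)).comp iE
  have hJ : Function.Injective J := (hκ.comp (hj₁.comp hi₂)).comp hiE
  have hER : ∀ z, J z ∈ Ψ.range := by
    have : (⊤ : Subgroup E) ≤ Ψ.range.comap J := by
      rw [← hE, Subgroup.closure_le]
      rintro z (rfl | rfl)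
      · exact hxR
      · have e : J z = (J x)⁻¹ * J (x * z) := by simp
        change J z ∈ Ψ.range
        rw [e]
        exact mul_mem (inv_mem hxR) hxyR
    exact fun z => this trivial
  exact exists_embedding_quotient Ψ (J.comp ι) (hJ.comp hι) fun c => hER (ι c)

end embedding

section window

variable {Γ : Type} [Group Γ] {t b : Γ} {m : ℤ}

theorem conj_mem_conjEval_map {S S' : Set ℤ} (hS : ∀ i ∈ S, i + 1 ∈ S') {g : Γ}
    (hg : g ∈ (letterSubgroup S).map (conjEval t b)) :
    t * g * t⁻¹ ∈ (letterSubgroup S').map (conjEval t b) := by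
  obtain ⟨g, hg, rfl⟩ := hg
  have : ∀ g ∈ letterSubgroup S, conjEval t b g ∈
      ((letterSubgroup S').map (conjEval t b)).comap (MulAut.conj t).toMonoidHom := by
    refine map_letterSubgroup_le_iff.2 fun i hi => ⟨FreeGroup.of (i + 1),
      of_mem_letterSubgroup (hS i hi), ?_⟩
    simp only [conjEval_of, MulEquiv.toMonoidHom_eq_coe, MonoidHom.coe_coe, MulAut.conj_apply]
    group
  exact this g hg

theorem exists_conj_of_mem_conjEval_map {S S' : Set ℤ} (hS : ∀ i ∈ S, i - 1 ∈ S') {g : Γ}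
    (hg : g ∈ (letterSubgroup S).map (conjEval t b)) :
    ∃ h ∈ (letterSubgroup S').map (conjEval t b), g = t * h * t⁻¹ := by
  obtain ⟨g, hg, rfl⟩ := hg
  have : ∀ g ∈ letterSubgroup S, conjEval t b g ∈
      ((letterSubgroup S').map (conjEval t b)).map (MulAut.conj t).toMonoidHom := by
    refine map_letterSubgroup_le_iff.2 fun i hi => ⟨_, ⟨FreeGroup.of (i - 1),
      of_mem_letterSubgroup (hS i hi), rfl⟩, ?_⟩
    simp only [conjEval_of, MulEquiv.toMonoidHom_eq_coe, MonoidHom.coe_coe, MulAut.conj_apply]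
    group
  obtain ⟨h, hh, e⟩ := this g hg
  exact ⟨h, hh, e.symm⟩

end window

namespace HalfSpaces

variable {Γ : Type} [Group Γ] {H A B : Subgroup Γ} {t : Γ} {P N : Set Γ}

theorem coprod_zpowers_injective_conj (S : HalfSpaces H A B t P N) (D : Subgroup Γ) (w x : Γ)
    (hx : ∀ k : ℤ, k ≠ 0 → ∀ z ∈ P, x ^ k * z ∉ P)
    (hD : ∀ δ ∈ D, δ ≠ 1 → ∀ z, z ∉ P → w⁻¹ * δ * w * z ∈ P) :
    Function.Injective (Monoid.Coprod.lift D.subtype (zpowersHom Γ (w * x * w⁻¹))) := by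
  refine coprod_zpowers_injective D _ {g | w⁻¹ * g ∉ P} ⟨w, ?_⟩ ⟨w * t, ?_⟩ ?_ ?_
  · change w⁻¹ * w ∉ P
    rw [inv_mul_cancel]
    exact S.one_notMem_pos
  · change ¬(w⁻¹ * (w * t) ∉ P)
    rw [inv_mul_cancel_left, not_not]
    exact S.t_mem
  · intro δ hδ hδ1 y hy hy'
    refine hy' ?_
    have := hD δ hδ hδ1 _ hy
    simpa [mul_assoc] using this
  · intro k hk y hy
    have hy : w⁻¹ * y ∈ P := not_not.1 hy
    change w⁻¹ * ((w * x * w⁻¹) ^ k * y) ∉ P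
    have := hx k hk _ hy
    rw [conj_zpow]
    simpa [mul_assoc] using this

theorem pow_mul_mem_pos (S : HalfSpaces H A B t P N) {p p' g : Γ} (hp : p ∈ H) (hpA : p ∉ A)
    (hp' : p' ∈ H) (hpA' : p' ∉ A) (hpp : p' * p ∉ A) (hg : g ∈ H) (hgB : g ∉ B) (k : ℕ) {z : Γ}
    (hz : z ∉ P) : (t * p * t⁻¹ * g * (t * p' * t⁻¹)) ^ (k + 1) * z ∈ P := by
  have key : ∃ z', z' ∉ P ∧
      (t * p * t⁻¹ * g * (t * p' * t⁻¹)) ^ (k + 1) * z = t * p * t⁻¹ * z' := by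
    induction k with
    | zero =>
      exact ⟨g * (t * p' * t⁻¹ * z), S.mul_notMem_pos hg hgB (S.conj_mul_mem_pos hp' hpA' hz),
        by group⟩
    | succ k ih =>
      obtain ⟨z', hz', e⟩ := ih
      refine ⟨g * (t * (p' * p) * t⁻¹ * z'),
        S.mul_notMem_pos hg hgB (S.conj_mul_mem_pos (mul_mem hp' hp) hpp hz'), ?_⟩
      rw [pow_succ', mul_assoc, e]
      group
  obtain ⟨z', hz', e⟩ := key
  rw [e]
  exact S.conj_mul_mem_pos hp hpA hz'

theorem zpow_mul_mem_pos (S : HalfSpaces H A B t P N) {p p' g : Γ} (hp : p ∈ H) (hpA : p ∉ A)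
    (hp' : p' ∈ H) (hpA' : p' ∉ A) (hpp : p' * p ∉ A) (hg : g ∈ H) (hgB : g ∉ B) {k : ℤ}
    (hk : k ≠ 0) {z : Γ} (hz : z ∉ P) : (t * p * t⁻¹ * g * (t * p' * t⁻¹)) ^ k * z ∈ P := by
  obtain ⟨j, rfl | rfl⟩ : ∃ j : ℕ, k = ((j + 1 : ℕ) : ℤ) ∨ k = -((j + 1 : ℕ) : ℤ) :=
    ⟨k.natAbs - 1, by omega⟩
  · rw [zpow_natCast]
    exact S.pow_mul_mem_pos hp hpA hp' hpA' hpp hg hgB j hz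
  · have := S.pow_mul_mem_pos (inv_mem hp') (by simpa using hpA') (inv_mem hp) (by simpa using hpA)
      (p := p'⁻¹) (p' := p⁻¹) (by rwa [← mul_inv_rev, inv_mem_iff]) (inv_mem hg)
      (by simpa using hgB) j hz
    rw [zpow_neg, zpow_natCast, ← inv_pow]
    convert this using 3
    group

end HalfSpaces

section malnormal

variable {Γ : Type} [Group Γ] {H A B : Subgroup Γ} {t b c d : Γ} {P N : Set Γ} {r : FreeGroup ℤ}
  {n : ℤ}

/-- If the lower associated subgroup `A` meets a conjugate of itself trivially, `ConjGroup r` is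
SQ-universal. -/
theorem sqUniversal_of_inter_conj_eq_bot (S : HalfSpaces H A B t P N) (h : conjEval t b r = 1)
    (hr : r ∈ letterSubgroup (Set.Icc 0 n))
    (hH : (letterSubgroup (Set.Icc 0 n)).map (conjEval t b) ≤ H)
    (hA : A ≤ (letterSubgroup (Set.Icc 0 n)).map (conjEval t b)) (hA' : A ≠ ⊥)
    (hd : d ∈ (letterSubgroup (Set.Icc 0 n)).map (conjEval t b))
    (hdA : ∀ a ∈ A, d * a * d⁻¹ ∈ A → a = 1)
    (hc : c ∈ (letterSubgroup (Set.Icc 0 n)).map (conjEval t b)) (hcB : c ∉ B) :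
    SQUniversal (ConjGroup r) := by
  obtain ⟨⟨a, ha⟩, ha1⟩ := Subgroup.ne_bot_iff_exists_ne_one.1 hA'
  replace ha1 : a ≠ 1 := fun e => ha1 (Subtype.ext e)
  let HS := (letterSubgroup (Set.Icc 0 n)).map (conjEval t b)
  let A' := (letterSubgroup (Set.Icc 0 (n + 1))).map (conjEval t b)
  have hHA' : HS ≤ A' :=
    Subgroup.map_mono (letterSubgroup_mono (Set.Icc_subset_Icc_right (by omega)))
  have hHA'' : ∀ g ∈ HS, t * g * t⁻¹ ∈ A' := fun g hg =>
    conj_mem_conjEval_map (S := Set.Icc 0 n)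
      (S' := Set.Icc 0 (n + 1)) (fun i hi => ⟨by have := hi.1; omega, by have := hi.2; omega⟩) hg
  have hD : ∀ δ ∈ (letterSubgroup (Set.Icc 1 (n + 1))).map (conjEval t b), ∃ h ∈ HS,
      δ = t * h * t⁻¹ := fun δ hδ => exists_conj_of_mem_conjEval_map
    (S := Set.Icc 1 (n + 1)) (S' := Set.Icc 0 n)
    (fun i hi => ⟨by have := hi.1; omega, by have := hi.2; omega⟩) hδ
  have hdA1 : d ∉ A := fun hdA1 => ha1 (hdA a ha (mul_mem (mul_mem hdA1 ha) (inv_mem hdA1)))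
  have hdA2 : d * a * d⁻¹ ∉ A := fun h => ha1 (hdA a ha h)
  have hdA3 : d * a * d⁻¹ * d ∉ A := by
    rw [inv_mul_cancel_right]
    exact fun h => hdA1 ((mul_mem_cancel_right ha).1 h)
  have haS : a ∈ HS := hA ha
  have hdaS : d * a * d⁻¹ ∈ HS := mul_mem (mul_mem hd haS) (inv_mem hd)
  have hdinv : ∀ z, z ∉ P → (t * d * t⁻¹)⁻¹ * z ∈ P := by
    intro z hz
    have := S.conj_mul_mem_pos (inv_mem (hH hd)) (by simpa using hdA1) hz
    simpa [mul_assoc] using this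
  have hcinv : ∀ z ∈ P, c⁻¹ * z ∉ P := fun z hz =>
    S.mul_notMem_pos (inv_mem (hH hc)) (by simpa using hcB) hz
  let y := t * d * t⁻¹ * c * (t * (d * a * d⁻¹) * t⁻¹)
  have hyA : y ∈ A' := mul_mem (mul_mem (hHA'' d hd) (hHA' hc)) (hHA'' _ hdaS)
  let x := c * y * c⁻¹
  have hxA : x ∈ A' := mul_mem (mul_mem (hHA' hc) hyA) (inv_mem (hHA' hc))
  have hx : ∀ k : ℤ, k ≠ 0 → ∀ z ∈ P, x ^ k * z ∉ P := by
    intro k hk z hz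
    rw [conj_zpow, mul_assoc, mul_assoc]
    exact S.mul_notMem_pos (hH hc) hcB (S.zpow_mul_mem_pos (hH hd) hdA1 (hH hdaS) hdA2 hdA3
      (hH hc) hcB hk (hcinv z hz))
  have hB : ∀ δ ∈ B, δ ≠ 1 → ∀ z, z ∉ P → (t * d * t⁻¹)⁻¹ * δ * (t * d * t⁻¹) * z ∈ P := by
    intro δ hδ hδ1 z hz
    have h1 : t⁻¹ * δ * t ∈ A := by simpa using (S.conjB δ hδ)
    have h2 : d⁻¹ * (t⁻¹ * δ * t) * d ∉ A := by
      intro h3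
      have h4 := hdA _ h3 (by simpa [mul_assoc] using h1)
      apply hδ1
      have : δ = t * d * (d⁻¹ * (t⁻¹ * δ * t) * d) * d⁻¹ * t⁻¹ := by group
      rw [this, h4]; group
    have := S.conj_mul_mem_pos (mul_mem (mul_mem (inv_mem (hH hd)) (S.leA h1)) (hH hd)) h2 hz
    convert this using 2
    group
  have hHD : ∀ h ∈ H, h ≠ 1 → ∀ z, z ∉ P → (t * d * t⁻¹)⁻¹ * h * (t * d * t⁻¹) * z ∈ P := by
    intro h hh hh1 z hz
    by_cases hhB : h ∈ B
    · exact hB h hhB hh1 z hz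
    · rw [mul_assoc, mul_assoc]
      exact hdinv _ (S.mul_notMem_pos hh hhB (S.conj_mul_mem_pos (hH hd) hdA1 hz))
  have hc'A : t * d * t⁻¹ ∈ A' := hHA'' d hd
  let w := c * (t * d * t⁻¹)
  have hwA : w ∈ A' := mul_mem (hHA' hc) hc'A
  refine sqUniversal_of_free_cyclic (m := n + 1) (α := w * x * w⁻¹)
    (β := (t * d * t⁻¹) * x * (t * d * t⁻¹)⁻¹) h
    (letterSubgroup_mono (Set.Icc_subset_Icc_right (by omega)) hr)
    (mul_mem (mul_mem hwA hxA) (inv_mem hwA)) (mul_mem (mul_mem hc'A hxA) (inv_mem hc'A)) ?_ ?_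
  · refine S.coprod_zpowers_injective_conj _ _ _ hx fun δ hδ hδ1 z hz => ?_
    obtain ⟨h, hh, rfl⟩ := hD δ hδ
    have e : w⁻¹ * (t * h * t⁻¹) * w * z =
        (t * d * t⁻¹)⁻¹ * (c⁻¹ * (t * h * t⁻¹) * c) * (t * d * t⁻¹) * z := by
      simp only [w]; group
    rw [e]
    by_cases hhA : h ∈ A
    · refine hHD _ (mul_mem (mul_mem (inv_mem (hH hc)) (S.leB (S.conjA h hhA))) (hH hc)) ?_ z hz
      intro h1
      apply hδ1
      have : t * h * t⁻¹ = c * (c⁻¹ * (t * h * t⁻¹) * c) * c⁻¹ := by group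
      rw [this, h1]; group
    · have : (t * d * t⁻¹)⁻¹ * (c⁻¹ * (t * h * t⁻¹) * c) * (t * d * t⁻¹) * z =
          (t * d * t⁻¹)⁻¹ * (c⁻¹ * (t * h * t⁻¹ * (c * (t * d * t⁻¹ * z)))) := by group
      rw [this]
      exact hdinv _ (hcinv _ (S.conj_mul_mem_pos (hH hh) hhA (S.mul_notMem_pos (hH hc) hcB
        (S.conj_mul_mem_pos (hH hd) hdA1 hz))))
  · have e : t * (t * d * t⁻¹ * x * (t * d * t⁻¹)⁻¹) * t⁻¹ =
        (t * (t * d * t⁻¹)) * x * (t * (t * d * t⁻¹))⁻¹ := by group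
    rw [e]
    refine S.coprod_zpowers_injective_conj _ _ _ hx fun δ hδ hδ1 z hz => ?_
    obtain ⟨h, hh, rfl⟩ := hD δ hδ
    have := hHD h (hH hh) (by rintro rfl; exact hδ1 (by group)) z hz
    convert this using 2
    group

end malnormal

namespace HalfSpaces

variable {Γ : Type} [Group Γ] {H A B : Subgroup Γ} {t : Γ} {P N : Set Γ}

theorem mul_notMem_neg_of_mem_sup (S : HalfSpaces H A B t P N) {w : Γ}
    (hw : w ∈ H ⊔ H.map (MulAut.conj t).toMonoidHom) (hwA : w ∉ A) {z : Γ} (hz : z ∈ N) :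
    w * z ∉ N := by
  let F : Bool → Subgroup Γ := fun i => cond i (H.map (MulAut.conj t).toMonoidHom) H
  have hB : ∀ i, B ≤ F i := by
    rintro (_ | _)
    · exact S.leB
    · intro g hg
      exact ⟨_, S.leA (S.conjB g hg), by simp [mul_assoc]⟩
  have key : ∀ i w, Alternating F B i w →
      (i = true → ∀ z ∈ N, w * z ∈ P) ∧
      (i = false → w ∈ H ∨ ∃ h ∈ H, h ∉ B ∧ ∀ z ∈ N, ∃ z' ∈ P, w * z = h * z') := by
    have hconj : ∀ g ∈ F true, g ∉ B → ∀ z, z ∉ P → g * z ∈ P := by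
      rintro _ ⟨h, hh, rfl⟩ hgB z hz
      exact S.conj_mul_mem_pos hh (fun hA => hgB (S.conjA h hA)) hz
    intro i w hw
    induction hw with
    | single i g hg hgB =>
      refine ⟨?_, ?_⟩
      · rintro rfl z hz
        exact hconj g hg hgB z (S.symm.notMem_neg_of_mem_pos hz)
      · rintro rfl
        exact Or.inl hg
    | cons i g w hg hgB hw ih =>
      refine ⟨?_, ?_⟩
      · rintro rfl z hz
        rw [mul_assoc]
        refine hconj g hg hgB _ ?_
        rcases ih.2 rfl with hwH | ⟨h, hh, hhB, hz'⟩
        · exact S.base_mul_neg z hz w hwH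
        · obtain ⟨z', hz', e⟩ := hz' z hz
          rw [e]
          exact S.mul_notMem_pos hh hhB hz'
      · rintro rfl
        exact Or.inr ⟨g, hg, hgB, fun z hz => ⟨w * z, ih.1 rfl z hz, mul_assoc _ _ _⟩⟩
  have hH : w ∈ H → w * z ∉ N := fun hH hN => hwA ((S.base_mul_mem_neg z hz w hH).1 hN)
  rcases Alternating.of_mem_sup (S := F) hB (g := w) (by rwa [sup_comm] at hw ⊢) with
    hwB | ⟨_ | _, hw⟩
  · exact hH (S.leB hwB)
  · rcases (key _ _ hw).2 rfl with hwH | ⟨h, hh, hhB, hz'⟩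
    · exact hH hwH
    · obtain ⟨z', hz', e⟩ := hz' z hz
      rw [e]
      exact S.base_mul_pos z' hz' h hh
  · exact S.notMem_neg_of_mem_pos ((key _ _ hw).1 rfl z hz)

theorem conj_mul_mem_pos_of_mem_sup (S : HalfSpaces H A B t P N) {δ : Γ}
    (hδ : t⁻¹ * δ * t ∈ H ⊔ H.map (MulAut.conj t).toMonoidHom) (hδB : δ ∉ B) {z : Γ}
    (hz : z ∉ P) : δ * z ∈ P := by
  have h1 := S.mul_notMem_neg_of_mem_sup hδ
    (fun hA => hδB (by simpa [mul_assoc] using S.conjA _ hA)) ((S.inv_mul_mem_neg_iff z).2 hz)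
  by_contra h2
  refine h1 ?_
  have := (S.inv_mul_mem_neg_iff _).2 h2
  simpa [mul_assoc] using this

theorem double_conj_mul_mem_pos (S : HalfSpaces H A B t P N) (hAB : ∀ g ∈ A, g ∈ B → g = 1)
    {c p δ : Γ} (hc : c ∈ H) (hcB : c ∉ B) (hp : p ∈ H) (hpA : p ∉ A)
    (hδ : t⁻¹ * δ * t ∈ H ⊔ H.map (MulAut.conj t).toMonoidHom) (hδ1 : δ ≠ 1) {z : Γ}
    (hz : z ∉ P) :
    (c * (t * (t * p * t⁻¹) * t⁻¹))⁻¹ * δ * (c * (t * (t * p * t⁻¹) * t⁻¹)) * z ∈ P := by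
  have hq : ∀ p ∈ H, t * p * t⁻¹ ∈ H ⊔ H.map (MulAut.conj t).toMonoidHom := fun p hp =>
    Subgroup.mem_sup_right ⟨p, hp, rfl⟩
  have hqA : ∀ p ∈ H, p ∉ A → t * p * t⁻¹ ∉ A := fun p hp hpA h =>
    hpA (S.mem_of_conj_pow_mem one_ne_zero hp (by simpa using S.leA h))
  have htA : ∀ q, q ∉ A → t * q * t⁻¹ ∉ B := fun q hq h =>
    hq (by simpa [mul_assoc] using S.conjB _ h)
  set q := t * p * t⁻¹
  have hg : ∀ z, z ∉ P → t * q * t⁻¹ * z ∈ P := fun z hz =>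
    S.conj_mul_mem_pos_of_mem_sup (by simpa [mul_assoc] using hq p hp) (htA _ (hqA p hp hpA)) hz
  have hg' : ∀ z, z ∉ P → (t * q * t⁻¹)⁻¹ * z ∈ P := fun z hz => by
    refine S.conj_mul_mem_pos_of_mem_sup ?_ (fun h => htA _ (hqA p hp hpA) (inv_mem_iff.1 h)) hz
    have := inv_mem (hq p hp)
    simpa [q, mul_assoc] using this
  have hc' : ∀ z ∈ P, c⁻¹ * z ∉ P := fun z hz =>
    S.mul_notMem_pos (inv_mem hc) (by simpa using hcB) hz
  have e : (c * (t * q * t⁻¹))⁻¹ * δ * (c * (t * q * t⁻¹)) * z =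
      (t * q * t⁻¹)⁻¹ * (c⁻¹ * (δ * (c * (t * q * t⁻¹ * z)))) := by group
  by_cases hδB : δ ∈ B
  swap
  · rw [e]
    exact hg' _ (hc' _ (S.conj_mul_mem_pos_of_mem_sup hδ hδB (S.mul_notMem_pos hc hcB (hg z hz))))
  have hδH : c⁻¹ * δ * c ∈ H := mul_mem (mul_mem (inv_mem hc) (S.leB hδB)) hc
  by_cases hcδ : c⁻¹ * δ * c ∈ B
  swap
  · rw [e, ← mul_assoc δ, ← mul_assoc c⁻¹, ← mul_assoc c⁻¹]
    exact hg' _ (S.mul_notMem_pos hδH hcδ (hg z hz))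
  have e2 : (c * (t * q * t⁻¹))⁻¹ * δ * (c * (t * q * t⁻¹)) =
      t * (q⁻¹ * (t⁻¹ * (c⁻¹ * δ * c) * t) * q) * t⁻¹ := by group
  have ha1 := S.conjB _ hcδ
  rw [e2]
  refine S.conj_mul_mem_pos_of_mem_sup ?_ (htA _ fun ha2 => ?_) hz
  · have := mul_mem (mul_mem (inv_mem (hq p hp)) (Subgroup.mem_sup_left (S.leA ha1))) (hq p hp)
    simpa [q, mul_assoc] using this
  have ha21 : q⁻¹ * (t⁻¹ * (c⁻¹ * δ * c) * t) * q ∉ B := by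
    intro hB
    have h1 := hAB _ ha2 hB
    apply hδ1
    have : δ = c * t * q * (q⁻¹ * (t⁻¹ * (c⁻¹ * δ * c) * t) * q) * q⁻¹ * t⁻¹ * c⁻¹ := by group
    rw [this, h1]; group
  have h1 := S.conj_mul_mem_pos (inv_mem hp) (by simpa using hpA) S.one_notMem_pos
  have h2 := S.conj_mul_mem_pos hp hpA (S.mul_notMem_pos (S.leA ha2) ha21 h1)
  refine S.base_notMem_pos _ (S.leA ha1) ?_
  convert h2 using 1
  simp only [q]; group

end HalfSpaces

section trivialInter

variable {Γ : Type} [Group Γ] {H A B : Subgroup Γ} {t b : Γ} {P N : Set Γ} {r : FreeGroup ℤ}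

theorem conjEval_map_Icc_le_sup (hb : b ∈ H) (hb' : t * b * t⁻¹ ∈ H) {i j : ℤ} {δ : Γ}
    (hj : j ≤ i + 2)
    (hδ : δ ∈ (letterSubgroup (Set.Icc i j)).map (conjEval t b)) :
    (t ^ i)⁻¹ * δ * t ^ i ∈ H ⊔ H.map (MulAut.conj t).toMonoidHom := by
  obtain ⟨g, hg, rfl⟩ := hδ
  have : ∀ g ∈ letterSubgroup (Set.Icc i j), conjEval t b g ∈
      (H ⊔ H.map (MulAut.conj t).toMonoidHom).comap (MulAut.conj (t ^ i)⁻¹).toMonoidHom := by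
    refine map_letterSubgroup_le_iff.2 fun k hk => ?_
    obtain ⟨hk1, hk2⟩ := hk
    change (t ^ i)⁻¹ * conjEval t b (FreeGroup.of k) * (t ^ i)⁻¹⁻¹ ∈
      H ⊔ H.map (MulAut.conj t).toMonoidHom
    rw [conjEval_of]
    obtain rfl | rfl | rfl : k = i ∨ k = i + 1 ∨ k = i + 2 := by omega
    · refine Subgroup.mem_sup_left ?_
      convert hb using 1
      group
    · refine Subgroup.mem_sup_left ?_
      convert hb' using 1
      group
    · refine Subgroup.mem_sup_right ⟨_, hb', ?_⟩
      simp only [MulEquiv.toMonoidHom_eq_coe, MonoidHom.coe_coe, MulAut.conj_apply,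
        zpow_add, zpow_ofNat, pow_two, mul_inv_rev]
      simp [mul_assoc]
  have := this g hg
  change (t ^ i)⁻¹ * conjEval t b g * (t ^ i)⁻¹⁻¹ ∈
    H ⊔ H.map (MulAut.conj t).toMonoidHom at this
  rwa [inv_inv] at this

/-- If `b` and `t * b * t⁻¹` generate subgroups whose powers avoid each other, `ConjGroup r` is
SQ-universal. -/
theorem sqUniversal_of_inter_eq_bot (S : HalfSpaces H A B t P N) (h : conjEval t b r = 1)
    (hr : r ∈ letterSubgroup (Set.Icc 0 1)) (hb : b ∈ H) (hb' : t * b * t⁻¹ ∈ H)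
    (hAB : ∀ g ∈ A, g ∈ B → g = 1) (h0 : ∀ k : ℤ, k ≠ 0 → b ^ k ∉ B)
    (h1 : ∀ k : ℤ, k ≠ 0 → (t * b * t⁻¹) ^ k ∉ A) : SQUniversal (ConjGroup r) := by
  have hbB : b ∉ B := by simpa using h0 1 one_ne_zero
  have hbA : t * b * t⁻¹ ∉ A := by simpa using h1 1 one_ne_zero
  have e0 : conjEval t b (FreeGroup.of 0) = b := by simp [conjEval_of]
  have e3 : conjEval t b (FreeGroup.of 3) = t * (t * (t * b * t⁻¹) * t⁻¹) * t⁻¹ := by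
    rw [conjEval_of, zpow_ofNat]; simp [pow_succ, mul_assoc]
  have m0 : b ∈ (letterSubgroup (Set.Icc 0 3)).map (conjEval t b) :=
    ⟨_, of_mem_letterSubgroup (by simp), e0⟩
  have m3 : t * (t * (t * b * t⁻¹) * t⁻¹) * t⁻¹ ∈
      (letterSubgroup (Set.Icc 0 3)).map (conjEval t b) :=
    ⟨_, of_mem_letterSubgroup (by simp), e3⟩
  set b₃ := t * (t * (t * b * t⁻¹) * t⁻¹) * t⁻¹ with hb₃
  refine sqUniversal_of_free_cyclic (m := 3) (α := (b * b₃) * b * (b * b₃)⁻¹)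
    (β := (b₃ * b) * b₃ * (b₃ * b)⁻¹) h
    (letterSubgroup_mono (Set.Icc_subset_Icc_right (by omega)) hr)
    (mul_mem (mul_mem (mul_mem m0 m3) m0) (inv_mem (mul_mem m0 m3)))
    (mul_mem (mul_mem (mul_mem m3 m0) m3) (inv_mem (mul_mem m3 m0))) ?_ ?_
  · refine S.coprod_zpowers_injective_conj _ _ _ (fun k hk z hz =>
      S.mul_notMem_pos (zpow_mem hb k) (h0 k hk) hz) fun δ hδ hδ1 z hz => ?_
    have := conjEval_map_Icc_le_sup hb hb' (by omega) hδ
    rw [zpow_one] at this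
    exact S.double_conj_mul_mem_pos hAB hb hbB hb' hbA this hδ1 hz
  · have e : t * (b₃ * b * b₃ * (b₃ * b)⁻¹) * t⁻¹ =
        (t ^ 3 * (t * b * t⁻¹ * (t⁻¹ * (t⁻¹ * b * t⁻¹⁻¹) * t⁻¹⁻¹))) * (t * b * t⁻¹) *
          (t ^ 3 * (t * b * t⁻¹ * (t⁻¹ * (t⁻¹ * b * t⁻¹⁻¹) * t⁻¹⁻¹)))⁻¹ := by
      simp [hb₃, pow_succ, mul_assoc]
    rw [e]
    refine S.symm.coprod_zpowers_injective_conj _ _ _ (fun k hk z hz =>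
      S.symm.mul_notMem_pos (zpow_mem hb' k) (h1 k hk) hz) fun δ hδ hδ1 z hz => ?_
    have h2 := conjEval_map_Icc_le_sup (i := 1) hb hb' (by omega) hδ
    have h3 : t⁻¹⁻¹ * ((t ^ 3)⁻¹ * δ * t ^ 3) * t⁻¹ ∈
        H ⊔ H.map (MulAut.conj t⁻¹).toMonoidHom := by
      have h4 := Subgroup.mem_map_of_mem (MulAut.conj t⁻¹).toMonoidHom h2
      rw [Subgroup.map_sup, Subgroup.map_map, sup_comm] at h4
      have h5 : (MulAut.conj t⁻¹).toMonoidHom.comp (MulAut.conj t).toMonoidHom =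
          MonoidHom.id Γ := by
        ext z; simp [mul_assoc]
      rw [h5, Subgroup.map_id] at h4
      convert h4 using 1
      simp [pow_succ, mul_assoc]
    have := S.symm.double_conj_mul_mem_pos (fun g hB hA => hAB g hA hB) hb' hbA hb hbB h3
      (by
        intro h5
        apply hδ1
        have : δ = t ^ 3 * ((t ^ 3)⁻¹ * δ * t ^ 3) * (t ^ 3)⁻¹ := by group
        rw [this, h5]; group) hz
    convert this using 2
    group

end trivialInter

namespace HalfSpaces

variable {E : Type} [Group E] {Q U : Subgroup E} {s : E} {P N : Set E}

theorem mul_notMem_union (S : HalfSpaces Q ⊥ ⊥ s P N) {q z : E} (hq : q ∈ Q) (hq1 : q ≠ 1)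
    (hz : z ∈ P ∪ N) : q * z ∉ P ∪ N := by
  rintro (h | h) <;> rcases hz with hz | hz
  · exact hq1 ((S.base_mul_mem_pos _ hz _ hq).1 h)
  · exact S.base_mul_neg _ hz _ hq h
  · exact S.base_mul_pos _ hz _ hq h
  · exact hq1 ((S.base_mul_mem_neg _ hz _ hq).1 h)

theorem base_notMem_union (S : HalfSpaces Q ⊥ ⊥ s P N) {q : E} (hq : q ∈ Q) : q ∉ P ∪ N := by
  rintro (h | h)
  · exact S.base_notMem_pos _ hq h
  · exact S.base_notMem_neg _ hq h

theorem pow_succ_mul_mem_pos (S : HalfSpaces Q ⊥ ⊥ s P N) {z : E} (hz : z ∉ P ∪ N) (k : ℕ) :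
    s ^ (k + 1) * z ∈ P := by
  induction k with
  | zero => rw [zero_add, pow_one, S.mul_mem_pos_iff]; exact fun h => hz (Or.inr h)
  | succ k ih =>
    rw [pow_succ', mul_assoc, S.mul_mem_pos_iff]
    exact S.notMem_neg_of_mem_pos ih

theorem zpow_mul_mem_union (S : HalfSpaces Q ⊥ ⊥ s P N) {z : E} (hz : z ∉ P ∪ N) {k : ℤ}
    (hk : k ≠ 0) : s ^ k * z ∈ P ∪ N := by
  obtain ⟨n, rfl | rfl⟩ := k.eq_nat_or_neg
  · obtain ⟨n, rfl⟩ := Nat.exists_eq_succ_of_ne_zero (by simpa using hk)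
    rw [zpow_natCast]
    exact Or.inl (S.pow_succ_mul_mem_pos hz n)
  · obtain ⟨n, rfl⟩ := Nat.exists_eq_succ_of_ne_zero (by simpa using hk)
    rw [zpow_neg, zpow_natCast, ← inv_pow]
    exact Or.inr (S.symm.pow_succ_mul_mem_pos (by rwa [Set.union_comm]) n)

theorem sup_zpowers_cases (S : HalfSpaces Q ⊥ ⊥ s P N) {w p : E}
    (hw : w ∈ U ⊔ Subgroup.zpowers s) (hp : ∀ u ∈ U, u * p ∉ P ∪ N) (hU : U ≤ Q) :
    w = 1 ∨ w * p ∈ P ∪ N ∨ ∃ u ∈ U, u ≠ 1 ∧ (w = u ∨ u⁻¹ * (w * p) ∈ P ∪ N) := by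
  let F : Bool → Subgroup E := fun i => if i then Subgroup.zpowers s else U
  have key : ∀ i w, Alternating F ⊥ i w → (i = true → w * p ∈ P ∪ N) ∧
      (i = false → ∃ u ∈ U, u ≠ 1 ∧ (w = u ∨ u⁻¹ * (w * p) ∈ P ∪ N)) := by
    intro i w h
    induction h with
    | single i g hg hgB =>
      cases i
      · exact ⟨by simp, fun _ => ⟨g, hg, fun h => hgB (h ▸ one_mem _), Or.inl rfl⟩⟩
      · refine ⟨fun _ => ?_, by simp⟩
        obtain ⟨k, rfl⟩ := hg
        refine S.zpow_mul_mem_union (by simpa using hp 1 (one_mem _)) ?_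
        rintro rfl
        exact hgB (by simp)
    | cons i g w hg hgB hw ih =>
      cases i
      · refine ⟨by simp, fun _ => ⟨g, hg, fun h => hgB (h ▸ one_mem _), Or.inr ?_⟩⟩
        rw [mul_assoc, inv_mul_cancel_left]
        exact ih.1 rfl
      · refine ⟨fun _ => ?_, by simp⟩
        obtain ⟨k, rfl⟩ := hg
        rw [mul_assoc]
        refine S.zpow_mul_mem_union ?_ (by rintro rfl; exact hgB (by simp))
        obtain ⟨u, hu, hu1, rfl | h⟩ := ih.2 rfl
        · exact hp _ hu
        · have := S.mul_notMem_union (hU hu) hu1 h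
          rwa [mul_inv_cancel_left] at this
  rcases Alternating.of_mem_sup (S := F) (B := ⊥) (fun i => bot_le) hw with h | ⟨i, h⟩
  · exact Or.inl h
  · cases i
    · exact Or.inr (Or.inr ((key _ _ h).2 rfl))
    · exact Or.inr (Or.inl ((key _ _ h).1 rfl))

/-- In the free product `Q * ⟨s⟩`, the subgroup `⟨U, s⟩` meets its conjugate by `g s g⁻¹`
trivially when `g ∈ Q ∖ U`. -/
theorem eq_one_of_conj_mem_sup_zpowers (S : HalfSpaces Q ⊥ ⊥ s P N) (hU : U ≤ Q) {g w : E}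
    (hg : g ∈ Q) (hgU : g ∉ U) (hw : w ∈ U ⊔ Subgroup.zpowers s)
    (hc : g * s * g⁻¹ * w * (g * s * g⁻¹)⁻¹ ∈ U ⊔ Subgroup.zpowers s) : w = 1 := by
  have hg1 : g ≠ 1 := by rintro rfl; exact hgU (one_mem _)
  have hug : ∀ u ∈ U, u * g ≠ 1 := by
    intro u hu h
    exact hgU (by rw [eq_inv_of_mul_eq_one_right h]; exact inv_mem hu)
  by_contra hw1
  have h1 : s⁻¹ ∈ P ∪ N := by
    have := S.zpow_mul_mem_union (S.base_notMem_union (one_mem Q)) (k := -1) (by omega)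
    simpa using this
  have h2 : g⁻¹ * (w * (g * s⁻¹)) ∉ P ∪ N := by
    intro hcon
    rcases S.sup_zpowers_cases hw (p := g * s⁻¹) (fun u hu => by
      rw [← mul_assoc]
      exact S.mul_notMem_union (mul_mem (hU hu) hg) (hug u hu) h1) hU with h | h | ⟨u, hu, hu1, h⟩
    · exact hw1 h
    · exact S.mul_notMem_union (inv_mem hg) (by simpa using hg1) h hcon
    · rcases h with rfl | h
      · rw [← mul_assoc, ← mul_assoc] at hcon
        refine S.mul_notMem_union (mul_mem (mul_mem (inv_mem hg) (hU hu)) hg) ?_ h1 hcon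
        intro h
        apply hu1
        rw [mul_assoc, inv_mul_eq_one] at h
        simpa using h
      · refine S.mul_notMem_union (mul_mem (inv_mem hg) (hU hu)) ?_ h ?_
        · intro h'
          rw [inv_mul_eq_one] at h'
          exact hgU (h' ▸ hu)
        · rwa [mul_assoc, mul_inv_cancel_left]
  have h3 : g⁻¹ * (g * s * g⁻¹ * w * (g * s * g⁻¹)⁻¹ * g) ∈ P ∪ N := by
    have := S.zpow_mul_mem_union h2 (k := 1) one_ne_zero
    convert this using 1
    group
  rcases S.sup_zpowers_cases hc (p := g) (fun u hu =>
      S.base_notMem_union (mul_mem (hU hu) hg)) hU with h | h | ⟨u, hu, hu1, h⟩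
  · rw [h] at h3
    simp [S.one_notMem_pos, S.one_notMem_neg] at h3
  · exact S.mul_notMem_union (inv_mem hg) (by simpa using hg1) h h3
  · rcases h with h | h
    · rw [h, ← mul_assoc] at h3
      exact S.base_notMem_union (mul_mem (mul_mem (inv_mem hg) (hU hu)) hg) h3
    · refine S.mul_notMem_union (mul_mem (inv_mem hg) (hU hu)) ?_ h ?_
      · intro h'
        rw [inv_mul_eq_one] at h'
        exact hgU (h' ▸ hu)
      · rwa [mul_assoc, mul_inv_cancel_left]

end HalfSpaces

section

variable {Λ : Type} {r : FreeGroup Λ} {Γ : Type} [Group Γ] {l : FreeGroup Λ →* Γ}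

theorem map_eq_one_of_conj_map_eq (hl : ∀ g, l g = 1 ↔ g ∈ Subgroup.normalClosure {r})
    {c : Λ} (hr : r ∈ letterSubgroup ({c}ᶜ : Set Λ)) {g : FreeGroup Λ}
    (hg : g ∈ letterSubgroup ({c}ᶜ : Set Λ)) {S : Set Λ}
    (hgS : l g ∉ (letterSubgroup S).map l) {w w' : FreeGroup Λ} (hw : w ∈ letterSubgroup S)
    (hw' : w' ∈ letterSubgroup S)
    (h : l (g * FreeGroup.of c * g⁻¹ * w * (g * FreeGroup.of c * g⁻¹)⁻¹) = l w') : l w = 1 := by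
  classical
  let φ : (⊥ : Subgroup Γ) ≃* (⊥ : Subgroup Γ) := MulEquiv.refl _
  obtain ⟨P, N, H⟩ := HNNExtension.halfSpaces (⊥ : Subgroup Γ) ⊥ φ
  rw [Subgroup.map_bot] at H
  let ι : Γ →* HNNExtension Γ ⊥ ⊥ φ := HNNExtension.of
  let τ : FreeGroup Λ →* HNNExtension Γ ⊥ ⊥ φ := FreeGroup.lift fun p =>
    if p = c then HNNExtension.t else ι (l (FreeGroup.of p))
  have hτc : τ (FreeGroup.of c) = HNNExtension.t := by simp [τ]
  have hτ : ∀ w ∈ letterSubgroup ({c}ᶜ : Set Λ), τ w = ι (l w) := by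
    intro w hw
    refine eqOn_letterSubgroup (f := τ) (f' := ι.comp l) (fun p hp => ?_) hw
    have hp : p ≠ c := hp
    simp [τ, hp]
  have hker : ∀ w w', l w = l w' → τ w = τ w' := by
    intro w w' h
    have hle : Subgroup.normalClosure {r} ≤ τ.ker := Subgroup.normalClosure_le_normal (by
      simp [hτ r hr, (hl r).2 (Subgroup.subset_normalClosure rfl)])
    rw [← mul_inv_eq_one, ← map_inv, ← map_mul]
    refine hle ((hl _).1 ?_)
    rw [map_mul, h, map_inv, mul_inv_cancel]
  have hτS : ∀ w ∈ letterSubgroup S, τ w ∈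
      ((letterSubgroup S).map l).map ι ⊔ Subgroup.zpowers HNNExtension.t := by
    rw [map_letterSubgroup_le_iff]
    intro p hp
    by_cases hpc : p = c
    · rw [hpc, hτc]; exact Subgroup.mem_sup_right (Subgroup.mem_zpowers _)
    · rw [hτ _ (of_mem_letterSubgroup hpc)]
      exact Subgroup.mem_sup_left ⟨_, ⟨_, of_mem_letterSubgroup hp, rfl⟩, rfl⟩
  have h1 := hker _ _ h
  simp only [map_mul, map_inv, hτc, hτ g hg] at h1
  have h2 : τ w = 1 := by
    refine H.eq_one_of_conj_mem_sup_zpowers (U := ((letterSubgroup S).map l).map ι) ?_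
      (g := ι (l g)) ⟨_, rfl⟩ ?_ (hτS w hw) ?_
    · rintro _ ⟨x, _, rfl⟩; exact ⟨x, rfl⟩
    · rintro ⟨x, hx, hxg⟩
      exact hgS (HNNExtension.of_injective φ hxg ▸ hx)
    · rw [show ι (l g) * HNNExtension.t * (ι (l g))⁻¹ * τ w *
        (ι (l g) * HNNExtension.t * (ι (l g))⁻¹)⁻¹ = τ w' from ?_]
      · exact hτS _ hw'
      · simpa using h1
  let fold : HNNExtension Γ ⊥ ⊥ φ →* Γ :=
    HNNExtension.lift (MonoidHom.id Γ) (l (FreeGroup.of c)) (by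
      rintro ⟨a, ha⟩
      obtain rfl := Subgroup.mem_bot.1 ha
      have : (φ ⟨1, ha⟩ : Γ) = 1 := rfl
      simp [this])
  have h3 : fold.comp τ = l := by
    ext p
    by_cases hpc : p = c
    · subst hpc; simp [hτc, fold]
    · rw [MonoidHom.comp_apply, hτ _ (of_mem_letterSubgroup hpc)]; simp [fold, ι]
  rw [← h3, MonoidHom.comp_apply, h2, map_one]

end

theorem conj_map_ne_of_endomorphism {Λ Γ : Type} [Group Γ] {l : FreeGroup Λ →* Γ} {S Z K : Set Λ}
    {Θ : FreeGroup Λ →* FreeGroup Λ} {T : Γ} (hinj : ∀ w ∈ letterSubgroup S, l w = 1 → w = 1)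
    (hΘ : ∀ p ∈ S, Θ (FreeGroup.of p) ∈ letterSubgroup S)
    (hT : ∀ p ∈ S, T * l (FreeGroup.of p) * T⁻¹ = l (Θ (FreeGroup.of p)))
    (hK : ∀ p ∈ S ∩ K, Θ (FreeGroup.of p) ∈ letterSubgroup (S ∩ K)) {g c : Λ}
    (hc : Θ (FreeGroup.of c) ∈ letterSubgroup (S ∩ K)) (hg : g ∈ S ∩ K) (hgZ : g ∉ Z) (hcZ : c ∈ Z)
    (hcK : c ∉ K) (hZ : Z ⊆ S) {ζ ζ' : FreeGroup Λ} (hζ : ζ ∈ letterSubgroup Z)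
    (hζ' : ζ' ∈ letterSubgroup Z) (j : ℕ) :
    T ^ (j + 1) * l (FreeGroup.of g * FreeGroup.of c * (FreeGroup.of g)⁻¹) * (T ^ (j + 1))⁻¹ ≠
      l (ζ * (FreeGroup.of g * FreeGroup.of c * (FreeGroup.of g)⁻¹) * ζ') := by
  classical
  have hΘS : ∀ w ∈ letterSubgroup S, Θ w ∈ letterSubgroup S := map_letterSubgroup_le_iff.2 hΘ
  have hΘK : ∀ w ∈ letterSubgroup (S ∩ K), Θ w ∈ letterSubgroup (S ∩ K) :=
    map_letterSubgroup_le_iff.2 hK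
  have hT1 : ∀ w ∈ letterSubgroup S, T * l w * T⁻¹ = l (Θ w) := fun w hw =>
    eqOn_letterSubgroup (f := (MulAut.conj T).toMonoidHom.comp l) (f' := l.comp Θ) hT hw
  have hTj : ∀ j : ℕ, ∀ w ∈ letterSubgroup S, T ^ j * l w * (T ^ j)⁻¹ = l (Θ^[j] w) := by
    intro j
    induction j with
    | zero => simp
    | succ j ih =>
      intro w hw
      rw [Function.iterate_succ_apply, ← ih _ (hΘS w hw), ← hT1 w hw, pow_succ]
      group
  have hit : ∀ (V : Set Λ), (∀ w ∈ letterSubgroup V, Θ w ∈ letterSubgroup V) → ∀ j : ℕ,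
      ∀ w ∈ letterSubgroup V, Θ^[j] w ∈ letterSubgroup V := by
    intro V hV j
    induction j with
    | zero => exact fun w hw => hw
    | succ j ih =>
      intro w hw
      rw [Function.iterate_succ_apply]
      exact ih _ (hV w hw)
  set h := FreeGroup.of g * FreeGroup.of c * (FreeGroup.of g)⁻¹ with hh
  have hgS := of_mem_letterSubgroup hg.1
  have hhS : h ∈ letterSubgroup S :=
    mul_mem (mul_mem hgS (of_mem_letterSubgroup (hZ hcZ))) (inv_mem hgS)
  intro heq
  rw [hTj _ _ hhS] at heq
  have hZS := letterSubgroup_mono hZ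
  have h1 : Θ^[j + 1] h = ζ * h * ζ' := by
    rw [← mul_inv_eq_one]
    refine hinj _ (mul_mem (hit S hΘS _ _ hhS) (inv_mem (mul_mem (mul_mem (hZS hζ) hhS)
      (hZS hζ')))) ?_
    rw [map_mul, map_inv, heq, mul_inv_cancel]
  have h2 : Θ^[j + 1] h ∈ letterSubgroup K := by
    refine letterSubgroup_mono Set.inter_subset_right (hit _ hΘK j (Θ h) ?_)
    rw [hh, map_mul, map_mul, map_inv]
    exact mul_mem (mul_mem (hK g hg) hc) (inv_mem (hK g hg))
  have hρ : ∀ w ∈ letterSubgroup Z, letterRetraction K w ∈ letterSubgroup Z := by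
    refine map_letterSubgroup_le_iff.2 fun p hp => ?_
    by_cases hpK : p ∈ K
    · rw [letterRetraction_of_mem hpK]; exact of_mem_letterSubgroup hp
    · rw [letterRetraction_of_notMem hpK]; exact one_mem _
  have h3 : h ∈ letterSubgroup Z := by
    have h4 := letterRetraction_eq_self h2
    have h5 : letterRetraction K h = 1 := by
      rw [hh, map_mul, map_mul, letterRetraction_of_notMem hcK, map_inv]; simp
    rw [h1, map_mul, map_mul, h5, mul_one] at h4
    have h6 : h = ζ⁻¹ * (letterRetraction K ζ * letterRetraction K ζ') * ζ'⁻¹ := by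
      rw [h4]; group
    rw [h6]
    exact mul_mem (mul_mem (inv_mem hζ) (mul_mem (hρ _ hζ) (hρ _ hζ'))) (inv_mem hζ')
  have h4 := letterRetraction_eq_self h3
  rw [hh, map_mul, map_mul, map_inv, letterRetraction_of_notMem hgZ, letterRetraction_of_mem hcZ,
    one_mul, inv_one, mul_one] at h4
  have hgc : g ≠ c := by rintro rfl; exact hgZ hcZ
  have h5 := congrArg (FreeGroup.lift fun p => if p = g then Equiv.swap (0 : Fin 3) 1 else
    if p = c then Equiv.swap (1 : Fin 3) 2 else 1) h4
  simp only [map_mul, map_inv, FreeGroup.lift_apply_of, if_true, hgc.symm, if_false] at h5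
  exact absurd h5 (by decide)

section magnus

variable {X : Type} {x : X} {μ ν : ℤ} {r' : FreeGroup (X × ℤ)} {Γ : Type} [Group Γ]
  {l : FreeGroup (X × ℤ) →* Γ} {t : Γ} {deg : Γ →* Multiplicative ℤ} {P N : Set Γ}

theorem exists_lt_index (w : FreeGroup (X × ℤ)) :
    ∃ κ : ℤ, ∀ κ' ≤ κ, w ∈ letterSubgroup {p : X × ℤ | κ' < p.2} := by
  classical
  obtain ⟨F, hF⟩ := exists_finset_letterSubgroup w
  obtain ⟨κ, hκ⟩ := (F.image Prod.snd).bddBelow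
  refine ⟨κ - 1, fun κ' h => letterSubgroup_mono (fun p hp => ?_) hF⟩
  have : κ ≤ p.2 := hκ (by simpa using ⟨p.1, hp⟩)
  show κ' < p.2
  omega

set_option maxHeartbeats 1000000 in
theorem MagnusHNN.exists_conjugator
    (h : MagnusHNN (indexShift X 1) (indexWindow x μ (ν - 1)) (indexWindow x (μ + 1) ν) r' l t deg
      P N) (hμν : μ ≤ ν)
    (hA : ∀ g ∈ letterSubgroup (indexWindow x μ (ν - 1)), g ∈ Subgroup.normalClosure {r'} → g = 1)
    {z : X} (hz : z ≠ x)
    (hx : ∀ i, μ ≤ i → i ≤ ν → l (FreeGroup.of (x, i)) ∉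
      (letterSubgroup {p : X × ℤ | p.1 ≠ x}).map l) :
    ∃ w ∈ letterSubgroup (indexWindow x μ ν ∩ {p | p.1 = x ∨ p.1 = z}),
      ∀ ζ ∈ letterSubgroup {p : X × ℤ | p.1 ≠ x}, ∀ ζ' ∈ letterSubgroup {p : X × ℤ | p.1 ≠ x},
        ∀ k : ℤ, l ζ * t ^ k = l w * (l ζ' * t ^ k) * (l w)⁻¹ → l ζ' * t ^ k = 1 := by
  classical
  set Z : Set (X × ℤ) := {p | p.1 ≠ x} with hZdef
  have hZw : ∀ a b, Z ⊆ indexWindow x a b := fun a b p hp hpx => absurd hpx hp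
  obtain ⟨e, he, -⟩ := h.exists_base
  have hshift : ∀ ζ ∈ letterSubgroup Z, ∀ k : ℤ, ∃ ζ' ∈ letterSubgroup Z,
      t ^ k * l ζ * (t ^ k)⁻¹ = l ζ' := by
    intro ζ hζ k
    have hm : FreeGroup.map (indexShift X k) ζ ∈ letterSubgroup Z :=
      map_shift_mem (S := {x}ᶜ) hζ
    exact ⟨_, hm, by
      rw [← he _ (letterSubgroup_mono (hZw _ _) hm), indexedEval_shift,
        he _ (letterSubgroup_mono (hZw _ _) hζ)]⟩
  have hpow : ∀ w, ∀ ζ ∈ letterSubgroup Z, ∀ ζ' ∈ letterSubgroup Z, ∀ k : ℤ, k ≠ 0 →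
      l ζ * t ^ k = l w * (l ζ' * t ^ k) * (l w)⁻¹ → ∃ j : ℕ, ∃ ζ₁ ∈ letterSubgroup Z,
        ∃ ζ₂ ∈ letterSubgroup Z, t ^ (j + 1) * l w * (t ^ (j + 1))⁻¹ = l (ζ₁ * w * ζ₂) := by
    intro w ζ hζ ζ' hζ' k hk heq
    have e1 : t ^ k * l w * (t ^ k)⁻¹ = (l ζ)⁻¹ * (l ζ * t ^ k) * l w * (t ^ k)⁻¹ := by group
    have e2 : t ^ (-k) * l w * (t ^ (-k))⁻¹ = t ^ (-k) * l ζ * (t ^ (-k))⁻¹ * l w *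
        (t ^ (-k) * l ζ'⁻¹ * (t ^ (-k))⁻¹) := by
      have : l w = (l ζ * t ^ k) * l w * (l ζ' * t ^ k)⁻¹ := by rw [heq]; group
      rw [map_inv]
      calc _ = t ^ (-k) * l w * t ^ k := by group
        _ = t ^ (-k) * ((l ζ * t ^ k) * l w * (l ζ' * t ^ k)⁻¹) * t ^ k := by rw [← this]
        _ = _ := by group
    obtain ⟨n, rfl | rfl⟩ := k.eq_nat_or_neg
    · obtain ⟨j, rfl⟩ := Nat.exists_eq_succ_of_ne_zero (by simpa using hk)
      refine ⟨j, ζ⁻¹, inv_mem hζ, ζ', hζ', ?_⟩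
      rw [heq] at e1
      rw [zpow_natCast] at e1
      rw [e1]
      simp only [map_mul, map_inv]
      group
    · obtain ⟨j, rfl⟩ := Nat.exists_eq_succ_of_ne_zero (by simpa using hk)
      obtain ⟨ζ₁, h1, h1'⟩ := hshift ζ hζ (- -((j.succ : ℕ) : ℤ))
      obtain ⟨ζ₂, h2, h2'⟩ := hshift ζ'⁻¹ (inv_mem hζ') (- -((j.succ : ℕ) : ℤ))
      refine ⟨j, ζ₁, h1, ζ₂, h2, ?_⟩
      rw [h1', h2'] at e2
      rw [neg_neg, zpow_natCast] at e2
      rw [e2]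
      simp only [map_mul]
  obtain ⟨κ₁, hκ₁⟩ := exists_lt_index r'
  have hrc : ∀ κ ≤ κ₁, r' ∈ letterSubgroup ({(z, κ)}ᶜ : Set (X × ℤ)) := fun κ hκ =>
    letterSubgroup_mono (by
      rintro p hp rfl
      exact lt_irrefl κ hp) (hκ₁ κ hκ)
  have hgc : ∀ i κ, FreeGroup.of (x, i) ∈ letterSubgroup ({(z, κ)}ᶜ : Set (X × ℤ)) := fun i κ =>
    of_mem_letterSubgroup fun h => hz (by simpa using (congrArg Prod.fst h).symm)
  have hw : ∀ i κ, μ ≤ i → i ≤ ν → FreeGroup.of (x, i) * FreeGroup.of (z, κ) *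
      (FreeGroup.of (x, i))⁻¹ ∈ letterSubgroup (indexWindow x μ ν ∩ {p | p.1 = x ∨ p.1 = z}) := by
    intro i κ h1 h2
    have h3 : FreeGroup.of (x, i) ∈
        letterSubgroup (indexWindow x μ ν ∩ {p | p.1 = x ∨ p.1 = z}) :=
      of_mem_letterSubgroup ⟨fun _ => ⟨h1, h2⟩, Or.inl rfl⟩
    exact mul_mem (mul_mem h3 (of_mem_letterSubgroup ⟨hZw _ _ hz, Or.inr rfl⟩)) (inv_mem h3)
  by_cases hν : l (FreeGroup.of (x, ν)) ∈ (letterSubgroup (indexWindow x μ (ν - 1))).map l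
  · obtain ⟨u₀, hu₀, hu₀'⟩ := hν
    have hlt : μ < ν := by
      refine lt_of_le_of_ne hμν fun hμν => hx ν hμν.le le_rfl ⟨u₀, ?_, hu₀'⟩
      refine letterSubgroup_mono (fun p hp hpx => ?_) hu₀
      have := hp hpx
      omega
    obtain ⟨κ₂, hκ₂⟩ := exists_lt_index u₀
    set κ := min κ₁ κ₂
    refine ⟨_, hw μ κ le_rfl hμν, fun ζ hζ ζ' hζ' k heq => ?_⟩
    by_cases hk : k = 0
    · subst hk
      rw [zpow_zero, mul_one] at heq ⊢
      refine map_eq_one_of_conj_map_eq h.ker (hrc κ (min_le_left _ _)) (hgc μ κ) (hx μ le_rfl hμν)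
        hζ' hζ ?_
      rw [map_mul, map_mul, map_inv, heq, mul_one]
    · exfalso
      obtain ⟨j, ζ₁, h1, ζ₂, h2, h3⟩ := hpow _ ζ hζ ζ' hζ' k hk heq
      let Θ : FreeGroup (X × ℤ) →* FreeGroup (X × ℤ) := FreeGroup.lift fun p =>
        if p = (x, ν - 1) then u₀ else FreeGroup.of (indexShift X 1 p)
      have hΘ1 : Θ (FreeGroup.of (x, ν - 1)) = u₀ := by simp [Θ]
      have hΘ2 : ∀ p, p ≠ (x, ν - 1) → Θ (FreeGroup.of p) = FreeGroup.of (indexShift X 1 p) :=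
        fun p hp => by simp [Θ, hp]
      have hsh : ∀ p ∈ indexWindow x μ (ν - 1), p ≠ (x, ν - 1) →
          indexShift X 1 p ∈ indexWindow x μ (ν - 1) := by
        rintro ⟨a, i⟩ hp hne hax
        obtain ⟨h4, h5⟩ := hp hax
        have hax : a = x := hax
        subst hax
        have h6 : i ≠ ν - 1 := fun h => hne (by rw [h])
        simp only [indexShift_apply] at h4 h5 ⊢
        omega
      refine conj_map_ne_of_endomorphism (l := l) (S := indexWindow x μ (ν - 1)) (Z := Z)
        (K := {p | p.1 = z → κ < p.2}) (Θ := Θ) (T := t) (g := (x, μ)) (c := (z, κ))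
        (fun w hw hlw => hA w hw ((h.ker w).1 hlw)) ?_ ?_ ?_ ?_ ?_ ?_ hz ?_ (hZw _ _) h1 h2 j h3
      · intro p hp
        by_cases hpx : p = (x, ν - 1)
        · rw [hpx, hΘ1]; exact hu₀
        · rw [hΘ2 p hpx]
          exact of_mem_letterSubgroup (hsh p hp hpx)
      · intro p hp
        rw [h.rel p hp]
        by_cases hpx : p = (x, ν - 1)
        · rw [hpx, hΘ1, hu₀', indexShift_apply]; simp
        · rw [hΘ2 p hpx]
      · rintro p ⟨hp, hpK⟩
        by_cases hpx : p = (x, ν - 1)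
        · rw [hpx, hΘ1]
          refine mem_letterSubgroup_inter hu₀ (letterSubgroup_mono ?_ (hκ₂ κ (min_le_right _ _)))
          exact fun q hq _ => hq
        · rw [hΘ2 p hpx]
          refine of_mem_letterSubgroup ⟨hsh p hp hpx, fun hpz => ?_⟩
          have h4 : κ < p.2 := hpK hpz
          show κ < p.2 + 1
          omega
      · rw [hΘ2 _ (fun h => hz (congrArg Prod.fst h))]
        exact of_mem_letterSubgroup ⟨hZw _ _ hz, fun _ => by
          simp only [indexShift_apply]; omega⟩
      · refine ⟨fun _ => ?_, fun h => absurd h.symm hz⟩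
        simp only; omega
      · exact fun h => h rfl
      · exact fun h => absurd (h rfl) (lt_irrefl _)
  · refine ⟨_, hw ν κ₁ hμν le_rfl, fun ζ hζ ζ' hζ' k heq => ?_⟩
    by_cases hk : k = 0
    · subst hk
      rw [zpow_zero, mul_one] at heq ⊢
      refine map_eq_one_of_conj_map_eq h.ker (hrc κ₁ le_rfl) (hgc ν κ₁) hν
        (letterSubgroup_mono (hZw _ _) hζ') (letterSubgroup_mono (hZw _ _) hζ) ?_
      rw [map_mul, map_mul, map_inv, heq, mul_one]
    · exfalso
      obtain ⟨j, ζ₁, h1, ζ₂, h2, h3⟩ := hpow _ ζ hζ ζ' hζ' k hk heq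
      obtain ⟨w', hw', hw''⟩ := h.half.mem_of_conj_pow_mem (k := j + 1) (by omega) ⟨_, rfl⟩
        (by rw [h3]; exact ⟨_, rfl⟩)
      have h4 := map_eq_one_of_conj_map_eq h.ker (hrc κ₁ le_rfl) (hgc ν κ₁) hν hw' hw' (by
        rw [map_mul, map_mul, map_inv, hw'']; group)
      rw [hw''] at h4
      have h5 : l (FreeGroup.of (z, κ₁)) = 1 := by
        rw [map_mul, map_mul, map_inv] at h4
        simpa using h4
      exact FreeGroup.of_ne_one _
        (hA _ (of_mem_letterSubgroup (hZw _ _ hz)) ((h.ker _).1 h5))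

end magnus

theorem map_mem_normalClosure {G G' : Type*} [Group G] [Group G'] (f : G →* G') {r g : G}
    (hg : g ∈ Subgroup.normalClosure {r}) : f g ∈ Subgroup.normalClosure {f r} := by
  have : Subgroup.normalClosure {r} ≤ (Subgroup.normalClosure {f r}).comap f :=
    Subgroup.normalClosure_le_normal (by
      simpa using Subgroup.subset_normalClosure (Set.mem_singleton (f r)))
  exact this hg

theorem exists_conj_inter_eq_one_of_expSum {X : Type} {r : FreeGroup X} {x y z : X} (hxy : x ≠ y)
    (hzx : z ≠ x) (hzy : z ≠ y) (hσ : expSum y r = 1) (hx : ¬ ConjInto r {x}ᶜ)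
    (hxm : ∀ u ∈ letterSubgroup ({x}ᶜ : Set X),
      FreeGroup.of x * u⁻¹ ∉ Subgroup.normalClosure {r}) :
    ∃ d ∈ letterSubgroup ({x, y, z} : Set X), ∀ m ∈ letterSubgroup ({x}ᶜ : Set X),
      ∀ m' ∈ letterSubgroup ({x}ᶜ : Set X),
        m⁻¹ * (d * m' * d⁻¹) ∈ Subgroup.normalClosure {r} → m = 1 := by
  classical
  let d : X → ℤ := Pi.single y 1
  have hright : (rewriteHom y d r).right = 1 := by rw [rewriteHom_single_right, hσ]
  obtain ⟨μ, ν, r', hμν, hc, -, hr', hμ, hν, hA, hB⟩ := exists_window (freiheitssatzBelow _)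
    (Nat.lt_succ_self _) (exists_not_conjInto_rewriteHom_left hσ hxy hx)
  obtain ⟨Γ, _, l, t, deg, P, N, hM⟩ :=
    exists_magnusHNN _ _ _ (indexShift_image_window x μ ν) r' hA hB
  obtain ⟨e, he, her, -⟩ := hM.exists_embed hr' hright hc
  have hZw : ∀ a b, {p : X × ℤ | p.1 ≠ x} ⊆ indexWindow x a b :=
    fun a b p hp hpx => absurd hpx hp
  let ev := indexedEval (FreeGroup.of y) (FreeGroup.of (α := X))
  have hev : ev (rewriteHom y d r).left = r := indexedEval_rewriteHom_left hσ
  have hym : FreeGroup.of y ∈ letterSubgroup ({x}ᶜ : Set X) :=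
    of_mem_letterSubgroup (by simpa using hxy.symm)
  obtain ⟨w, hw, hwc⟩ := hM.exists_conjugator hμν hA hzx (by
    rintro i h1 h2 ⟨u, hu, hue⟩
    have h3 : FreeGroup.of (x, i) * u⁻¹ ∈ Subgroup.normalClosure {r'} := by
      rw [← hM.ker, map_mul, map_inv, hue, mul_inv_cancel]
    have h4 := map_mem_normalClosure ev h3
    have h5 : Subgroup.normalClosure {ev r'} = Subgroup.normalClosure {r} := by
      rw [← hev]
      exact normalClosure_eq_of_isConj (ev.map_isConj hc.symm)
    have hevu : ∀ u ∈ letterSubgroup {p : X × ℤ | p.1 ≠ x},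
        ev u ∈ letterSubgroup ({x}ᶜ : Set X) := by
      refine map_letterSubgroup_le_iff.2 fun p hp => ?_
      rw [indexedEval_of]
      exact mul_mem (mul_mem (zpow_mem hym _) (of_mem_letterSubgroup hp)) (inv_mem (zpow_mem hym _))
    rw [h5, map_mul, map_inv, indexedEval_of] at h4
    refine hxm (FreeGroup.of y ^ (-i) * ev u * (FreeGroup.of y ^ (-i))⁻¹)
      (mul_mem (mul_mem (zpow_mem hym _) (hevu u hu)) (inv_mem (zpow_mem hym _))) ?_
    have h6 := Subgroup.Normal.conj_mem Subgroup.normalClosure_normal _ h4 (FreeGroup.of y ^ (-i))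
    convert h6 using 1
    simp only
    group)
  have hf : ∀ m ∈ letterSubgroup ({x}ᶜ : Set X), (rewriteHom y d m).left ∈
      letterSubgroup {p : X × ℤ | p.1 ≠ x} ∧ stableEval y d t e m =
        l (rewriteHom y d m).left * t ^ (rewriteHom y d m).right.toAdd := by
    intro m hm
    have h1 : (rewriteHom y d m).left ∈ letterSubgroup {p : X × ℤ | p.1 ≠ x} :=
      letterSubgroup_mono (fun p hp => hp.1) (rewriteHom_left_mem y d hm)
    exact ⟨h1, by rw [stableEval_eq, he _ (letterSubgroup_mono (hZw _ _) h1)]⟩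
  have hfw : stableEval y d t e (ev w) = l w := by
    rw [← he w (letterSubgroup_mono Set.inter_subset_left hw)]
    refine eqOn_letterSubgroup (f := (stableEval y d t e).comp ev) (f' := indexedEval t e)
      (fun p hp => ?_) (letterSubgroup_mono Set.inter_subset_right hw)
    have hpy : p.1 ≠ y := by
      rcases hp with hp | hp <;> rw [hp]
      exacts [hxy, hzy]
    rw [MonoidHom.comp_apply, indexedEval_of, indexedEval_of, map_mul, map_mul, map_inv, map_zpow,
      stableEval_of_self, stableEval_of_ne _ _ _ _ hpy]
    simp [d, hpy]
  refine ⟨ev w, ?_, fun m hm m' hm' hmem => ?_⟩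
  · refine map_letterSubgroup_le_iff.2 (fun p hp => ?_) w
      (letterSubgroup_mono Set.inter_subset_right hw)
    have hy : FreeGroup.of y ∈ letterSubgroup ({x, y, z} : Set X) := of_mem_letterSubgroup (by simp)
    rw [indexedEval_of]
    refine mul_mem (mul_mem (zpow_mem hy _) (of_mem_letterSubgroup ?_)) (inv_mem (zpow_mem hy _))
    rcases hp with hp | hp <;> simp [hp]
  · have hker : stableEval y d t e (m⁻¹ * (ev w * m' * (ev w)⁻¹)) = 1 := by
      have hle : Subgroup.normalClosure {r} ≤ (stableEval y d t e).ker :=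
        Subgroup.normalClosure_le_normal (by simpa using her)
      exact hle hmem
    obtain ⟨h1, h2⟩ := hf m hm
    obtain ⟨h1', h2'⟩ := hf m' hm'
    rw [map_mul, map_mul, map_mul, map_inv, map_inv, inv_mul_eq_one, hfw, h2, h2'] at hker
    have hdeg := congrArg deg hker
    simp only [map_mul, map_inv, hM.deg_l, map_zpow, hM.deg_t, one_mul, inv_one, mul_one] at hdeg
    have hk : (rewriteHom y d m).right.toAdd = (rewriteHom y d m').right.toAdd := by
      simpa [← ofAdd_zsmul] using hdeg
    rw [← hk] at hker
    have h3 := hwc _ h1 _ h1' _ hker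
    rw [h3, mul_one, mul_inv_cancel] at hker
    have h4 := congrArg deg hker
    simp only [map_mul, hM.deg_l, map_zpow, hM.deg_t, one_mul, map_one] at h4
    have h5 : (rewriteHom y d m).right.toAdd = 0 := by simpa [← ofAdd_zsmul] using h4
    rw [h5, zpow_zero, mul_one, hM.ker] at hker
    have h6 := hA _ (letterSubgroup_mono (hZw _ _) h1) hker
    refine rewriteHom_injOn (y := y) (ξ := x) (d := d) (by simp [d])
      (fun p hpy _ => by simp [d, hpy]) hm (SemidirectProduct.ext h6 ?_)
    exact Multiplicative.toAdd.injective h5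

theorem exists_conj_inter_eq_one {X : Type} {r : FreeGroup X} {x y z : X} (hxy : x ≠ y)
    (hzx : z ≠ x) (hzy : z ≠ y) (hx : ¬ ConjInto r {x}ᶜ)
    (hxm : ∀ u ∈ letterSubgroup ({x}ᶜ : Set X),
      FreeGroup.of x * u⁻¹ ∉ Subgroup.normalClosure {r}) :
    ∃ d ∈ letterSubgroup ({x, y, z} : Set X), ∀ m ∈ letterSubgroup ({x}ᶜ : Set X),
      ∀ m' ∈ letterSubgroup ({x}ᶜ : Set X),
        m⁻¹ * (d * m' * d⁻¹) ∈ Subgroup.normalClosure {r} → m = 1 := by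
  obtain ⟨e, hσ, hfix, he, hes⟩ := exists_equiv_expSum_eq_one hzy.symm r
  have hfix' : ∀ p, p ≠ y → p ≠ z → e.symm (FreeGroup.of p) = FreeGroup.of p := fun p h1 h2 => by
    rw [MulEquiv.symm_apply_eq, hfix p h1 h2]
  have hsub : ({y, z} : Set X) ⊆ ({x}ᶜ : Set X) := by
    rintro p (rfl | rfl)
    exacts [hxy.symm, hzx]
  have hpres : ∀ f : FreeGroup X ≃* FreeGroup X,
      (∀ p, p ≠ y → p ≠ z → f (FreeGroup.of p) = FreeGroup.of p) →
      (∀ p ∈ ({y, z} : Set X), f (FreeGroup.of p) ∈ letterSubgroup ({y, z} : Set X)) →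
      ∀ g ∈ letterSubgroup ({x}ᶜ : Set X), f.toMonoidHom g ∈ letterSubgroup ({x}ᶜ : Set X) := by
    intro f h1 h2
    refine map_letterSubgroup_le_iff.2 fun p hp => ?_
    by_cases hpm : p ∈ ({y, z} : Set X)
    · exact letterSubgroup_mono hsub (h2 p hpm)
    · have h3 : p ≠ y ∧ p ≠ z := by simpa [not_or] using hpm
      change f (FreeGroup.of p) ∈ _
      rw [h1 p h3.1 h3.2]
      exact of_mem_letterSubgroup hp
  have hpe := hpres e hfix he
  have hps := hpres e.symm hfix' hes
  obtain ⟨d, hd, hdm⟩ := exists_conj_inter_eq_one_of_expSum (r := e r) hxy hzx hzy hσ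
    (fun ⟨s, hs, hc⟩ => hx ⟨_, hps s hs, by
      have := e.symm.toMonoidHom.map_isConj hc
      simpa using this⟩)
    (fun u hu hmem => hxm _ (hps u hu) (by
      have := map_mem_normalClosure e.symm.toMonoidHom hmem
      simpa [hfix' x hxy hzx.symm] using this))
  refine ⟨e.symm.toMonoidHom d, ?_, fun m hm m' hm' hmem => ?_⟩
  · refine map_letterSubgroup_le_iff.2 (fun p hp => ?_) d hd
    change e.symm (FreeGroup.of p) ∈ _
    rcases hp with rfl | hp
    · rw [hfix' _ hxy hzx.symm]; exact of_mem_letterSubgroup (by simp)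
    · exact letterSubgroup_mono (Set.subset_insert _ _) (hes p hp)
  · have := map_mem_normalClosure e.toMonoidHom hmem
    have h1 := hdm _ (hpe m hm) _ (hpe m' hm') (by simpa using this)
    simpa using h1

theorem exists_magnusHNN_interval {r : FreeGroup ℤ} {n : ℤ} (h0 : ¬ ConjInto r {0}ᶜ)
    (hn : ¬ ConjInto r {n}ᶜ) :
    ∃ (Γ : Type) (_ : Group Γ) (l : FreeGroup ℤ →* Γ) (t : Γ) (deg : Γ →* Multiplicative ℤ)
      (P N : Set Γ), MagnusHNN (Equiv.addRight (1 : ℤ)) (Set.Ico 0 n) (Set.Ioc 0 n) r l t deg P N ∧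
        ∀ w ∈ letterSubgroup (Set.Icc 0 n), conjEval t (l (FreeGroup.of 0)) w = l w := by
  obtain ⟨Γ, _, l, t, deg, P, N, hM⟩ := exists_magnusHNN (Equiv.addRight (1 : ℤ)) (Set.Ico 0 n)
    (Set.Ioc 0 n) (by
      ext i
      simp only [Equiv.coe_addRight, Set.mem_image, Set.mem_Ioc, Set.mem_Ico]
      exact ⟨fun h => ⟨i - 1, by omega, by omega⟩, fun ⟨j, h1, h2⟩ => by omega⟩) r
    (fun g hg => freiheitssatz hn (letterSubgroup_mono (fun i hi hin => by
      rw [hin] at hi; exact lt_irrefl _ hi.2) hg))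
    (fun g hg => freiheitssatz h0 (letterSubgroup_mono (fun i hi hin => by
      rw [hin] at hi; exact lt_irrefl _ hi.1) hg))
  refine ⟨Γ, _, l, t, deg, P, N, hM, fun w hw => eqOn_letterSubgroup (fun i hi => ?_) hw⟩
  rw [conjEval_of]
  have := zpow_conj_of_step (f := fun i => l (FreeGroup.of i)) (t := t) (a := 0) (b := n)
    (fun j h1 h2 => hM.rel j ⟨h1, h2⟩) hi.1 hi.2
  simpa using this

theorem notMem_normalClosure_of_interval {r : FreeGroup ℤ} {n i : ℤ} {S : Set ℤ}
    (hr : r ∈ letterSubgroup (Set.Icc 0 n)) (hi : i ∈ Set.Icc 0 n)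
    (hS : Set.Icc 0 n ∩ {i}ᶜ ⊆ S)
    (h : ∀ u ∈ letterSubgroup S, FreeGroup.of i * u⁻¹ ∉ Subgroup.normalClosure {r}) :
    ∀ u ∈ letterSubgroup ({i}ᶜ : Set ℤ), FreeGroup.of i * u⁻¹ ∉ Subgroup.normalClosure {r} := by
  intro u hu hmem
  have h1 := map_mem_normalClosure (letterRetraction (Set.Icc 0 n)) hmem
  rw [letterRetraction_eq_self hr, map_mul, map_inv, letterRetraction_of_mem hi] at h1
  refine h _ (letterSubgroup_mono hS ?_) h1
  refine map_letterSubgroup_le_iff.2 (fun j hj => ?_) u hu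
  by_cases hjn : j ∈ Set.Icc 0 n
  · rw [letterRetraction_of_mem hjn]; exact of_mem_letterSubgroup ⟨hjn, hj⟩
  · rw [letterRetraction_of_notMem hjn]; exact one_mem _

/-- The case of at least three conjugates. -/
theorem sqUniversal_of_two_le {r : FreeGroup ℤ} {n : ℤ} (hn2 : 2 ≤ n)
    (hr : r ∈ letterSubgroup (Set.Icc 0 n)) (h0 : ¬ ConjInto r {0}ᶜ) (hn : ¬ ConjInto r {n}ᶜ)
    (h0m : ∀ u ∈ letterSubgroup (Set.Ioc 0 n), FreeGroup.of 0 * u⁻¹ ∉ Subgroup.normalClosure {r})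
    (hnm : ∀ u ∈ letterSubgroup (Set.Ico 0 n), FreeGroup.of n * u⁻¹ ∉ Subgroup.normalClosure {r}) :
    SQUniversal (ConjGroup r) := by
  obtain ⟨Γ, _, l, t, deg, P, N, hM, hl⟩ := exists_magnusHNN_interval h0 hn
  obtain ⟨d, hd, hdm⟩ := exists_conj_inter_eq_one (r := r) (x := n) (y := 0) (z := 1) (by omega)
    (by omega) (by omega) hn (notMem_normalClosure_of_interval hr ⟨by omega, le_rfl⟩
      (by rintro i ⟨⟨h1, h2⟩, h3⟩; exact ⟨h1, lt_of_le_of_ne h2 h3⟩) hnm)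
  have hd : d ∈ letterSubgroup (Set.Icc 0 n) := letterSubgroup_mono (by
    rintro i (rfl | rfl | rfl) <;> constructor <;> omega) hd
  have hIco : Set.Ico 0 n ⊆ ({n}ᶜ : Set ℤ) := fun i hi hin => by
    rw [hin] at hi; exact lt_irrefl _ hi.2
  have h0n : FreeGroup.of (0 : ℤ) ∈ letterSubgroup (Set.Icc 0 n) :=
    of_mem_letterSubgroup ⟨le_rfl, by omega⟩
  have hmap : (letterSubgroup (Set.Icc 0 n)).map (conjEval t (l (FreeGroup.of 0))) =
      (letterSubgroup (Set.Icc 0 n)).map l := by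
    ext g
    constructor
    · rintro ⟨w, hw, rfl⟩; exact ⟨w, hw, (hl w hw).symm⟩
    · rintro ⟨w, hw, rfl⟩; exact ⟨w, hw, hl w hw⟩
  obtain ⟨n, rfl⟩ := Int.eq_ofNat_of_zero_le (show 0 ≤ n by omega)
  refine sqUniversal_of_inter_conj_eq_bot (n := n) hM.half (r := r) (d := l d)
    (c := l (FreeGroup.of 0)) (b := l (FreeGroup.of 0)) ?_ hr ?_ ?_ ?_ ?_ ?_ ?_ ?_
  · rw [hl r hr, hM.ker]; exact Subgroup.subset_normalClosure rfl
  · rw [hmap]; rintro _ ⟨w, _, rfl⟩; exact ⟨w, rfl⟩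
  · rw [hmap]; exact Subgroup.map_mono (letterSubgroup_mono Set.Ico_subset_Icc_self)
  · intro hbot
    have h1 : l (FreeGroup.of 0) ∈ (letterSubgroup (Set.Ico (0 : ℤ) n)).map l :=
      ⟨_, of_mem_letterSubgroup ⟨le_rfl, by omega⟩, rfl⟩
    rw [hbot, Subgroup.mem_bot, hM.ker] at h1
    exact FreeGroup.of_ne_one _ (freiheitssatz hn
      (of_mem_letterSubgroup (hIco ⟨le_rfl, by omega⟩)) h1)
  · rw [hmap]; exact ⟨d, hd, rfl⟩
  · rintro _ ⟨m', hm', rfl⟩ ⟨m, hm, he⟩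
    have h1 : m = 1 := hdm m (letterSubgroup_mono hIco hm) m' (letterSubgroup_mono hIco hm') (by
      rw [← hM.ker]
      simp only [map_mul, map_inv]
      exact inv_mul_eq_one.2 he)
    rw [h1, map_one] at he
    simpa using he.symm
  · rw [hmap]; exact ⟨_, h0n, rfl⟩
  · rintro ⟨u, hu, he⟩
    refine h0m u hu ?_
    rw [← hM.ker, map_mul, map_inv, he, mul_inv_cancel]

open scoped commutatorElement

section momentary

variable {T : Type} [Group T]

/-- The evaluation of words at the time `j`, for a sequence of group elements. -/
def timeEval (β : ℤ → T) (j : ℤ) : FreeGroup ℤ →* T :=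
  FreeGroup.lift fun i => β (i + j)

theorem timeEval_of (β : ℤ → T) (i j : ℤ) : timeEval β j (FreeGroup.of i) = β (i + j) :=
  FreeGroup.lift_apply_of

theorem conjEval_lab (β : ℤ → T) (v : FreeGroup ℤ) :
    conjEval (translation T)⁻¹ (lab ℤ T β) v = lab ℤ T fun n => timeEval β n v := by
  let φ : FreeGroup ℤ →* (ℤ → T) := MonoidHom.pi fun n => timeEval β n
  have : conjEval (translation T)⁻¹ (lab ℤ T β) = (lab ℤ T).comp φ := by
    ext1 i
    rw [conjEval_of, inv_zpow', translation_zpow, per_conj_lab, MonoidHom.comp_apply]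
    congr 1
    funext n
    change β _ = timeEval β n (FreeGroup.of i)
    rw [timeEval_of]
    simp [add_comm]
  exact DFunLike.congr_fun this v

/-- The values at the time `0` of the words that are trivial at all other times. -/
def momentary (β : ℤ → T) : Subgroup T where
  carrier := {γ | ∃ v, timeEval β 0 v = γ ∧ ∀ j ≠ 0, timeEval β j v = 1}
  one_mem' := ⟨1, by simp, by simp⟩
  mul_mem' := by
    rintro _ _ ⟨v, rfl, hv⟩ ⟨w, rfl, hw⟩
    exact ⟨v * w, map_mul _ _ _, fun j hj => by rw [map_mul, hv j hj, hw j hj, one_mul]⟩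
  inv_mem' := by
    rintro _ ⟨v, rfl, hv⟩
    exact ⟨v⁻¹, map_inv _ _, fun j hj => by rw [map_inv, hv j hj, inv_one]⟩

theorem momentary_le_range (β : ℤ → T) : momentary β ≤ (timeEval β 0).range := by
  rintro _ ⟨v, rfl, -⟩
  exact ⟨v, rfl⟩

theorem conj_mem_momentary {β : ℤ → T} {γ g : T} (hγ : γ ∈ momentary β)
    (hg : g ∈ (timeEval β 0).range) : g * γ * g⁻¹ ∈ momentary β := by
  obtain ⟨v, rfl, hv⟩ := hγ
  obtain ⟨w, rfl⟩ := hg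
  exact ⟨w * v * w⁻¹, by simp, fun j hj => by simp [hv j hj]⟩

theorem commutator_mem_momentary {β : ℤ → T} {γ g : T} (hγ : γ ∈ momentary β)
    (hg : g ∈ (timeEval β 0).range) : ⁅γ, g⁆ ∈ momentary β := by
  rw [commutatorElement_def, mul_assoc, mul_assoc, ← mul_assoc g]
  exact mul_mem hγ (conj_mem_momentary (inv_mem hγ) hg)

theorem exists_embedding_of_momentary {r : FreeGroup ℤ} {β : ℤ → T} (hr : ∀ j, timeEval β j r = 1)
    {C : Type} [Group C] (ι : C →* T) (hι : Function.Injective ι) (h : ∀ c, ι c ∈ momentary β) :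
    ∃ (N : Subgroup (ConjGroup r)) (_ : N.Normal), ∃ f : C →* ConjGroup r ⧸ N,
      Function.Injective f := by
  obtain ⟨Ψ, ht, hb⟩ := ConjGroup.exists_hom (r := r) (T := (translation T)⁻¹) (B := lab ℤ T β) (by
    rw [conjEval_lab, ← map_one (lab ℤ T)]
    congr 1
    funext n
    exact hr n)
  refine exists_embedding_quotient Ψ ((pointLabel T).comp ι) ((pointLabel_injective T).comp hι)
    fun c => ?_
  obtain ⟨v, hv0, hv⟩ := h c
  refine ⟨conjEval (ConjGroup.t r) (ConjGroup.b r) v, ?_⟩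
  rw [map_conjEval, ht, hb, conjEval_lab]
  change _ = lab ℤ T (Pi.mulSingle 0 (ι c))
  congr 1
  funext n
  by_cases hn : n = 0
  · subst hn
    rw [hv0, Pi.mulSingle_eq_same]
  · rw [hv n hn, Pi.mulSingle_eq_of_ne hn]

/-- A criterion for SQ-universality: for all prescribed values `x` and `y`, one finds a momentary
labelling and a labelling with these values on the intersection of their supports. -/
theorem sqUniversal_of_labels {r : FreeGroup ℤ}
    (h : ∀ (E : Type) [Group E] (x y : E), ∃ (Ω : Type) (β : ℤ → Equiv.Perm (Ω × E)) (F G : Ω → E)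
      (I : Set Ω), (∀ j, timeEval β j r = 1) ∧ lab Ω E F ∈ momentary β ∧
        lab Ω E G ∈ (timeEval β 0).range ∧ I.Nonempty ∧ (∀ ω ∈ I, F ω = x ∧ G ω = y) ∧
        ∀ ω ∉ I, F ω = 1 ∨ G ω = 1) :
    SQUniversal (ConjGroup r) := by
  classical
  intro C _ _
  obtain ⟨E, _, x, y, ι, hι, hxy, -, -, hC⟩ := exists_two_generator_embedding C
  obtain ⟨Ω, β, F, G, I, hr, hF, hG, ⟨o, ho⟩, hI, hI'⟩ := h E x y
  let δ : E →* Equiv.Perm (Ω × E) := (lab Ω E).comp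
    { toFun := fun e ω => if ω ∈ I then e else 1
      map_one' := by funext ω; simp
      map_mul' := fun a b => by funext ω; by_cases hω : ω ∈ I <;> simp [hω] }
  have hδ' : ∀ e, δ e = lab Ω E fun ω => if ω ∈ I then e else 1 := fun _ => rfl
  have hδ : Function.Injective δ := by
    intro a b hab
    have := congrFun (lab_injective hab) o
    simpa [ho] using this
  let M := (momentary β).comap δ
  have key : ∀ (L : Ω → E) (z : E), lab Ω E L ∈ (timeEval β 0).range → (∀ ω ∈ I, L ω = z) →
      ∀ e ∈ M, z * e * z⁻¹ ∈ M := by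
    intro L z hL hz e he
    have h1 := conj_mem_momentary he hL
    change δ _ ∈ momentary β
    convert h1 using 1
    rw [hδ', hδ', ← map_inv, ← map_mul, ← map_mul]
    congr 1
    funext ω
    by_cases hω : ω ∈ I <;> simp [hω, hz]
  have key' : ∀ (L : Ω → E) (z : E), lab Ω E L ∈ (timeEval β 0).range → (∀ ω ∈ I, L ω = z) →
      z ∈ Subgroup.normalizer (M : Set E) := by
    intro L z hL hz
    rw [Subgroup.mem_normalizer_iff]
    refine fun e => ⟨key L z hL hz e, fun he => ?_⟩
    have := key L⁻¹ z⁻¹ (by rw [map_inv]; exact inv_mem hL) (fun ω hω => by simp [hz ω hω]) _ he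
    simpa [mul_assoc] using this
  have hM : M.Normal := by
    rw [← Subgroup.normalizer_eq_top_iff, eq_top_iff, ← hxy, Subgroup.closure_le]
    rintro z (rfl | rfl)
    · exact key' F _ (momentary_le_range β hF) fun ω hω => (hI ω hω).1
    · exact key' G _ hG fun ω hω => (hI ω hω).2
  have hcomm : ⁅x, y⁆ ∈ M := by
    have h1 := commutator_mem_momentary hF hG
    change δ _ ∈ momentary β
    convert h1 using 1
    rw [hδ', commutatorElement_def, commutatorElement_def, ← map_inv, ← map_inv, ← map_mul,
      ← map_mul, ← map_mul]
    congr 1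
    funext ω
    by_cases hω : ω ∈ I
    · simp [hω, hI ω hω]
    · rcases hI' ω hω with h2 | h2 <;> simp [hω, h2]
  refine exists_embedding_of_momentary hr (δ.comp ι) (hδ.comp hι) fun c => ?_
  exact Subgroup.normalClosure_le_normal (N := M) (by simpa using hcomm) (hC c)

end momentary

/-- The commutator of a permutation twisted by a labelling with a commuting permutation. -/
theorem commutator_conj_per {Ω G : Type} [Group G] {π ρ : Equiv.Perm Ω} (h : Commute π ρ)
    (F : Ω → G) :
    ⁅lab Ω G F * per Ω G π * (lab Ω G F)⁻¹, per Ω G ρ⁆ = lab Ω G fun ω =>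
      F ω * (F (π.symm ω))⁻¹ * F (π.symm (ρ.symm ω)) * (F (ρ.symm ω))⁻¹ := by
  have h1 := per_conj_lab (G := G) π F⁻¹
  have h2 := per_conj_lab (G := G) (ρ * π) F
  have h3 := per_conj_lab (G := G) ρ F⁻¹
  have hc : per Ω G π * per Ω G ρ = per Ω G ρ * per Ω G π := by rw [← map_mul, h.eq, map_mul]
  have e : (lab Ω G fun ω => F ω * (F (π.symm ω))⁻¹ * F (π.symm (ρ.symm ω)) * (F (ρ.symm ω))⁻¹) =
      lab Ω G F * lab Ω G (F⁻¹ ∘ π.symm) * lab Ω G (F ∘ (ρ * π).symm) *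
        lab Ω G (F⁻¹ ∘ ρ.symm) := by
    rw [← map_mul, ← map_mul, ← map_mul]
    rfl
  rw [e, ← h1, ← h2, ← h3, commutatorElement_def, map_mul, map_inv]
  generalize per Ω G π = p at *
  generalize per Ω G ρ = q at *
  generalize lab Ω G F = f at *
  have hc' : p⁻¹ * q * p = q := by rw [mul_assoc, ← hc, inv_mul_cancel_left]
  have hc2 : q⁻¹ * p⁻¹ = p⁻¹ * q⁻¹ := by rw [← mul_inv_rev, hc, mul_inv_rev]
  calc f * p * f⁻¹ * q * (f * p * f⁻¹)⁻¹ * q⁻¹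
      = f * p * f⁻¹ * (p⁻¹ * q * p) * f * p⁻¹ * f⁻¹ * q⁻¹ := by rw [hc']; group
    _ = f * (p * f⁻¹ * p⁻¹) * (q * p * f * (q * p)⁻¹) * (q * f⁻¹ * q⁻¹) := by
      rw [mul_inv_rev]; group

open scoped commutatorElement

theorem commutator_conj_translate {Ω G : Type} [AddCommGroup Ω] [Group G] (F : Ω → G) (a b : Ω) :
    ⁅lab Ω G F * per Ω G (Equiv.addRight a) * (lab Ω G F)⁻¹, per Ω G (Equiv.addRight b)⁆ =
      lab Ω G fun ω => F ω * (F (ω - a))⁻¹ * F (ω - b - a) * (F (ω - b))⁻¹ := by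
  have h : Commute (Equiv.addRight a) (Equiv.addRight b) := by
    ext ω
    simp [add_right_comm]
  rw [commutator_conj_per h]
  simp [sub_eq_add_neg]

theorem addRight_zpow {Ω : Type} [AddCommGroup Ω] (a : Ω) (k : ℤ) :
    Equiv.addRight a ^ k = Equiv.addRight (k • a) := by
  let f : Multiplicative Ω →* Equiv.Perm Ω :=
    { toFun := fun z => Equiv.addRight z.toAdd
      map_one' := by ext; simp
      map_mul' := fun z z' => by ext; simp [add_left_comm, add_comm] }
  exact (map_zpow f (Multiplicative.ofAdd a) k).symm

theorem map_eq_zpow_expSum {G : Type} [Group G] (f : FreeGroup ℤ →* G) {S : Set ℤ} {i : ℤ}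
    (hf : ∀ j ∈ S, j ≠ i → f (FreeGroup.of j) = 1) {g : FreeGroup ℤ} (hg : g ∈ letterSubgroup S) :
    f g = f (FreeGroup.of i) ^ (expSum i g).toAdd := by
  refine eqOn_letterSubgroup (f := f) (f' := (zpowersHom G (f (FreeGroup.of i))).comp (expSum i))
    (fun j hj => ?_) hg
  by_cases hji : j = i
  · subst hji
    simp [expSum_of_self, zpowersHom_apply]
  · rw [hf j hj hji, MonoidHom.comp_apply, expSum_of_ne hji]
    simp

theorem timeEval_eq_one_of_pow {T : Type} [Group T] {β : ℤ → T} {r : FreeGroup ℤ} {S : Set ℤ}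
    {d : ℕ} (hr : r ∈ letterSubgroup S) (hσ : ∀ i, (d : ℤ) ∣ (expSum i r).toAdd)
    (hd : ∀ j, β j ^ d = 1)
    {j : ℤ} (h : ∀ i ∈ S, ∀ i' ∈ S, β (i + j) ≠ 1 → β (i' + j) ≠ 1 → i = i') :
    timeEval β j r = 1 := by
  obtain ⟨i, hi⟩ : ∃ i, ∀ i' ∈ S, i' ≠ i → β (i' + j) = 1 := by
    by_cases hS : ∃ i ∈ S, β (i + j) ≠ 1
    · obtain ⟨i, hi, hi1⟩ := hS
      exact ⟨i, fun i' hi' hne => by_contra fun hn => hne (h i' hi' i hi hn hi1)⟩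
    · push Not at hS
      exact ⟨0, fun i' hi' _ => hS i' hi'⟩
  rw [map_eq_zpow_expSum (i := i) (timeEval β j) (fun i' hi' hne => by
    rw [timeEval_of, hi i' hi' hne]) hr, timeEval_of]
  obtain ⟨z, hz⟩ := hσ i
  rw [hz, zpow_mul, zpow_natCast, hd, one_zpow]

/-- The square of the square of the integers modulo `d`. -/
abbrev ResidueSpace (d : ℕ) : Type := (ZMod d × ZMod d) × (ZMod d × ZMod d)

/-- A relator all of whose exponent sums have a common divisor. -/
theorem sqUniversal_of_dvd {r : FreeGroup ℤ} {n : ℤ} {d : ℕ} (hd : 2 ≤ d)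
    (hr : r ∈ letterSubgroup (Set.Icc 0 n)) (hσ : ∀ i, (d : ℤ) ∣ (expSum i r).toAdd) :
    SQUniversal (ConjGroup r) := by
  refine sqUniversal_of_labels fun E _ x y => ?_
  have : Fact (1 < d) := ⟨hd⟩
  have hA : (1 : ZMod d) ≠ 0 := one_ne_zero
  let F : E → ResidueSpace d → E := fun e ω => open Classical in if ω = 0 then e else 1
  have hF : ∀ e ω, ω ≠ 0 → F e ω = 1 := fun e ω h => if_neg h
  have hF0 : ∀ e, F e 0 = e := fun e => if_pos rfl
  let D : E → ResidueSpace d → ResidueSpace d → ResidueSpace d → E := fun e a b ω =>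
    F e ω * (F e (ω - a))⁻¹ * F e (ω - b - a) * (F e (ω - b))⁻¹
  obtain ⟨N, hN, hN1⟩ : ∃ N : ℤ, n < N ∧ 0 < N := ⟨max n 0 + 1, by omega, by omega⟩
  let τ : ResidueSpace d → Equiv.Perm (ResidueSpace d × E) :=
    fun a => per (ResidueSpace d) E (Equiv.addRight a)
  let e₁ : ResidueSpace d := ((1, 0), 0)
  let e₂ : ResidueSpace d := ((0, 1), 0)
  let e₃ : ResidueSpace d := (0, (1, 0))
  let e₄ : ResidueSpace d := (0, (0, 1))
  let β : ℤ → Equiv.Perm (ResidueSpace d × E) := fun j =>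
    if j = 0 then lab (ResidueSpace d) E (F x) * τ e₁ * (lab (ResidueSpace d) E (F x))⁻¹ else
    if j = N then τ e₂ else
    if j = 3 * N then lab (ResidueSpace d) E (F y) * τ e₃ * (lab (ResidueSpace d) E (F y))⁻¹ else
    if j = 7 * N then τ e₄ else 1
  have hβ : ∀ j, β j ≠ 1 → j = 0 ∨ j = N ∨ j = 3 * N ∨ j = 7 * N := by
    intro j hj
    by_contra h
    push Not at h
    exact hj (by simp [β, h])
  have b0 : β 0 = lab (ResidueSpace d) E (F x) * τ e₁ * (lab (ResidueSpace d) E (F x))⁻¹ :=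
    if_pos rfl
  have b1 : β N = τ e₂ := by
    exact (if_neg (by omega)).trans (if_pos rfl)
  have b2 : β (3 * N) = lab (ResidueSpace d) E (F y) * τ e₃ * (lab (ResidueSpace d) E (F y))⁻¹ := by
    exact (if_neg (by omega)).trans ((if_neg (by omega)).trans (if_pos rfl))
  have b3 : β (7 * N) = τ e₄ := by
    exact (if_neg (by omega)).trans ((if_neg (by omega)).trans
      ((if_neg (by omega)).trans (if_pos rfl)))
  have hτ : ∀ a, τ a ^ d = 1 := by
    intro a
    have : d • a = 0 := by
      ext <;> simp
    simp only [τ]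
    rw [← map_pow, ← zpow_natCast, addRight_zpow, natCast_zsmul, this]
    simp
  have hd1 : ∀ j, β j ^ d = 1 := by
    intro j
    by_cases hj : β j = 1
    · rw [hj, one_pow]
    · rcases hβ j hj with h | h | h | h
      · rw [h, b0, conj_pow, hτ]; simp
      · rw [h, b1, hτ]
      · rw [h, b2, conj_pow, hτ]; simp
      · rw [h, b3, hτ]
  have hcomm : ∀ a b : ℤ, (∀ j, j ≠ 0 → β (a + j) = 1 ∨ β (b + j) = 1) →
      ⁅β a, β b⁆ ∈ momentary β := by
    intro a b h
    refine ⟨⁅FreeGroup.of a, FreeGroup.of b⁆, ?_, fun j hj => ?_⟩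
    · rw [map_commutatorElement, timeEval_of, timeEval_of, add_zero, add_zero]
    · rw [map_commutatorElement, timeEval_of, timeEval_of]
      rcases h j hj with h | h <;> simp [h]
  have hsep : ∀ a b : ℤ, (a = 0 ∧ b = N ∨ a = 3 * N ∧ b = 7 * N) →
      ∀ j, j ≠ 0 → β (a + j) = 1 ∨ β (b + j) = 1 := by
    intro a b hab j hj
    by_contra h
    push Not at h
    have h1 := hβ _ h.1
    have h2 := hβ _ h.2
    omega
  have m1 := hcomm 0 N (hsep _ _ (by simp))
  have m2 := hcomm (3 * N) (7 * N) (hsep _ _ (by simp))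
  rw [b0, b1, commutator_conj_translate] at m1
  rw [b2, b3, commutator_conj_translate] at m2
  refine ⟨ResidueSpace d, β, D x e₁ e₂, D y e₃ e₄, {0}, fun j => ?_, m1,
    momentary_le_range β m2, ⟨0, rfl⟩,
    ?_, ?_⟩
  · refine timeEval_eq_one_of_pow hr hσ hd1 fun i hi i' hi' h1 h2 => ?_
    have h1 := hβ _ h1
    have h2 := hβ _ h2
    obtain ⟨h3, h4⟩ := hi
    obtain ⟨h5, h6⟩ := hi'
    omega
  · rintro _ rfl
    have ne : ∀ a b : ResidueSpace d, a ≠ 0 → b ≠ 0 → a + b ≠ 0 → ∀ e, D e a b 0 = e := by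
      intro a b ha hb hab e
      simp only [D]
      rw [hF0, hF _ (0 - a) (by simpa using ha), hF _ (0 - b) (by simpa using hb),
        hF _ (0 - b - a) (by
          intro h; apply hab; rw [zero_sub, sub_eq_zero] at h; rw [← h]; simp)]
      simp
    constructor
    · refine ne _ _ ?_ ?_ ?_ x <;> simp [e₁, e₂, Prod.ext_iff, hA]
    · refine ne _ _ ?_ ?_ ?_ y <;> simp [e₃, e₄, Prod.ext_iff, hA]
  · intro ω hω
    have hω : ω.2 ≠ 0 ∨ ω.1 ≠ 0 := by
      by_contra h
      push Not at h
      exact hω (Prod.ext h.2 h.1)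
    rcases hω with h | h
    · left
      simp only [D]
      rw [hF, hF, hF, hF]
      · simp
      all_goals exact fun hz => h (by simpa [e₁, e₂] using congrArg Prod.snd hz)
    · right
      simp only [D]
      rw [hF, hF, hF, hF]
      · simp
      all_goals exact fun hz => h (by simpa [e₃, e₄] using congrArg Prod.fst hz)

open scoped commutatorElement

/-- The rationals modulo one. -/
abbrev RatCircle : Type := AddCircle (1 : ℚ)

theorem ratCircle_coe_div_eq_zero_iff {a b : ℤ} (hb : b ≠ 0) :
    (((a / b : ℚ) : ℚ) : RatCircle) = 0 ↔ b ∣ a := by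
  have hb' : (b : ℚ) ≠ 0 := Int.cast_ne_zero.2 hb
  rw [AddCircle.coe_eq_zero_iff]
  constructor
  · rintro ⟨n, hn⟩
    refine ⟨n, ?_⟩
    have : (a : ℚ) = b * n := by
      rw [eq_div_iff hb'] at hn
      rw [← hn]
      simp [mul_comm]
    exact_mod_cast this
  · rintro ⟨n, rfl⟩
    refine ⟨n, ?_⟩
    push_cast
    field_simp
    simp

theorem not_sq_dvd_of_isCoprime {p q m : ℤ} (h : IsCoprime p q) (hq : 2 ≤ |q|) (k : ℕ)
    (hm : m ≠ 0) (hm2 : |m| ≤ 2) : ¬ q ^ 2 ∣ m * p ^ k := by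
  intro hd
  have hc : IsCoprime (q ^ 2) (p ^ k) := h.symm.pow
  have h1 := Int.le_of_dvd (abs_pos.2 hm) ((dvd_abs _ _).2 (hc.dvd_of_dvd_mul_right hd))
  rw [← sq_abs] at h1
  nlinarith

theorem not_sq_dvd_sub_of_isCoprime {p q : ℤ} (h : IsCoprime p q) (hq : 2 ≤ |q|) :
    ¬ q ^ 2 ∣ q - p := by
  intro hd
  have h1 : q ∣ p := by
    have h2 : q ∣ q - p := (dvd_pow_self q two_ne_zero).trans hd
    have := dvd_sub (dvd_refl q) h2
    simpa using this
  have h2 := Int.isUnit_iff.1 (h.isUnit_of_dvd' h1 dvd_rfl)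
  rcases h2 with rfl | rfl <;> simp at hq

theorem commutator_label_support {Ω G : Type} [AddCommGroup Ω] [Group G] {F : Ω → G} {a b ω : Ω}
    (h : F ω * (F (ω - a))⁻¹ * F (ω - b - a) * (F (ω - b))⁻¹ ≠ 1) :
    ∃ s, (s = 0 ∨ s = b) ∧ ∃ s', (s' = 0 ∨ s' = a) ∧ F (ω - s - s') ≠ 1 := by
  by_contra hn
  push Not at hn
  refine h ?_
  have h1 := hn 0 (Or.inl rfl) 0 (Or.inl rfl)
  have h2 := hn 0 (Or.inl rfl) a (Or.inr rfl)
  have h3 := hn b (Or.inr rfl) 0 (Or.inl rfl)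
  have h4 := hn b (Or.inr rfl) a (Or.inr rfl)
  simp only [sub_zero] at h1 h2 h3
  simp [h1, h2, h3, h4]

/-- A Baumslag-Solitar type relator with coprime exponents, neither of which is a unit. -/
theorem sqUniversal_of_isCoprime {r : FreeGroup ℤ} {p q : ℤ} (hr : r ∈ letterSubgroup (Set.Icc 0 1))
    (hpq : IsCoprime p q) (hp : 2 ≤ |p|) (hq : 2 ≤ |q|) (h0 : (expSum 0 r).toAdd = q)
    (h1 : (expSum 1 r).toAdd = -p) : SQUniversal (ConjGroup r) := by
  refine sqUniversal_of_labels fun E _ x y => ?_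
  have hp0 : p ≠ 0 := by rintro rfl; simp at hp
  have hq0 : q ≠ 0 := by rintro rfl; simp at hq
  have hpQ : (p : ℚ) ≠ 0 := Int.cast_ne_zero.2 hp0
  have hqQ : (q : ℚ) ≠ 0 := Int.cast_ne_zero.2 hq0
  obtain ⟨g, hg⟩ : ∃ g : RatCircle, g = ((1 / q : ℚ) : RatCircle) := ⟨_, rfl⟩
  obtain ⟨l, hl⟩ : ∃ l : RatCircle, l = ((p / q ^ 2 : ℚ) : RatCircle) := ⟨_, rfl⟩
  obtain ⟨z, hz⟩ : ∃ z : RatCircle, z = ((p ^ 3 / q ^ 4 : ℚ) : RatCircle) := ⟨_, rfl⟩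
  obtain ⟨h, hh⟩ : ∃ h : RatCircle, h = ((1 / p : ℚ) : RatCircle) := ⟨_, rfl⟩
  obtain ⟨k, hk⟩ : ∃ k : RatCircle, k = ((q / p ^ 2 : ℚ) : RatCircle) := ⟨_, rfl⟩
  have hg0 : g ≠ 0 := by
    intro hn
    rw [hg] at hn
    have := (ratCircle_coe_div_eq_zero_iff (a := 1) hq0).1 (by exact_mod_cast hn)
    rcases Int.isUnit_iff.1 (isUnit_of_dvd_one this) with rfl | rfl <;> simp at hq
  have hh0 : h ≠ 0 := by
    intro hn
    rw [hh] at hn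
    have := (ratCircle_coe_div_eq_zero_iff (a := 1) hp0).1 (by exact_mod_cast hn)
    rcases Int.isUnit_iff.1 (isUnit_of_dvd_one this) with rfl | rfl <;> simp at hp
  have hl0 : l ≠ 0 := by
    intro hn
    rw [hl] at hn
    have := (ratCircle_coe_div_eq_zero_iff (a := p) (pow_ne_zero 2 hq0)).1 (by exact_mod_cast hn)
    exact not_sq_dvd_of_isCoprime hpq hq 1 one_ne_zero (by simp) (by simpa using this)
  have hk0 : k ≠ 0 := by
    intro hn
    rw [hk] at hn
    have := (ratCircle_coe_div_eq_zero_iff (a := q) (pow_ne_zero 2 hp0)).1 (by exact_mod_cast hn)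
    exact not_sq_dvd_of_isCoprime hpq.symm hp 1 one_ne_zero (by simp) (by simpa using this)
  have hgl : g ≠ l := by
    intro hn
    rw [← sub_eq_zero, hg, hl, ← AddCircle.coe_sub] at hn
    refine not_sq_dvd_sub_of_isCoprime hpq hq
      ((ratCircle_coe_div_eq_zero_iff (pow_ne_zero 2 hq0)).1 ?_)
    rw [← hn]
    congr 1
    push_cast
    field_simp
  have hhk : h ≠ k := by
    intro hn
    rw [← sub_eq_zero, hh, hk, ← AddCircle.coe_sub] at hn
    refine not_sq_dvd_sub_of_isCoprime hpq.symm hp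
      ((ratCircle_coe_div_eq_zero_iff (pow_ne_zero 2 hp0)).1 ?_)
    rw [← hn]
    congr 1
    push_cast
    field_simp
  have hqg : (q ^ 2) • g = 0 := by
    rw [hg, ← AddCircle.coe_zsmul, AddCircle.coe_eq_zero_iff]
    exact ⟨q, by simp; field_simp⟩
  have hql : (q ^ 2) • l = 0 := by
    rw [hl, ← AddCircle.coe_zsmul, AddCircle.coe_eq_zero_iff]
    exact ⟨p, by simp; field_simp⟩
  have hz0 : ∀ m : ℤ, m ≠ 0 → |m| ≤ 2 → ∀ s : RatCircle, (q ^ 2) • s = 0 → m • z ≠ s := by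
    rintro m hm hm2 s hs rfl
    rw [hz, ← mul_smul, ← AddCircle.coe_zsmul] at hs
    refine not_sq_dvd_of_isCoprime hpq hq 3 hm hm2
      ((ratCircle_coe_div_eq_zero_iff (pow_ne_zero 2 hq0)).1 ?_)
    rw [← hs]
    congr 1
    simp
    field_simp
  obtain ⟨F, hF0, hFz, hF1⟩ : ∃ F : RatCircle × RatCircle → E, F (0, 0) = y ∧ F (z, 0) = x ∧
      ∀ ω, F ω ≠ 1 → ω = (0, 0) ∨ ω = (z, 0) := by
    classical
    have hz' : z ≠ 0 := by simpa using hz0 1 one_ne_zero (by simp) 0 (by simp)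
    refine ⟨fun ω => if ω = (0, 0) then y else if ω = (z, 0) then x else 1, if_pos rfl,
      (if_neg (by simpa using hz')).trans (if_pos rfl), fun ω hω => ?_⟩
    by_contra hn
    push Not at hn
    exact hω ((if_neg hn.1).trans (if_neg hn.2))
  let τ : RatCircle × RatCircle → Equiv.Perm ((RatCircle × RatCircle) × E) :=
    fun a => per (RatCircle × RatCircle) E (Equiv.addRight a)
  have hτ : ∀ a (m : ℤ), τ a ^ m = τ (m • a) := fun a m => by
    simp only [τ]
    rw [← map_zpow, addRight_zpow]
  have hτ0 : τ (0, 0) = 1 := by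
    have h := (hτ 0 0).symm
    rwa [zero_smul, zpow_zero] at h
  have hτc : ∀ a b, Commute (τ a) (τ b) := fun a b => by
    refine Commute.map (f := per (RatCircle × RatCircle) E) ?_
    ext ω <;> simp [add_right_comm]
  let cL : ℤ → ℚ := fun j => ((q / p : ℚ) ^ j) / q
  let cR : ℤ → ℚ := fun j => ((q / p : ℚ) ^ (j - 1)) / p
  have hqp : (q / p : ℚ) ≠ 0 := div_ne_zero hqQ hpQ
  have hcL : ∀ j, q • (cL j : RatCircle) = p • (cL (j + 1) : RatCircle) := fun j => by
    rw [← AddCircle.coe_zsmul, ← AddCircle.coe_zsmul, zsmul_eq_mul, zsmul_eq_mul]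
    simp only [cL]
    rw [zpow_add_one₀ hqp]
    field_simp
  have hcR : ∀ j, q • (cR j : RatCircle) = p • (cR (j + 1) : RatCircle) := fun j => by
    rw [← AddCircle.coe_zsmul, ← AddCircle.coe_zsmul, zsmul_eq_mul, zsmul_eq_mul]
    simp only [cR]
    rw [show j + 1 - 1 = j - 1 + 1 by ring, zpow_add_one₀ hqp]
    field_simp
  let Λ := lab (RatCircle × RatCircle) E F
  let ξ : ℤ → Equiv.Perm ((RatCircle × RatCircle) × E) := fun j =>
    if j ≤ 0 then τ ((cL j : RatCircle), 0) else Λ * τ (0, (cR j : RatCircle)) * Λ⁻¹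
  have ξL : ∀ j ≤ 0, ξ j = τ ((cL j : RatCircle), 0) := fun j hj => if_pos hj
  have ξR : ∀ j, 0 < j → ξ j = Λ * τ (0, (cR j : RatCircle)) * Λ⁻¹ := fun j hj =>
    if_neg (not_le.2 hj)
  have hcL0 : q • ((cL 0 : ℚ) : RatCircle) = 0 := by
    rw [← AddCircle.coe_zsmul, AddCircle.coe_eq_zero_iff]
    exact ⟨1, by simp [cL]; field_simp⟩
  have hcR1 : p • ((cR 1 : ℚ) : RatCircle) = 0 := by
    rw [← AddCircle.coe_zsmul, AddCircle.coe_eq_zero_iff]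
    exact ⟨1, by simp [cR]; field_simp⟩
  have hξ : ∀ j, ξ j ^ q = ξ (j + 1) ^ p := by
    intro j
    rcases lt_trichotomy j 0 with hj | rfl | hj
    · rw [ξL j hj.le, ξL (j + 1) (by omega), hτ, hτ]
      simp [hcL]
    · rw [ξL 0 le_rfl, ξR (0 + 1) (by omega), conj_zpow, hτ, hτ]
      simp only [Prod.smul_mk, hcL0, zero_add, hcR1, smul_zero]
      rw [hτ0]
      simp
    · rw [ξR j hj, ξR (j + 1) (by omega), conj_zpow, conj_zpow, hτ, hτ]
      simp [hcR]
  let β : ℤ → Equiv.Perm ((RatCircle × RatCircle) × E) := fun j => ξ j ^ p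
  obtain ⟨u, v, huv⟩ := hpq
  have hX : ∀ i j, timeEval β j (FreeGroup.of i ^ u * FreeGroup.of (i + 1) ^ v) = ξ (i + j) := by
    intro i j
    rw [map_mul, map_zpow, map_zpow, timeEval_of, timeEval_of, show i + 1 + j = i + j + 1 by ring]
    simp only [β]
    rw [← hξ, ← zpow_mul, ← zpow_mul, ← zpow_add, mul_comm p, mul_comm q, huv, zpow_one]
  have hrange : ∀ i, ξ i ∈ (timeEval β 0).range := fun i => ⟨_, by rw [hX i 0, add_zero]⟩
  have hrel : ∀ j, timeEval β j r = 1 := by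
    intro j
    let f : FreeGroup ℤ →* Multiplicative ℤ :=
      FreeGroup.lift fun i => Multiplicative.ofAdd (if i = 0 then p else q)
    have h01 : ∀ i ∈ Set.Icc (0 : ℤ) 1, i = 0 ∨ i = 1 := fun i hi => by
      obtain ⟨h3, h4⟩ := hi
      omega
    have h2 : timeEval β j r = (zpowersHom _ (ξ j)).comp f r := by
      refine eqOn_letterSubgroup (f := timeEval β j) (f' := (zpowersHom _ (ξ j)).comp f)
        (fun i hi => ?_) hr
      rcases h01 i hi with rfl | rfl
      · simp [timeEval_of, f, β, zpowersHom_apply]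
      · simp [timeEval_of, f, β, zpowersHom_apply, add_comm 1 j, hξ]
    have h3 : f r = 1 := by
      rw [hom_apply_eq_expSum (u := (0 : ℤ)) (v := 1) zero_ne_one
        (letterSubgroup_mono (fun i hi => h01 i hi) hr)]
      apply Multiplicative.toAdd.injective
      simp [f, h0, h1]
      ring
    rw [h2, MonoidHom.comp_apply, h3, map_one]
  have hmom : ⁅ξ 1, ξ 0⁆ ∈ momentary β := by
    refine ⟨⁅FreeGroup.of (1 : ℤ) ^ u * FreeGroup.of ((1 : ℤ) + 1) ^ v,
      FreeGroup.of (0 : ℤ) ^ u * FreeGroup.of ((0 : ℤ) + 1) ^ v⁆, ?_, fun j hj => ?_⟩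
    · rw [map_commutatorElement, hX, hX, add_zero, add_zero]
    · rw [map_commutatorElement, hX, hX, commutatorElement_eq_one_iff_commute, zero_add]
      rcases lt_or_gt_of_ne hj with hj | hj
      · rw [ξL _ (by omega), ξL _ (by omega)]
        exact hτc _ _
      · rw [ξR _ (by omega), ξR _ (by omega)]
        exact (hτc _ _).conj _
  have hrg : ξ (-3) * ⁅ξ 2, ξ (-1)⁆ * (ξ (-3))⁻¹ ∈ (timeEval β 0).range := by
    have h2 := hrange 2
    have h3 := hrange (-1)
    have h4 := hrange (-3)
    rw [commutatorElement_def]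
    exact mul_mem (mul_mem h4 (mul_mem (mul_mem (mul_mem h2 h3) (inv_mem h2)) (inv_mem h3)))
      (inv_mem h4)
  have e1 : ξ 1 = Λ * τ (0, h) * Λ⁻¹ := by
    rw [ξR 1 one_pos, hh]; simp [cR]
  have e0 : ξ 0 = τ (g, 0) := by
    rw [ξL 0 le_rfl, hg]; simp [cL]
  have e2 : ξ 2 = Λ * τ (0, k) * Λ⁻¹ := by
    rw [ξR 2 two_pos, hk]
    congr 5
    simp only [cR]
    norm_num
    field_simp
  have em1 : ξ (-1) = τ (l, 0) := by
    rw [ξL _ (by omega), hl]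
    congr 3
    simp only [cL]
    rw [zpow_neg_one]
    field_simp
  have em3 : ξ (-3) = τ (z, 0) := by
    rw [ξL _ (by omega), hz]
    congr 3
    simp only [cL]
    rw [zpow_neg, show (3 : ℤ) = ((3 : ℕ) : ℤ) by rfl, zpow_natCast]
    field_simp
  rw [e1, e0] at hmom
  rw [e2, em1, em3] at hrg
  simp only [τ, Λ] at hmom hrg
  rw [commutator_conj_translate] at hmom hrg
  rw [per_conj_lab] at hrg
  have hF : ∀ ω, ω ≠ (0, 0) → ω ≠ (z, 0) → F ω = 1 := fun ω h2 h3 => by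
    by_contra hn
    exact (hF1 ω hn).elim h2 h3
  refine ⟨RatCircle × RatCircle, β, _, _, {(z, 0)}, hrel, hmom, hrg, ⟨_, rfl⟩, ?_, ?_⟩
  · have hzs : ∀ s : RatCircle, (q ^ 2) • s = 0 → z ≠ s := fun s hs => by
      simpa using hz0 1 one_ne_zero (by simp) s hs
    rintro _ rfl
    constructor
    · have a1 : F ((z, 0) - (0, h)) = 1 := hF _ (by simp [hh0]) (by simp [hh0])
      have a2 : F ((z, 0) - (g, 0) - (0, h)) = 1 := hF _ (by simp [hh0]) (by simp [hh0])
      have a3 : F ((z, 0) - (g, 0)) = 1 :=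
        hF _ (by simpa [sub_eq_zero] using hzs g hqg) (by simp [hg0])
      rw [a1, a2, a3, hFz]
      simp
    · have a0 : (z, 0) - (z, 0) = ((0, 0) : RatCircle × RatCircle) := sub_self _
      simp only [Function.comp_apply, Equiv.addRight_symm, Equiv.coe_addRight, ← sub_eq_add_neg,
        a0]
      have a1 : F ((0, 0) - (0, k)) = 1 := hF _ (by simp [hk0]) (by simp [hk0])
      have a2 : F ((0, 0) - (l, 0) - (0, k)) = 1 := hF _ (by simp [hk0]) (by simp [hk0])
      have a3 : F ((0, 0) - (l, 0)) = 1 :=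
        hF _ (by simp [hl0]) (by simpa using (hzs (-l) (by simp [hql])).symm)
      rw [a1, a2, a3, hF0]
      simp
  · intro ω hω
    by_contra hn
    push Not at hn
    obtain ⟨s, hs, s', hs', h2⟩ := commutator_label_support hn.1
    obtain ⟨m, hm, m', hm', h3⟩ := commutator_label_support hn.2
    simp only [Equiv.addRight_symm, Equiv.coe_addRight, ← sub_eq_add_neg] at h3
    have hzs : ∀ s s' : RatCircle, (q ^ 2) • s = 0 → (q ^ 2) • s' = 0 → s - s' ≠ z :=
      fun s s' hs hs' => by
        simpa using (hz0 1 one_ne_zero (by simp) (s - s') (by rw [smul_sub, hs, hs', sub_zero])).symm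
    have hzs2 : ∀ s s' : RatCircle, (q ^ 2) • s = 0 → (q ^ 2) • s' = 0 → s - s' ≠ z + z :=
      fun s s' hs hs' => by
        simpa [two_smul] using
          (hz0 2 two_ne_zero (by simp) (s - s') (by rw [smul_sub, hs, hs', sub_zero])).symm
    have hfst : ∀ b : RatCircle, ∀ s : RatCircle × RatCircle, s = 0 ∨ s = (b, 0) →
        ∃ a : RatCircle, s = (a, 0) ∧ (a = 0 ∨ a = b) := by
      rintro b s (rfl | rfl)
      exacts [⟨0, rfl, Or.inl rfl⟩, ⟨b, rfl, Or.inr rfl⟩]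
    have hsnd : ∀ b : RatCircle, ∀ s : RatCircle × RatCircle, s = 0 ∨ s = (0, b) →
        ∃ a : RatCircle, s = (0, a) ∧ (a = 0 ∨ a = b) := by
      rintro b s (rfl | rfl)
      exacts [⟨0, rfl, Or.inl rfl⟩, ⟨b, rfl, Or.inr rfl⟩]
    replace hs := hfst g s hs
    replace hm := hfst l m hm
    replace hs' := hsnd h s' hs'
    replace hm' := hsnd k m' hm'
    obtain ⟨s, rfl, hs⟩ := hs
    obtain ⟨m, rfl, hm⟩ := hm
    obtain ⟨s', rfl, hs'⟩ := hs'
    obtain ⟨m', rfl, hm'⟩ := hm'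
    obtain ⟨ω₁, ω₂⟩ := ω
    have hqs : (q ^ 2) • s = 0 := by rcases hs with rfl | rfl <;> simp [hqg]
    have hqm : (q ^ 2) • m = 0 := by rcases hm with rfl | rfl <;> simp [hql]
    have h2 := hF1 _ h2
    have h3 := hF1 _ h3
    simp only [Prod.mk_sub_mk, Prod.mk.injEq, sub_zero] at h2 h3
    have h2' : ω₂ = s' := by rcases h2 with h2 | h2 <;> exact sub_eq_zero.1 h2.2
    have h3' : ω₂ = m' := by rcases h3 with h3 | h3 <;> exact sub_eq_zero.1 h3.2
    have hω2 : ω₂ = 0 := by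
      rcases hs' with hs' | hs'
      · rw [h2', hs']
      · rcases hm' with hm' | hm'
        · rw [h3', hm']
        · exact absurd (hs'.symm.trans (h2'.symm.trans (h3'.trans hm'))) hhk
    rcases h2 with ⟨h2, -⟩ | ⟨h2, -⟩ <;> rcases h3 with ⟨h3, -⟩ | ⟨h3, -⟩
    · refine hzs s m hqs hqm ?_
      rw [sub_eq_zero.1 h2] at h3
      rw [← sub_eq_zero, ← h3]; abel
    · refine hzs2 s m hqs hqm ?_
      rw [sub_eq_zero.1 h2] at h3
      rw [eq_add_of_sub_eq (eq_add_of_sub_eq h3)]; abel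
    · rw [eq_add_of_sub_eq h2] at h3
      have hsm : s = m := by
        rw [← sub_eq_zero, ← h3]; abel
      have hs0 : s = 0 := by
        rcases hs with hs | hs
        · exact hs
        · rcases hm with hm | hm
          · rw [hsm, hm]
          · exact absurd (hs.symm.trans (hsm.trans hm)) hgl
      refine hω (Prod.ext ?_ hω2)
      rw [eq_add_of_sub_eq h2, hs0, add_zero]
    · refine hzs s m hqs hqm ?_
      rw [eq_add_of_sub_eq h2] at h3
      rw [← h3]; abel

theorem ConjInto.map {X Y : Type} {r : FreeGroup X} {S : Set X} {S' : Set Y} (f : X → Y)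
    (hS : ∀ x ∈ S, f x ∈ S') (h : ConjInto r S) : ConjInto (FreeGroup.map f r) S' := by
  obtain ⟨s, hs, hc⟩ := h
  refine ⟨FreeGroup.map f s, map_letterSubgroup_le_iff.2 (fun x hx => ?_) s hs,
    (FreeGroup.map f).map_isConj hc⟩
  rw [FreeGroup.map.of]
  exact of_mem_letterSubgroup (hS x hx)

theorem map_addRight_map_addRight (k : ℤ) (r : FreeGroup ℤ) :
    FreeGroup.map (· + k) (FreeGroup.map (· + -k) r) = r := by
  rw [FreeGroup.map.comp]
  have : ((fun x : ℤ => x + k) ∘ fun x : ℤ => x + -k) = id := by ext x; simp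
  rw [this, FreeGroup.map.id]

/-- Up to conjugation and translation of the letters, a nontrivial element involves exactly the
letters of an interval starting at `0`, whose end points cannot be avoided. -/
theorem exists_interval {r : FreeGroup ℤ} (hr : r ≠ 1) :
    ∃ (k n : ℤ) (r' : FreeGroup ℤ), 0 ≤ n ∧ IsConj (FreeGroup.map (· + k) r) r' ∧
      r' ∈ letterSubgroup (Set.Icc 0 n) ∧ ¬ ConjInto r' {0}ᶜ ∧ ¬ ConjInto r' {n}ᶜ := by
  have hne : {x | ¬ ConjInto r {x}ᶜ}.Nonempty := by
    rw [Set.nonempty_iff_ne_empty]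
    intro hn
    obtain ⟨s, hs, hc⟩ := ConjInto.essential r
    rw [hn] at hs
    rw [letterSubgroup_empty hs, isConj_one_left] at hc
    exact hr hc
  obtain ⟨lo, hlo, hlo'⟩ := (finite_essential r).exists_minimal hne
  obtain ⟨hi, hhi, hhi'⟩ := (finite_essential r).exists_maximal hne
  have hlo1 : ∀ x ∈ {x | ¬ ConjInto r {x}ᶜ}, lo ≤ x := fun x hx =>
    (le_total lo x).elim id fun h => hlo' hx h
  have hhi1 : ∀ x ∈ {x | ¬ ConjInto r {x}ᶜ}, x ≤ hi := fun x hx =>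
    (le_total x hi).elim id fun h => hhi' hx h
  obtain ⟨s, hs, hc⟩ := ConjInto.essential r
  have hend : ∀ x : ℤ, ¬ ConjInto r {x}ᶜ →
      ¬ ConjInto (FreeGroup.map (· + -lo) s) {x - lo}ᶜ := by
    intro x hx h
    have := ConjInto.map (S := {x - lo}ᶜ) (S' := {x}ᶜ) (· + lo) (fun y hy hyx => hy (by
      rw [Set.mem_singleton_iff] at hyx ⊢; omega)) h
    rw [map_addRight_map_addRight] at this
    exact hx (this.of_isConj hc.symm)
  refine ⟨-lo, hi - lo, FreeGroup.map (· + -lo) s, sub_nonneg.2 (hlo1 hi hhi),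
    (FreeGroup.map _).map_isConj hc, ?_, ?_, hend hi hhi⟩
  · refine map_letterSubgroup_le_iff.2 (fun x hx => ?_) s hs
    rw [FreeGroup.map.of]
    have h1 := hlo1 x hx
    have h2 := hhi1 x hx
    exact of_mem_letterSubgroup ⟨by omega, by omega⟩
  · have := hend lo hlo
    rwa [sub_self] at this

theorem exists_lift_eq_conjEval {r : FreeGroup ℤ} {q : ℤ} (hr : r ∈ letterSubgroup (Set.Icc 0 1))
    (h : (expSum 0 r).toAdd + q * (expSum 1 r).toAdd = 0) :
    ∃ r₁ : FreeGroup ℤ, ∀ (G : Type) [Group G] (s c : G),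
      FreeGroup.lift (fun i : ℤ => if i = 0 then s else c * s ^ q) r = conjEval s c r₁ := by
  let d : ℤ → ℤ := fun i => if i = 0 then 1 else q
  refine ⟨FreeGroup.map Prod.snd (rewriteHom 0 d r).left, fun G _ s c => ?_⟩
  have h1 : FreeGroup.lift (fun i : ℤ => if i = 0 then s else c * s ^ q) =
      stableEval 0 d s (fun _ => c) := by
    ext i
    by_cases hi : i = 0
    · subst hi; simp [stableEval_of_self, d]
    · rw [stableEval_of_ne _ _ _ _ hi]; simp [d, hi]
  have h2 : (rewriteHom 0 d r).right = 1 := by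
    rw [rewriteHom_right_apply, hom_apply_eq_expSum (u := (0 : ℤ)) (v := 1) zero_ne_one
      (letterSubgroup_mono (fun i hi => by
        obtain ⟨h3, h4⟩ := hi
        have : i = 0 ∨ i = 1 := by omega
        exact this) hr)]
    apply Multiplicative.toAdd.injective
    simp [d]
    linarith
  have h3 : indexedEval s (fun _ : ℤ => c) = (conjEval s c).comp (FreeGroup.map Prod.snd) := by
    ext p
    simp [indexedEval_of, conjEval_of]
  rw [h1, stableEval_eq, h2, h3]
  simp

/-- The polynomial whose coefficients are the exponent sums of the letters. -/
noncomputable def expPolynomial : FreeGroup ℤ →* Multiplicative (Polynomial ℂ) :=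
  FreeGroup.lift fun i => Multiplicative.ofAdd (Polynomial.X ^ i.toNat)

theorem expPolynomial_coeff {n j : ℤ} (hj : 0 ≤ j) {r : FreeGroup ℤ}
    (hr : r ∈ letterSubgroup (Set.Icc 0 n)) :
    (expPolynomial r).toAdd.coeff j.toNat = ((expSum j r).toAdd : ℂ) := by
  let f : FreeGroup ℤ →* Multiplicative ℂ :=
    (Polynomial.lcoeff ℂ j.toNat).toAddMonoidHom.toMultiplicative.comp expPolynomial
  let f' : FreeGroup ℤ →* Multiplicative ℂ :=
    (Int.castAddHom ℂ).toMultiplicative.comp (expSum j)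
  have h : f r = f' r := by
    refine eqOn_letterSubgroup (f := f) (f' := f') (fun i hi => ?_) hr
    apply Multiplicative.toAdd.injective
    by_cases hij : i = j
    · subst hij
      simp [f, f', expPolynomial, expSum_of_self]
    · have : j.toNat ≠ i.toNat := by
        have := hi.1
        omega
      simp [f, f', expPolynomial, expSum_of_ne hij, Polynomial.coeff_X_pow, this]
  exact congrArg Multiplicative.toAdd h

theorem conjEval_eq_eval {n : ℤ} {r : FreeGroup ℤ} (hr : r ∈ letterSubgroup (Set.Icc 0 n))
    {G : Type} [Group G] {s : G} {ν : Multiplicative ℂ →* G} {ζ : ℂ}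
    (h : ∀ z, s * ν (Multiplicative.ofAdd z) * s⁻¹ = ν (Multiplicative.ofAdd (ζ * z))) (w : ℂ) :
    conjEval s (ν (Multiplicative.ofAdd w)) r =
      ν (Multiplicative.ofAdd ((expPolynomial r).toAdd.eval ζ * w)) := by
  let g : Polynomial ℂ →+ ℂ :=
    (AddMonoidHom.mulRight w).comp (Polynomial.evalRingHom ζ).toAddMonoidHom
  refine eqOn_letterSubgroup (f := conjEval s (ν (Multiplicative.ofAdd w)))
    (f' := (ν.comp g.toMultiplicative).comp expPolynomial) (fun i hi => ?_) hr
  obtain ⟨i, rfl⟩ := Int.eq_ofNat_of_zero_le hi.1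
  have h1 : ∀ i : ℕ, s ^ i * ν (Multiplicative.ofAdd w) * (s ^ i)⁻¹ =
      ν (Multiplicative.ofAdd (ζ ^ i * w)) := by
    intro i
    induction i with
    | zero => simp
    | succ i ih =>
      rw [pow_succ', pow_succ', mul_assoc ζ, ← h, ← ih]
      simp [mul_assoc]
  rw [conjEval_of, zpow_natCast, h1]
  simp [g, expPolynomial]

/-- If in every group the relation `r` between the conjugates of `c` by the powers of `s` forces
`s ^ k = (c * s ^ q) ^ l`, but not `c = 1`, then `r` holds in an abelian group on which `s` acts as
multiplication by a suitable complex number. -/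
theorem exists_eigenvalue {r : FreeGroup ℤ} {q k l : ℤ} (hk : k ≠ 0) (hl : l ≠ 0)
    (hU : ∀ (G : Type) [Group G] (s c : G), conjEval s c r = 1 → s ^ k = (c * s ^ q) ^ l)
    (hV : ∃ (G : Type) (_ : Group G) (s c : G), conjEval s c r = 1 ∧ c ≠ 1) :
    ∃ ζ : ℂ, ζ ≠ 0 ∧ ∀ (G : Type) [Group G] (s : G) (ν : Multiplicative ℂ →* G),
      (∀ z, s * ν (Multiplicative.ofAdd z) * s⁻¹ = ν (Multiplicative.ofAdd (ζ * z))) →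
        ∀ w, conjEval s (ν (Multiplicative.ofAdd w)) r = 1 := by
  have hr1 : r ≠ 1 := by
    rintro rfl
    have := hU (Multiplicative ℤ) 1 (Multiplicative.ofAdd 1) (by simp)
    have := congrArg Multiplicative.toAdd this
    simp at this
    exact hl this.symm
  obtain ⟨j, n, r', hn0, hc, hr', h0, hn⟩ := exists_interval hr1
  have hrr' : ∀ (G : Type) [Group G] (s c : G), conjEval s c r' = 1 ↔ conjEval s c r = 1 := by
    intro G _ s c
    have h1 := (conjEval s c).map_isConj hc
    rw [conjEval_map_add] at h1
    constructor
    · intro h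
      rw [h, isConj_one_left, conj_eq_one_iff] at h1
      exact h1
    · intro h
      rw [h, mul_one, mul_inv_cancel, isConj_one_right] at h1
      exact h1
  obtain ⟨Γ, _, L, t, deg, P, N, hM, hL⟩ := exists_magnusHNN_interval h0 hn
  have hr'1 : conjEval t (L (FreeGroup.of 0)) r' = 1 := by
    rw [hL r' hr', hM.ker]; exact Subgroup.subset_normalClosure rfl
  have hz := hU Γ t (L (FreeGroup.of 0)) ((hrr' _ _ _).1 hr'1)
  set c := L (FreeGroup.of 0) with hcdef
  have hcomm : Commute (t ^ k) c := by
    have h1 : Commute (t ^ k) (c * t ^ q) := by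
      rw [hz]; exact (Commute.refl _).zpow_left l
    have h2 : Commute (t ^ k) (t ^ q)⁻¹ := ((Commute.refl t).zpow_zpow k q).inv_right
    simpa using h1.mul_right h2
  have hcomm' : ∀ i ∈ Set.Icc 0 n, Commute (t ^ k.natAbs) (L (FreeGroup.of i)) := by
    intro i hi
    rw [← hL _ (of_mem_letterSubgroup hi), conjEval_of]
    have h1 : Commute (t ^ k) (t ^ i * c * (t ^ i)⁻¹) :=
      (((Commute.refl t).zpow_zpow k i).mul_right hcomm).mul_right
        (((Commute.refl t).zpow_zpow k i).inv_right)
    rcases Int.natAbs_eq k with hk' | hk'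
    · rw [hk', zpow_natCast] at h1; exact h1
    · rw [hk', zpow_neg, zpow_natCast] at h1; exact (Commute.inv_left_iff).1 h1
  have hkn : k.natAbs ≠ 0 := Int.natAbs_ne_zero.2 hk
  have hmem : ∀ S : Set ℤ, ∀ i ∈ Set.Icc 0 n, i ∉ S →
      L (FreeGroup.of i) ∈ (letterSubgroup S).map L →
      ∃ u ∈ letterSubgroup S, FreeGroup.of i * u⁻¹ ∈ Subgroup.normalClosure {r'} := by
    rintro S i hi hiS ⟨u, hu, hLu⟩
    exact ⟨u, hu, by rw [← hM.ker, map_mul, map_inv, hLu, mul_inv_cancel]⟩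
  have hexp : ∀ S : Set ℤ, ∀ i, i ∉ S → (∃ u ∈ letterSubgroup S,
      FreeGroup.of i * u⁻¹ ∈ Subgroup.normalClosure {r'}) → (expSum i r').toAdd ≠ 0 := by
    rintro S i hiS ⟨u, hu, hmem⟩ hz
    have h1 := map_mem_normalClosure (expSum i) hmem
    rw [map_mul, map_inv, expSum_of_self, expSum_eq_one hiS hu] at h1
    have h2 : expSum i r' = 1 := hz
    rw [h2] at h1
    have h3 : Subgroup.normalClosure ({1} : Set (Multiplicative ℤ)) ≤ ⊥ :=
      Subgroup.normalClosure_le_normal (by simp)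
    simpa using h3 h1
  obtain ⟨u, hu, hun⟩ := hmem (Set.Ico 0 n) n ⟨hn0, le_rfl⟩ (by simp)
    (hM.half.mem_of_conj_pow_mem hkn ⟨_, rfl⟩ (by
      rw [(hcomm' n ⟨hn0, le_rfl⟩).eq]; simp))
  have hB := hmem (Set.Ioc 0 n) 0 ⟨le_rfl, hn0⟩ (by simp)
    (hM.half.mem_of_inv_conj_pow_mem hkn ⟨_, rfl⟩ (by
      rw [mul_assoc, ← (hcomm' 0 ⟨le_rfl, hn0⟩).eq]; simp))
  have hfn := hexp _ _ (by simp) ⟨u, hu, hun⟩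
  have hf0 := hexp _ _ (by simp) hB
  have hn1 : 0 < n := by
    refine lt_of_le_of_ne hn0 fun hn => ?_
    subst hn
    rw [Set.Ico_self] at hu
    rw [letterSubgroup_empty hu, inv_one, mul_one] at hun
    obtain ⟨G, _, s, c, h1, h2⟩ := hV
    have := ConjGroup.conjEval_eq_one_of_mem ((hrr' _ _ _).2 h1) hun
    rw [conjEval_of] at this
    exact h2 (by simpa using this)
  obtain ⟨ζ, hζ⟩ := IsAlgClosed.exists_root (expPolynomial r').toAdd (by
    intro hdeg
    have h1 := Polynomial.eq_C_of_degree_eq_zero hdeg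
    have h2 := expPolynomial_coeff hn0 hr'
    rw [h1, Polynomial.coeff_C_of_ne_zero (by omega)] at h2
    exact hfn (by exact_mod_cast h2.symm))
  refine ⟨ζ, ?_, fun G _ s ν h w => (hrr' _ _ _).1 ?_⟩
  · rintro rfl
    have h2 := expPolynomial_coeff le_rfl hr'
    rw [Int.toNat_zero, Polynomial.coeff_zero_eq_eval_zero, hζ] at h2
    exact hf0 (by exact_mod_cast h2.symm)
  · rw [conjEval_eq_eval hr' h, hζ]
    simp

theorem lift_eq_one_of_mem {r : FreeGroup ℤ} {G : Type} [Group G] {f : FreeGroup ℤ →* G}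
    (h : f r = 1) {g : FreeGroup ℤ} (hg : g ∈ Subgroup.normalClosure {r}) : f g = 1 := by
  have : Subgroup.normalClosure {r} ≤ f.ker := Subgroup.normalClosure_le_normal (by simpa using h)
  exact this hg

theorem exists_unimodular {r : FreeGroup ℤ} {q k l : ℤ} (hr : r ∈ letterSubgroup (Set.Icc 0 1))
    (hσ : (expSum 0 r).toAdd + q * (expSum 1 r).toAdd = 0) (hk : k ≠ 0) (hl : l ≠ 0)
    (hkl : FreeGroup.of 0 ^ k * (FreeGroup.of 1 ^ l)⁻¹ ∈ Subgroup.normalClosure {r})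
    (hq : FreeGroup.of 1 * (FreeGroup.of 0 ^ q)⁻¹ ∉ Subgroup.normalClosure {r}) :
    ∃ ζ : ℂ, ‖ζ‖ = 1 ∧ ζ ^ q ≠ 1 ∧ ∀ (G : Type) [Group G] (s : G) (ν : Multiplicative ℂ →* G),
      (∀ z, s * ν (Multiplicative.ofAdd z) * s⁻¹ = ν (Multiplicative.ofAdd (ζ * z))) →
        ∀ w, FreeGroup.lift (fun i : ℤ =>
          if i = 0 then s else ν (Multiplicative.ofAdd w) * s ^ q) r = 1 := by
  obtain ⟨r₁, hr₁⟩ := exists_lift_eq_conjEval hr hσ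
  have hU : ∀ (G : Type) [Group G] (s c : G), conjEval s c r₁ = 1 → s ^ k = (c * s ^ q) ^ l := by
    intro G _ s c h
    rw [← hr₁] at h
    have := lift_eq_one_of_mem h hkl
    simpa [mul_inv_eq_one] using this
  obtain ⟨ζ, hζ0, hζ⟩ := exists_eigenvalue hk hl hU (by
    let mk := QuotientGroup.mk' (Subgroup.normalClosure {r})
    refine ⟨_, inferInstance, mk (FreeGroup.of 0), mk (FreeGroup.of 1 * (FreeGroup.of 0 ^ q)⁻¹),
      ?_, fun h => hq ((QuotientGroup.eq_one_iff _).1 h)⟩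
    rw [← hr₁]
    refine Eq.trans (eqOn_letterSubgroup (f' := mk) (fun i hi => ?_) hr)
      ((QuotientGroup.eq_one_iff _).2 (Subgroup.subset_normalClosure rfl))
    obtain ⟨h1, h2⟩ := hi
    have : i = 0 ∨ i = 1 := by omega
    rcases this with rfl | rfl <;> simp)
  let s : Equiv.Perm ℂ := MulAction.toPermHom ℂˣ ℂ (Units.mk0 ζ hζ0)
  let ν : Multiplicative ℂ →* Equiv.Perm ℂ := MulAction.toPermHom (Multiplicative ℂ) ℂ
  have hs : ∀ (m : ℤ) (z : ℂ), (s ^ m) z = ζ ^ m * z := by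
    intro m z
    simp only [s]
    rw [← map_zpow, MulAction.toPermHom_apply, MulAction.toPerm_apply, Units.smul_def]
    simp
  have hν : ∀ w z : ℂ, ν (Multiplicative.ofAdd w) z = w + z := fun w z => rfl
  have h1 := hU _ s (ν (Multiplicative.ofAdd 1)) (hζ _ s ν (fun z => by
    rw [mul_inv_eq_iff_eq_mul]
    ext x
    have := hs 1
    simp only [zpow_one] at this
    simp only [Equiv.Perm.coe_mul, Function.comp_apply, this, hν, mul_add]) 1)
  have hζq : ζ ^ q ≠ 1 := by
    intro h
    have h2 : s ^ q = 1 := by ext z; simp [hs, h]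
    rw [h2, mul_one] at h1
    have h3 := DFunLike.congr_fun h1 0
    rw [hs, mul_zero, ← map_zpow ν, ← ofAdd_zsmul, hν] at h3
    simp at h3
    exact hl (by exact_mod_cast h3.symm)
  refine ⟨ζ, ?_, hζq, fun G _ s ν h w => ?_⟩
  · have hD : (1 - ζ ^ q) ≠ 0 := sub_ne_zero.2 hζq.symm
    have h2 : (ν (Multiplicative.ofAdd 1) * s ^ q) (1 - ζ ^ q)⁻¹ = (1 - ζ ^ q)⁻¹ := by
      rw [Equiv.Perm.mul_apply, hs, hν]
      field_simp
      ring
    have h3 := Equiv.Perm.zpow_apply_eq_self_of_apply_eq_self h2 l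
    rw [← h1, hs] at h3
    have h4 : ζ ^ k = 1 := by
      have := mul_right_cancel₀ (inv_ne_zero hD) (h3.trans (one_mul _).symm)
      exact this
    refine Complex.norm_eq_one_of_pow_eq_one (n := k.natAbs) ?_ (Int.natAbs_ne_zero.2 hk)
    rcases Int.natAbs_eq k with hk' | hk'
    · rw [hk', zpow_natCast] at h4; exact h4
    · rw [hk', zpow_neg, zpow_natCast, inv_eq_one] at h4; exact h4
  · rw [hr₁, hζ G s ν h]

open scoped commutatorElement

section rotations

variable {ι : Type}

/-- The coordinatewise rotation with angles `e` about the point `c`. -/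
noncomputable def rotationAbout (e : ι → Circle) (c : ι → ℂ) : Equiv.Perm (ι → ℂ) :=
  Equiv.addRight c * MulAction.toPermHom (ι → Circle) (ι → ℂ) e * (Equiv.addRight c)⁻¹

theorem rotationAbout_apply (e : ι → Circle) (c ω : ι → ℂ) :
    rotationAbout e c ω = fun i => e i * (ω i - c i) + c i := by
  funext i
  simp [rotationAbout, Circle.smul_def, sub_eq_add_neg, mul_add]

theorem rotationAbout_zpow (e : ι → Circle) (c : ι → ℂ) (q : ℤ) :
    rotationAbout e c ^ q = rotationAbout (e ^ q) c := by
  rw [rotationAbout, rotationAbout, conj_zpow, map_zpow]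

theorem rotationAbout_conj_addRight (e : ι → Circle) (c v : ι → ℂ) :
    rotationAbout e c * Equiv.addRight v * (rotationAbout e c)⁻¹ = Equiv.addRight (e • v) := by
  rw [mul_inv_eq_iff_eq_mul]
  ext ω i
  simp [rotationAbout_apply, Circle.smul_def]
  ring

theorem norm_rotationAbout (e : ι → Circle) (c ω : ι → ℂ) (i : ι) :
    ‖rotationAbout e c ω i - c i‖ = ‖ω i - c i‖ := by
  rw [rotationAbout_apply]
  simp [Circle.norm_coe]

end rotations

theorem commute_lab_per {Ω G : Type} [Group G] {F : Ω → G} {π : Equiv.Perm Ω}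
    (h : ∀ ω, F (π ω) = F ω) : Commute (lab Ω G F) (per Ω G π) := by
  have h1 := per_conj_lab (G := G) π F
  have h2 : F ∘ π.symm = F := by
    funext ω
    rw [Function.comp_apply, ← h, Equiv.apply_symm_apply]
  rw [h2, mul_inv_eq_iff_eq_mul] at h1
  exact h1.symm

theorem exists_turn {ζ : ℂ} (hζ : ‖ζ‖ = 1) {q : ℤ} (hq : q ≠ 0) :
    ∃ turn : ℤ → Circle, (turn 0 : ℂ) = ζ ∧ ∀ j, turn (j + 1) = turn j ^ q := by
  refine ⟨fun j => Circle.exp (ζ.arg * (q : ℝ) ^ j), ?_, fun j => ?_⟩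
  · have := Complex.norm_mul_exp_arg_mul_I ζ
    rw [hζ] at this
    simpa [Circle.coe_exp] using this
  · have hq' : (q : ℝ) ≠ 0 := by exact_mod_cast hq
    rw [← Circle.exp_zsmul]
    simp only [zpow_add_one₀ hq']
    congr 1
    simp
    ring

section threePlane

variable {E : Type} [Group E]

/-- The function with value `e` on `S` and `1` elsewhere. -/
noncomputable def constOn {Ω : Type} (S : Set Ω) (e : E) (ω : Ω) : E :=
  open Classical in if ω ∈ S then e else 1

theorem constOn_of_mem {Ω : Type} {S : Set Ω} {ω : Ω} (h : ω ∈ S) (e : E) : constOn S e ω = e :=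
  if_pos h

theorem constOn_of_notMem {Ω : Type} {S : Set Ω} {ω : Ω} (h : ω ∉ S) (e : E) :
    constOn S e ω = 1 :=
  if_neg h

theorem mem_of_constOn_ne_one {Ω : Type} {S : Set Ω} {ω : Ω} {e : E} (h : constOn S e ω ≠ 1) :
    ω ∈ S :=
  by_contra fun hn => h (constOn_of_notMem hn e)

/-- The unit circle about `1` in the first coordinate axis. -/
def circleSet : Set (Fin 3 → ℂ) :=
  {ω | ‖ω 0 - 1‖ = 1 ∧ ω 1 = 0 ∧ ω 2 = 0}

/-- The torus about `1` in the first coordinate plane. -/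
def torusSet : Set (Fin 3 → ℂ) :=
  {ω | ‖ω 0 - 1‖ = 1 ∧ ‖ω 1 - 1‖ = 1 ∧ ω 2 = 0}

theorem norm_add_sub_ne {u z : ℂ} (hu : 2 < ‖u‖) (hz : ‖z - 1‖ = 1) : ‖z - u - 1‖ ≠ 1 := by
  intro h
  have h1 : u = (z - 1) - (z - u - 1) := by ring
  have h2 := norm_sub_le (z - 1) (z - u - 1)
  rw [← h1, h, hz] at h2
  linarith

theorem circleSet_value {u v : ℂ} (hu : 2 < ‖u‖) (hv : v ≠ 0) (x : E) {ω : Fin 3 → ℂ}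
    (hω : ω ∈ circleSet) :
    constOn circleSet x ω * (constOn circleSet x (ω - Pi.single 0 u))⁻¹ *
      constOn circleSet x (ω - Pi.single 1 v - Pi.single 0 u) *
      (constOn circleSet x (ω - Pi.single 1 v))⁻¹ = x := by
  obtain ⟨h0, h1, h2⟩ := hω
  have a1 : ω - Pi.single 0 u ∉ circleSet := fun h => norm_add_sub_ne hu h0 (by simpa using h.1)
  have a2 : ω - Pi.single 1 v - Pi.single 0 u ∉ circleSet := fun h => hv (by
    simpa [h1] using h.2.1)
  have a3 : ω - Pi.single 1 v ∉ circleSet := fun h => hv (by simpa [h1] using h.2.1)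
  have a0 : ω ∈ circleSet := ⟨h0, h1, h2⟩
  rw [constOn_of_mem a0, constOn_of_notMem a1, constOn_of_notMem a2,
    constOn_of_notMem a3]
  simp

theorem torusSet_value {u v : ℂ} (hu : 2 < ‖u‖) (hv : v ≠ 0) (y : E) {ω : Fin 3 → ℂ}
    (hω : ω ∈ circleSet) :
    constOn torusSet y ω * (constOn torusSet y (ω - Pi.single 2 v))⁻¹ *
      constOn torusSet y (ω - Pi.single 1 u - Pi.single 2 v) *
      (constOn torusSet y (ω - Pi.single 1 u))⁻¹ = y := by
  obtain ⟨h0, h1, h2⟩ := hω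
  have h1' : ‖ω 1 - 1‖ = 1 := by simp [h1]
  have a1 : ω - Pi.single 2 v ∉ torusSet := fun h => hv (by simpa [h2] using h.2.2)
  have a2 : ω - Pi.single 1 u - Pi.single 2 v ∉ torusSet := fun h => hv (by
    simpa [h2] using h.2.2)
  have a3 : ω - Pi.single 1 u ∉ torusSet := fun h => norm_add_sub_ne hu h1' (by
    simpa using h.2.1)
  have a0 : ω ∈ torusSet := ⟨h0, h1', h2⟩
  rw [constOn_of_mem a0, constOn_of_notMem a1, constOn_of_notMem a2,
    constOn_of_notMem a3]
  simp

theorem circleSet_torusSet_disjoint {u v : ℂ} (hu : 2 < ‖u‖) (x y : E)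
    {ω : Fin 3 → ℂ}
    (hx : constOn circleSet x ω * (constOn circleSet x (ω - Pi.single 0 u))⁻¹ *
      constOn circleSet x (ω - Pi.single 1 (2 * u) - Pi.single 0 u) *
      (constOn circleSet x (ω - Pi.single 1 (2 * u)))⁻¹ ≠ 1)
    (hy : constOn torusSet y ω * (constOn torusSet y (ω - Pi.single 2 v))⁻¹ *
      constOn torusSet y (ω - Pi.single 1 u - Pi.single 2 v) *
      (constOn torusSet y (ω - Pi.single 1 u))⁻¹ ≠ 1) :
    ω ∈ circleSet := by
  obtain ⟨s, hs, s', hs', hx⟩ := commutator_label_support hx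
  obtain ⟨m, hm, m', hm', hy⟩ := commutator_label_support hy
  have hax : ∀ (i : Fin 3) (b : ℂ) (s : Fin 3 → ℂ), s = 0 ∨ s = Pi.single i b →
      ∃ a : ℂ, s = Pi.single i a ∧ (a = 0 ∨ a = b) := by
    rintro i b s (rfl | rfl)
    exacts [⟨0, by simp, Or.inl rfl⟩, ⟨b, rfl, Or.inr rfl⟩]
  replace hs := hax _ _ s hs
  replace hs' := hax _ _ s' hs'
  replace hm := hax _ _ m hm
  replace hm' := hax _ _ m' hm'
  obtain ⟨s, rfl, hs⟩ := hs
  obtain ⟨s', rfl, hs'⟩ := hs'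
  obtain ⟨m, rfl, hm⟩ := hm
  obtain ⟨m', rfl, hm'⟩ := hm'
  obtain ⟨h0, h1, h2⟩ := mem_of_constOn_ne_one hx
  obtain ⟨k0, k1, k2⟩ := mem_of_constOn_ne_one hy
  simp [sub_eq_zero] at h0 h1 h2 k0 k1 k2
  have h11 : ‖(0 : ℂ) - 1‖ = 1 := by simp
  have hs0 : s = 0 := by
    rcases hs with hs | hs
    · exact hs
    · exfalso
      subst hs
      rcases hm with hm | hm <;> subst hm
      · refine norm_add_sub_ne (u := - (2 * u)) (by simp; linarith) h11 ?_
        simpa [h1] using k1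
      · refine norm_add_sub_ne (u := - m) (by simpa using hu) h11 ?_
        rw [h1] at k1
        rw [← k1]
        ring_nf
  refine ⟨?_, by rw [h1, hs0], h2⟩
  rcases hs' with rfl | rfl
  · simpa using h0
  · exact absurd h0 (norm_add_sub_ne hu k0)

end threePlane

section spin

/-- The times at which the centres of the rotations change. -/
def jumpTime : Fin 3 → ℤ := ![0, 1, 3]

/-- The angles of the rotations. -/
def spinAngle (turn : ℤ → Circle) (j : ℤ) (i : Fin 3) : Circle := turn (j - jumpTime i)

/-- The centres of the rotations. -/
def spinCentre (j : ℤ) (i : Fin 3) : ℂ := if j ≤ jumpTime i then 0 else 1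

/-- The indicator of the coordinates whose rotation changes its centre. -/
def spinJump (j : ℤ) (i : Fin 3) : ℂ := if j = jumpTime i then 1 else 0

variable {turn : ℤ → Circle}

theorem rotationAbout_spin_succ {q : ℤ} (h : ∀ j, turn (j + 1) = turn j ^ q) (j : ℤ) :
    rotationAbout (spinAngle turn (j + 1)) (spinCentre (j + 1)) =
      Equiv.addRight ((1 - (turn 0 : ℂ) ^ q) • spinJump j) *
        rotationAbout (spinAngle turn j) (spinCentre j) ^ q := by
  rw [rotationAbout_zpow]
  ext ω i
  have h1 : spinAngle turn (j + 1) i = spinAngle turn j i ^ q := by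
    rw [spinAngle, spinAngle, ← h]
    congr 1
    ring
  simp only [rotationAbout_apply, Equiv.Perm.coe_mul, Function.comp_apply, Equiv.coe_addRight,
    Pi.add_apply, Pi.smul_apply, Pi.pow_apply, h1]
  rcases lt_trichotomy j (jumpTime i) with hj | hj | hj
  · simp [spinCentre, spinJump, hj.ne, hj.le, show j + 1 ≤ jumpTime i by omega]
  · have h0 : spinAngle turn (jumpTime i) i = turn 0 := by rw [spinAngle, sub_self]
    simp [spinCentre, spinJump, hj, h0]
    ring
  · simp [spinCentre, spinJump, hj.ne', hj.not_ge, show ¬ j + 1 ≤ jumpTime i by omega]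

theorem spinAngle_smul_spinJump (turn : ℤ → Circle) (z : ℂ) (j : ℤ) :
    spinAngle turn j • (z • spinJump j) = ((turn 0 : ℂ) * z) • spinJump j := by
  ext i
  by_cases hj : j = jumpTime i
  · simp [spinJump, spinAngle, hj, Circle.smul_def]
  · simp [spinJump, hj]

theorem spinJump_eq_zero {j : ℤ} (h0 : j ≠ 0) (h1 : j ≠ 1) (h3 : j ≠ 3) : spinJump j = 0 := by
  ext i
  fin_cases i <;> simp [spinJump, jumpTime, *]

theorem spinJump_zero : spinJump 0 = Pi.single 0 1 := by
  ext i
  fin_cases i <;> simp [spinJump, jumpTime]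

theorem spinJump_one : spinJump 1 = Pi.single 1 1 := by
  ext i
  fin_cases i <;> simp [spinJump, jumpTime]

theorem spinJump_three : spinJump 3 = Pi.single 2 1 := by
  ext i
  fin_cases i <;> simp [spinJump, jumpTime]

theorem spin_mem_circleSet_iff (turn : ℤ → Circle) (ω : Fin 3 → ℂ) :
    rotationAbout (spinAngle turn 1) (spinCentre 1) ω ∈ circleSet ↔ ω ∈ circleSet := by
  have h := norm_rotationAbout (spinAngle turn 1) (spinCentre 1) ω
  have h0 := h 0
  have h1 := h 1
  have h2 := h 2
  simp only [spinCentre, jumpTime] at h0 h1 h2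
  simp at h0 h1 h2
  simp only [circleSet, Set.mem_ofPred_eq]
  rw [h0, ← norm_eq_zero, h1, ← norm_eq_zero (a := rotationAbout _ _ ω 2), h2, norm_eq_zero,
    norm_eq_zero]

theorem spin_mem_torusSet_iff (turn : ℤ → Circle) (ω : Fin 3 → ℂ) :
    rotationAbout (spinAngle turn 3) (spinCentre 3) ω ∈ torusSet ↔ ω ∈ torusSet := by
  have h := norm_rotationAbout (spinAngle turn 3) (spinCentre 3) ω
  have h0 := h 0
  have h1 := h 1
  have h2 := h 2
  simp only [spinCentre, jumpTime] at h0 h1 h2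
  simp at h0 h1 h2
  simp only [torusSet, Set.mem_ofPred_eq]
  rw [h0, h1, ← norm_eq_zero, h2, norm_eq_zero]

end spin

/-- A relator of exponent sums `-q` and `1` at the letters `0` and `1`, for which the letters have
a common power but the letter `1` is not a power of the letter `0`. -/
theorem sqUniversal_of_zpow_mem {r : FreeGroup ℤ} {q k l : ℤ} (hq0 : q ≠ 0)
    (hr : r ∈ letterSubgroup (Set.Icc 0 1))
    (hσ : (expSum 0 r).toAdd + q * (expSum 1 r).toAdd = 0) (hk : k ≠ 0) (hl : l ≠ 0)
    (hkl : FreeGroup.of 0 ^ k * (FreeGroup.of 1 ^ l)⁻¹ ∈ Subgroup.normalClosure {r})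
    (hq : FreeGroup.of 1 * (FreeGroup.of 0 ^ q)⁻¹ ∉ Subgroup.normalClosure {r}) :
    SQUniversal (ConjGroup r) := by
  obtain ⟨ζ, hζ1, hζq, hζ⟩ := exists_unimodular hr hσ hk hl hkl hq
  obtain ⟨turn, ht0, ht⟩ := exists_turn hζ1 hq0
  refine sqUniversal_of_labels fun E _ x y => ?_
  set θ : ℂ := 1 - ζ ^ q with hθ
  have hθ0 : θ ≠ 0 := sub_ne_zero.2 hζq.symm
  obtain ⟨K, hK⟩ : ∃ K : ℕ, 2 < ‖(K : ℂ) * θ‖ := by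
    obtain ⟨K, hK⟩ := exists_nat_gt (2 / ‖θ‖)
    refine ⟨K, ?_⟩
    rw [norm_mul, Complex.norm_natCast]
    exact (div_lt_iff₀ (norm_pos_iff.2 hθ0)).1 hK
  have hK0 : (K : ℂ) * θ ≠ 0 := by
    intro h
    rw [h, norm_zero] at hK
    linarith
  let A : (Fin 3 → ℂ) → Equiv.Perm ((Fin 3 → ℂ) × E) := fun v => per _ E (Equiv.addRight v)
  let B : ℤ → Equiv.Perm (Fin 3 → ℂ) := fun j => rotationAbout (spinAngle turn j) (spinCentre j)
  let F : (Fin 3 → ℂ) → E := constOn circleSet x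
  let G : (Fin 3 → ℂ) → E := constOn torusSet y
  let Λ : ℤ → Equiv.Perm ((Fin 3 → ℂ) × E) := fun j =>
    if j ≤ 1 then lab _ E F else if j ≤ 3 then 1 else lab _ E G
  have hΛ1 : ∀ j ≤ 1, Λ j = lab _ E F := fun j hj => if_pos hj
  have hΛ2 : ∀ j, 1 < j → j ≤ 3 → Λ j = 1 := fun j hj hj' =>
    (if_neg (by omega)).trans (if_pos hj')
  have hΛ3 : ∀ j, 3 < j → Λ j = lab _ E G := fun j hj =>
    (if_neg (by omega)).trans (if_neg (by omega))
  let β : ℤ → Equiv.Perm ((Fin 3 → ℂ) × E) := fun j => Λ j * per _ E (B j) * (Λ j)⁻¹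
  have hβ : ∀ j, β j = Λ (j + 1) * per _ E (B j) * (Λ (j + 1))⁻¹ := by
    intro j
    simp only [β]
    by_cases h1 : j = 1
    · subst h1
      rw [hΛ1 1 le_rfl, hΛ2 (1 + 1) (by omega) (by omega)]
      have := commute_lab_per (G := E) (F := F) (π := B 1) fun ω => by
        by_cases hω : ω ∈ circleSet
        · simp only [F, B]
          rw [constOn_of_mem hω, constOn_of_mem ((spin_mem_circleSet_iff turn ω).2 hω)]
        · simp only [F, B]
          rw [constOn_of_notMem hω,
            constOn_of_notMem fun h => hω ((spin_mem_circleSet_iff turn ω).1 h)]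
      rw [this.eq]
      simp
    by_cases h3 : j = 3
    · subst h3
      rw [hΛ2 3 (by omega) le_rfl, hΛ3 (3 + 1) (by omega)]
      have := commute_lab_per (G := E) (F := G) (π := B 3) fun ω => by
        by_cases hω : ω ∈ torusSet
        · simp only [G, B]
          rw [constOn_of_mem hω, constOn_of_mem ((spin_mem_torusSet_iff turn ω).2 hω)]
        · simp only [G, B]
          rw [constOn_of_notMem hω,
            constOn_of_notMem fun h => hω ((spin_mem_torusSet_iff turn ω).1 h)]
      rw [this.eq]
      simp
    have : Λ (j + 1) = Λ j := by
      rcases lt_or_ge 3 j with h | h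
      · rw [hΛ3 _ h, hΛ3 _ (by omega)]
      · rcases lt_or_ge 1 j with h' | h'
        · rw [hΛ2 _ h' h, hΛ2 _ (by omega) (by omega)]
        · rw [hΛ1 _ h', hΛ1 _ (by omega)]
    rw [this]
  have hstep : ∀ j, β (j + 1) = Λ (j + 1) * A (θ • spinJump j) * (Λ (j + 1))⁻¹ * β j ^ q := by
    intro j
    rw [hβ j, conj_zpow]
    simp only [β, B, A]
    rw [rotationAbout_spin_succ ht, ht0, ← map_zpow, map_mul]
    simp [mul_assoc, hθ]
  have hrel : ∀ j, timeEval β j r = 1 := by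
    intro j
    let ν : Multiplicative ℂ →* Equiv.Perm ((Fin 3 → ℂ) × E) :=
      { toFun := fun z => Λ (j + 1) * A (z.toAdd • θ • spinJump j) * (Λ (j + 1))⁻¹
        map_one' := by simp [A]
        map_mul' := fun z z' => by
          have : A ((z * z').toAdd • θ • spinJump j) =
              A (z.toAdd • θ • spinJump j) * A (z'.toAdd • θ • spinJump j) := by
            simp only [A]
            rw [← map_mul, toAdd_mul, add_smul]
            congr 1
            ext ω : 1
            simp only [Equiv.coe_addRight, Equiv.Perm.coe_mul, Function.comp_apply]
            abel
          rw [this]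
          simp [mul_assoc] }
    have hν : ∀ z, ν (Multiplicative.ofAdd z) =
      Λ (j + 1) * A (z • θ • spinJump j) * (Λ (j + 1))⁻¹ := fun _ => rfl
    have h1 := hζ _ (β j) ν (fun z => by
      have h2 : per _ E (B j) * A (z • θ • spinJump j) * (per _ E (B j))⁻¹ =
          A ((ζ * z) • θ • spinJump j) := by
        simp only [A, B]
        rw [← map_inv, ← map_mul, ← map_mul, rotationAbout_conj_addRight, smul_smul z,
          spinAngle_smul_spinJump, ht0, smul_smul, mul_assoc]
      rw [hν, hν, ← h2, hβ]
      simp [mul_assoc]) 1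
    rw [← h1]
    refine eqOn_letterSubgroup (f := timeEval β j) (fun i hi => ?_) hr
    obtain ⟨h3, h4⟩ := hi
    have : i = 0 ∨ i = 1 := by omega
    rcases this with rfl | rfl
    · simp [timeEval_of]
    · rw [timeEval_of, FreeGroup.lift_apply_of, if_neg one_ne_zero, hν, one_smul, add_comm 1 j, hstep]
  let n : ℤ → FreeGroup ℤ := fun i => FreeGroup.of (i + 1) * (FreeGroup.of i ^ q)⁻¹
  have hn : ∀ i j, timeEval β j (n i) =
      Λ (i + j + 1) * A (θ • spinJump (i + j)) * (Λ (i + j + 1))⁻¹ := by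
    intro i j
    rw [map_mul, map_inv, map_zpow, timeEval_of, timeEval_of, add_right_comm, hstep]
    simp
  have hn1 : ∀ i j, i + j ≠ 0 → i + j ≠ 1 → i + j ≠ 3 → timeEval β j (n i) = 1 := by
    intro i j h0 h1 h3
    rw [hn, spinJump_eq_zero h0 h1 h3]
    simp [A]
  have hA : ∀ (v : Fin 3 → ℂ) (m : ℕ), A v ^ m = A ((m : ℂ) • v) := by
    intro v m
    simp only [A]
    have : (m : ℤ) • v = (m : ℂ) • v := by
      ext i
      simp
    rw [← map_pow, ← zpow_natCast, addRight_zpow, this]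
  have hv : ∀ (i : Fin 3) (c : ℂ), c • (Pi.single i 1 : Fin 3 → ℂ) = Pi.single i c := by
    intro i c
    rw [← Pi.single_smul, smul_eq_mul, mul_one]
  have n0 : timeEval β 0 (n 0) = lab _ E F * A (Pi.single 0 θ) * (lab _ E F)⁻¹ := by
    rw [hn, hΛ1 _ (by omega), add_zero, spinJump_zero, hv]
  have n1 : timeEval β 0 (n 1) = A (Pi.single 1 θ) := by
    rw [hn, hΛ2 _ (by omega) (by omega), add_zero, spinJump_one, hv]
    simp
  have n3 : timeEval β 0 (n 3) = lab _ E G * A (Pi.single 2 θ) * (lab _ E G)⁻¹ := by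
    rw [hn, hΛ3 _ (by omega), add_zero, spinJump_three, hv]
  have hsm : ∀ (i : Fin 3) (m : ℂ), m • (Pi.single i θ : Fin 3 → ℂ) = Pi.single i (m * θ) := by
    intro i m
    rw [← Pi.single_smul, smul_eq_mul]
  have hmom : ⁅lab _ E F * A (Pi.single 0 (K * θ)) * (lab _ E F)⁻¹, A (Pi.single 1 (2 * (K * θ)))⁆ ∈
      momentary β := by
    refine ⟨⁅n 0 ^ K, n 1 ^ (2 * K)⁆, ?_, fun j hj => ?_⟩
    · rw [map_commutatorElement, map_pow, map_pow, n0, n1, conj_pow, hA, hA, hsm, hsm]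
      push_cast
      rw [mul_assoc 2]
    · rw [map_commutatorElement, map_pow, map_pow]
      by_cases h : 0 + j ≠ 0 ∧ 0 + j ≠ 1 ∧ 0 + j ≠ 3
      · rw [hn1 0 j h.1 h.2.1 h.2.2]
        simp
      · rw [hn1 1 j (by omega) (by omega) (by omega)]
        simp
  have hrg : ⁅lab _ E G * A (Pi.single 2 θ) * (lab _ E G)⁻¹, A (Pi.single 1 (K * θ))⁆ ∈
      (timeEval β 0).range := by
    refine ⟨⁅n 3, n 1 ^ K⁆, ?_⟩
    rw [map_commutatorElement, map_pow, n3, n1, hA, hsm]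
  simp only [A] at hmom hrg
  rw [commutator_conj_translate] at hmom hrg
  refine ⟨Fin 3 → ℂ, β, _, _, circleSet, hrel, hmom, hrg, ⟨0, by simp [circleSet]⟩, ?_, ?_⟩
  · exact fun ω hω => ⟨circleSet_value hK (mul_ne_zero two_ne_zero hK0) x hω,
      torusSet_value hK hθ0 y hω⟩
  · intro ω hω
    by_contra hn
    push Not at hn
    exact hω (circleSet_torusSet_disjoint hK x y hn.1 hn.2)

section flip

variable {r : FreeGroup ℤ}

theorem map_sub_left_involutive (n : ℤ) (g : FreeGroup ℤ) :
    FreeGroup.map (n - ·) (FreeGroup.map (n - ·) g) = g := by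
  have : ((n - ·) ∘ (n - ·) : ℤ → ℤ) = id := by
    funext i
    simp
  rw [FreeGroup.map.comp, this]
  exact FreeGroup.map.id g

theorem mem_normalClosure_map_sub_left_iff {n : ℤ} {g : FreeGroup ℤ} :
    g ∈ Subgroup.normalClosure {FreeGroup.map (n - ·) r} ↔
      FreeGroup.map (n - ·) g ∈ Subgroup.normalClosure {r} := by
  constructor <;> intro h
  · simpa only [map_sub_left_involutive] using map_mem_normalClosure (FreeGroup.map (n - ·)) h
  · simpa only [map_sub_left_involutive] using map_mem_normalClosure (FreeGroup.map (n - ·)) h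

theorem map_sub_left_mem {n : ℤ} {S S' : Set ℤ} (hS : ∀ i ∈ S, n - i ∈ S') {g : FreeGroup ℤ}
    (hg : g ∈ letterSubgroup S) : FreeGroup.map (n - ·) g ∈ letterSubgroup S' :=
  map_letterSubgroup_le_iff.2 (fun i hi => by
    rw [FreeGroup.map.of]
    exact of_mem_letterSubgroup (hS i hi)) g hg

theorem expSum_map_sub_left (n i : ℤ) (g : FreeGroup ℤ) :
    expSum i (FreeGroup.map (n - ·) g) = expSum (n - i) g := by
  have : (expSum i).comp (FreeGroup.map (n - ·)) = expSum (n - i) := by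
    ext1 j
    rw [MonoidHom.comp_apply, FreeGroup.map.of]
    by_cases h : j = n - i
    · subst h
      simp [expSum_of_self]
    · rw [expSum_of_ne h, expSum_of_ne (by omega)]
  exact DFunLike.congr_fun this g

theorem ConjGroup.nonempty_equiv_map_sub_left (r : FreeGroup ℤ) (n : ℤ) :
    Nonempty (ConjGroup r ≃* ConjGroup (FreeGroup.map (n - ·) r)) := by
  obtain ⟨e⟩ := ConjGroup.nonempty_equiv_map_neg r
  obtain ⟨f⟩ := ConjGroup.nonempty_equiv_map_add (FreeGroup.map Neg.neg r) n
  rw [FreeGroup.map.comp] at f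
  have : ((· + n) ∘ Neg.neg : ℤ → ℤ) = (n - ·) := by
    funext i
    simp [sub_eq_neg_add]
  rw [this] at f
  exact ⟨e.trans f⟩

theorem not_conjInto_map_sub_left {n i : ℤ} (h : ¬ ConjInto r {n - i}ᶜ) :
    ¬ ConjInto (FreeGroup.map (n - ·) r) {i}ᶜ := by
  rintro ⟨s, hs, hc⟩
  refine h ⟨FreeGroup.map (n - ·) s, map_sub_left_mem (fun j hj => ?_) hs, ?_⟩
  · simpa using hj
  · have := MonoidHom.map_isConj (FreeGroup.map (n - ·)) hc
    rwa [map_sub_left_involutive] at this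

end flip

theorem mem_letterSubgroup_singleton {X : Type} {x : X} {g : FreeGroup X} :
    g ∈ letterSubgroup {x} ↔ ∃ k : ℤ, FreeGroup.of x ^ k = g := by
  rw [letterSubgroup, Set.image_singleton, Subgroup.mem_closure_singleton]

theorem of_zpow_eq_one_iff {X : Type} {x : X} {k : ℤ} : FreeGroup.of x ^ k = 1 ↔ k = 0 := by
  refine ⟨fun h => ?_, fun h => by rw [h, zpow_zero]⟩
  have := congrArg (expSum x) h
  rw [map_zpow, expSum_of_self, map_one (expSum x), ← ofAdd_zsmul, ofAdd_eq_one] at this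
  simpa using this

theorem Ico_zero_one : Set.Ico (0 : ℤ) 1 = {0} := by
  ext i
  simp only [Set.mem_Ico, Set.mem_singleton_iff]
  omega

theorem Ioc_zero_one : Set.Ioc (0 : ℤ) 1 = {1} := by
  ext i
  simp only [Set.mem_Ioc, Set.mem_singleton_iff]
  omega

/-- A relation between powers of two letters is a power of the relator modulo commutators. -/
theorem exists_mul_expSum_eq {r g : FreeGroup ℤ} (hg : g ∈ Subgroup.normalClosure {r}) :
    ∃ m : ℤ, ∀ i, (expSum i g).toAdd = m * (expSum i r).toAdd := by
  let f : FreeGroup ℤ →* (ℤ → Multiplicative ℤ) := MonoidHom.pi fun i => expSum i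
  have h1 := map_mem_normalClosure f hg
  have h2 : Subgroup.normalClosure {f r} ≤ Subgroup.zpowers (f r) :=
    Subgroup.normalClosure_le_normal (by simp)
  obtain ⟨m, hm⟩ := h2 h1
  refine ⟨m, fun i => ?_⟩
  have h3 : expSum i r ^ m = expSum i g := congrFun hm i
  rw [← h3]
  simp

section two_letters

variable {r : FreeGroup ℤ}

theorem sqUniversal_of_unit_expSum {k l : ℤ} (hr : r ∈ letterSubgroup (Set.Icc 0 1))
    (h0 : (expSum 0 r).toAdd ≠ 0) (h1 : |(expSum 1 r).toAdd| = 1)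
    (hk : k ≠ 0) (hl : l ≠ 0)
    (hkl : FreeGroup.of 0 ^ k * (FreeGroup.of 1 ^ l)⁻¹ ∈ Subgroup.normalClosure {r})
    (hq : ∀ q : ℤ, FreeGroup.of 1 * (FreeGroup.of 0 ^ q)⁻¹ ∉ Subgroup.normalClosure {r}) :
    SQUniversal (ConjGroup r) := by
  have h1' : (expSum 1 r).toAdd * (expSum 1 r).toAdd = 1 := by
    rw [← abs_mul_abs_self, h1, one_mul]
  refine sqUniversal_of_zpow_mem (q := -((expSum 0 r).toAdd * (expSum 1 r).toAdd)) ?_ hr ?_ hk hl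
    hkl (hq _)
  · refine neg_ne_zero.2 (mul_ne_zero h0 fun h => ?_)
    rw [h] at h1'
    omega
  · rw [neg_mul, mul_assoc, h1', mul_one, add_neg_cancel]

theorem sqUniversal_of_common_power {k l : ℤ} (hr : r ∈ letterSubgroup (Set.Icc 0 1))
    (hk : k ≠ 0) (hl : l ≠ 0)
    (hkl : FreeGroup.of 0 ^ k * (FreeGroup.of 1 ^ l)⁻¹ ∈ Subgroup.normalClosure {r})
    (h1 : ∀ q : ℤ, FreeGroup.of 1 * (FreeGroup.of 0 ^ q)⁻¹ ∉ Subgroup.normalClosure {r})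
    (h0 : ∀ q : ℤ, FreeGroup.of 0 * (FreeGroup.of 1 ^ q)⁻¹ ∉ Subgroup.normalClosure {r}) :
    SQUniversal (ConjGroup r) := by
  obtain ⟨m, hm⟩ := exists_mul_expSum_eq hkl
  have e0 := hm 0
  have e1 := hm 1
  rw [map_mul, map_inv, map_zpow, map_zpow, expSum_of_self, expSum_of_ne one_ne_zero] at e0
  rw [map_mul, map_inv, map_zpow, map_zpow, expSum_of_self, expSum_of_ne zero_ne_one] at e1
  simp at e0 e1
  have s0 : (expSum 0 r).toAdd ≠ 0 := fun h => hk (by rw [e0, h, mul_zero])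
  have s1 : (expSum 1 r).toAdd ≠ 0 := fun h => hl (by rw [h, mul_zero] at e1; omega)
  have h01 : ∀ i ∈ Set.Icc (0 : ℤ) 1, i = 0 ∨ i = 1 := fun i hi => by
    obtain ⟨h3, h4⟩ := hi
    omega
  by_cases hd : 2 ≤ Int.gcd (expSum 0 r).toAdd (expSum 1 r).toAdd
  · refine sqUniversal_of_dvd hd hr fun i => ?_
    by_cases hi : i ∈ Set.Icc (0 : ℤ) 1
    · rcases h01 i hi with rfl | rfl
      exacts [Int.gcd_dvd_left _ _, Int.gcd_dvd_right _ _]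
    · rw [expSum_eq_one hi hr]
      simp
  have hg : Int.gcd (expSum 0 r).toAdd (expSum 1 r).toAdd = 1 := by
    have := Int.gcd_pos_of_ne_zero_left (expSum 1 r).toAdd s0
    omega
  by_cases hs1 : |(expSum 1 r).toAdd| = 1
  · exact sqUniversal_of_unit_expSum hr s0 hs1 hk hl hkl h1
  by_cases hs0 : |(expSum 0 r).toAdd| = 1
  · obtain ⟨e⟩ := ConjGroup.nonempty_equiv_map_sub_left r 1
    refine SQUniversal.of_mulEquiv e.symm (sqUniversal_of_unit_expSum (k := l) (l := k)
      (map_sub_left_mem (fun i hi => ?_) hr) ?_ ?_ hl hk ?_ fun q => ?_)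
    · rcases h01 i hi with rfl | rfl <;> simp
    · rw [expSum_map_sub_left]
      simpa using s1
    · rw [expSum_map_sub_left]
      simpa using hs0
    · rw [mem_normalClosure_map_sub_left_iff]
      simpa using inv_mem hkl
    · rw [mem_normalClosure_map_sub_left_iff]
      simpa using h0 q
  · have p0 := abs_pos.2 s0
    have p1 := abs_pos.2 s1
    refine sqUniversal_of_isCoprime (p := -(expSum 1 r).toAdd) (q := (expSum 0 r).toAdd) hr ?_ ?_
      ?_ rfl (neg_neg _).symm
    · exact (Int.isCoprime_iff_gcd_eq_one.2 hg).symm.neg_left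
    · rw [abs_neg]; omega
    · omega

theorem sqUniversal_of_interval_one (hr : r ∈ letterSubgroup (Set.Icc 0 1))
    (h0 : ¬ ConjInto r {0}ᶜ) (h1 : ¬ ConjInto r {1}ᶜ)
    (h0m : ∀ u ∈ letterSubgroup (Set.Ioc (0 : ℤ) 1),
      FreeGroup.of 0 * u⁻¹ ∉ Subgroup.normalClosure {r})
    (h1m : ∀ u ∈ letterSubgroup (Set.Ico (0 : ℤ) 1),
      FreeGroup.of 1 * u⁻¹ ∉ Subgroup.normalClosure {r}) :
    SQUniversal (ConjGroup r) := by
  rw [Ioc_zero_one] at h0m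
  rw [Ico_zero_one] at h1m
  by_cases hkl : ∃ k l : ℤ, k ≠ 0 ∧ l ≠ 0 ∧
      FreeGroup.of 0 ^ k * (FreeGroup.of 1 ^ l)⁻¹ ∈ Subgroup.normalClosure {r}
  · obtain ⟨k, l, hk, hl, hkl⟩ := hkl
    exact sqUniversal_of_common_power hr hk hl hkl
      (fun q => h1m _ (mem_letterSubgroup_singleton.2 ⟨q, rfl⟩))
      (fun q => h0m _ (mem_letterSubgroup_singleton.2 ⟨q, rfl⟩))
  push Not at hkl
  obtain ⟨Γ, _, L, t, deg, P, N, hM, hL⟩ := exists_magnusHNN_interval h0 h1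
  have hfree : ∀ k l : ℤ, L (FreeGroup.of 0) ^ k = L (FreeGroup.of 1) ^ l → k = 0 ∧ l = 0 := by
    intro k l h
    have hmem : FreeGroup.of 0 ^ k * (FreeGroup.of 1 ^ l)⁻¹ ∈ Subgroup.normalClosure {r} := by
      rw [← hM.ker, map_mul, map_inv, map_zpow, map_zpow, h, mul_inv_cancel]
    by_cases hk : k = 0
    · subst hk
      refine ⟨rfl, of_zpow_eq_one_iff.1 (inv_eq_one.1 (freiheitssatz h0 ?_
        (by simpa using hmem)))⟩
      exact inv_mem (zpow_mem (of_mem_letterSubgroup (by simp)) _)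
    · by_cases hl : l = 0
      · subst hl
        refine absurd (of_zpow_eq_one_iff.1 (freiheitssatz h1 ?_ (by simpa using hmem))) hk
        exact zpow_mem (of_mem_letterSubgroup (by simp)) _
      · exact absurd hmem (hkl k l hk hl)
  have ht : t * L (FreeGroup.of 0) * t⁻¹ = L (FreeGroup.of 1) := by
    simpa using hM.rel 0 (by simp)
  have hmem : ∀ i (g : Γ), g ∈ (letterSubgroup {i}).map L → ∃ k : ℤ, L (FreeGroup.of i) ^ k = g := by
    rintro i _ ⟨u, hu, rfl⟩
    obtain ⟨k, rfl⟩ := mem_letterSubgroup_singleton.1 hu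
    exact ⟨k, (map_zpow _ _ _).symm⟩
  have hS := hM.half
  rw [Ico_zero_one, Ioc_zero_one] at hS
  refine sqUniversal_of_inter_eq_bot hS (b := L (FreeGroup.of 0)) ?_ hr ⟨_, rfl⟩ ?_
    (fun g hA hB => ?_) (fun k hk hB => ?_) fun k hk hA => ?_
  · rw [hL r hr, hM.ker]
    exact Subgroup.subset_normalClosure rfl
  · rw [ht]
    exact ⟨_, rfl⟩
  · obtain ⟨k, rfl⟩ := hmem 0 g hA
    obtain ⟨l, hl⟩ := hmem 1 _ hB
    rw [(hfree k l hl.symm).1, zpow_zero]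
  · obtain ⟨l, hl⟩ := hmem 1 _ hB
    exact hk (hfree k l hl.symm).1
  · rw [ht] at hA
    obtain ⟨l, hl⟩ := hmem 0 _ hA
    exact hk (hfree l k hl).2

end two_letters

theorem residuallyFinite_of_ascending_int {r u : FreeGroup ℤ} {n : ℤ} (hn0 : 0 ≤ n)
    (hr : r ∈ letterSubgroup (Set.Icc 0 n)) (hn : ¬ ConjInto r {n}ᶜ)
    (hu : u ∈ letterSubgroup (Set.Ico 0 n))
    (hur : FreeGroup.of n * u⁻¹ ∈ Subgroup.normalClosure {r}) : ResiduallyFinite (ConjGroup r) := by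
  lift n to ℕ using hn0
  exact residuallyFinite_of_ascending hr hn hu hur

theorem sqUniversal_or_residuallyFinite_of_interval {r : FreeGroup ℤ} {n : ℤ} (hn0 : 0 ≤ n)
    (hr : r ∈ letterSubgroup (Set.Icc 0 n)) (h0 : ¬ ConjInto r {0}ᶜ) (hn : ¬ ConjInto r {n}ᶜ) :
    SQUniversal (ConjGroup r) ∨ ResiduallyFinite (ConjGroup r) := by
  by_cases hnm : ∃ u ∈ letterSubgroup (Set.Ico 0 n),
      FreeGroup.of n * u⁻¹ ∈ Subgroup.normalClosure {r}
  · obtain ⟨u, hu, hur⟩ := hnm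
    exact Or.inr (residuallyFinite_of_ascending_int hn0 hr hn hu hur)
  by_cases h0m : ∃ u ∈ letterSubgroup (Set.Ioc 0 n),
      FreeGroup.of 0 * u⁻¹ ∈ Subgroup.normalClosure {r}
  · obtain ⟨u, hu, hur⟩ := h0m
    obtain ⟨e⟩ := ConjGroup.nonempty_equiv_map_sub_left r n
    refine Or.inr (ResiduallyFinite.of_mulEquiv e.symm (residuallyFinite_of_ascending_int hn0
      (u := FreeGroup.map (n - ·) u) (map_sub_left_mem (fun i hi => ?_) hr)
      (not_conjInto_map_sub_left (by simpa using h0)) (map_sub_left_mem (fun i hi => ?_) hu) ?_))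
    · obtain ⟨h1, h2⟩ := hi
      exact ⟨by omega, by omega⟩
    · obtain ⟨h1, h2⟩ := hi
      exact ⟨by omega, by omega⟩
    · rw [mem_normalClosure_map_sub_left_iff, map_mul, map_inv, map_sub_left_involutive]
      simpa using hur
  push Not at hnm h0m
  refine Or.inl ?_
  rcases lt_trichotomy n 1 with h | rfl | h
  · obtain rfl : n = 0 := by omega
    rw [Set.Icc_self] at hr
    obtain ⟨k, rfl⟩ := mem_letterSubgroup_singleton.1 hr
    have hk1 : k.natAbs ≠ 1 := by
      intro hk
      refine hnm 1 (one_mem _) ?_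
      rw [inv_one, mul_one]
      have h1 : FreeGroup.of (0 : ℤ) ^ k ∈
          Subgroup.normalClosure {FreeGroup.of (0 : ℤ) ^ k} := Subgroup.subset_normalClosure rfl
      rcases Int.natAbs_eq k with h2 | h2 <;> rw [hk] at h2
      · simpa [h2] using h1
      · simpa [h2] using h1
    have hk0 : k.natAbs ≠ 0 := by
      intro hk
      rw [Int.natAbs_eq_zero] at hk
      subst hk
      exact h0 (conjInto_of_mem (by simp))
    refine sqUniversal_of_dvd (d := k.natAbs) (n := 0) (by omega) (by simpa using hr) fun i => ?_
    rw [map_zpow, toAdd_zpow]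
    exact Dvd.dvd.mul_right (Int.natAbs_dvd.2 dvd_rfl) _
  · exact sqUniversal_of_interval_one hr h0 hn h0m hnm
  · exact sqUniversal_of_two_le (by omega) hr h0 hn h0m hnm

theorem sqUniversal_or_residuallyFinite_conjGroup (r : FreeGroup ℤ) :
    SQUniversal (ConjGroup r) ∨ ResiduallyFinite (ConjGroup r) := by
  by_cases hr : r = 1
  · subst hr
    exact Or.inl (sqUniversal_of_dvd le_rfl (one_mem (letterSubgroup (Set.Icc 0 0))) (by simp))
  · obtain ⟨k, n, r', hn0, hc, hr', h0, hn⟩ := exists_interval hr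
    obtain ⟨e⟩ := ConjGroup.nonempty_equiv_map_add r k
    obtain ⟨f⟩ := ConjGroup.nonempty_equiv_of_isConj hc
    exact (sqUniversal_or_residuallyFinite_of_interval hn0 hr' h0 hn).imp
      (SQUniversal.of_mulEquiv (e.trans f).symm) (ResiduallyFinite.of_mulEquiv (e.trans f).symm)

/-- Any group with a 2-generator 1-relator presentation is either SQ-universal
or residually finite. -/
theorem stmt_13 (w : FreeGroup Bool) :
    SQUniversal (PresentedGroup ({w} : Set (FreeGroup Bool))) ∨
      ResiduallyFinite (PresentedGroup ({w} : Set (FreeGroup Bool))) := by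
  obtain ⟨r, ⟨e⟩⟩ := exists_conjGroup w
  exact (sqUniversal_or_residuallyFinite_conjGroup r).imp (SQUniversal.of_mulEquiv e)
    (ResiduallyFinite.of_mulEquiv e)
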